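/- Let p be a prime with p ≡ 2 (mod 3) and let r ∈ ℕ. Then: if r is even, H_{2,0,3}(p^r) = (p^r/2)·(p^{r+1}−1)/(p−1) − (1/2)·a(p^r); if r is odd, H_{2,0,3}(p^r) = −2·(p^{(3r+3)/2}−1)/(p³−1) + p^r·(p^{r+1}−1)/(p−1) − 2p^r·(p^{⌊(r+1)/2⌋}−1)/(p−1); for m ∈ {1,2}: if r is even, H_{2,m,3}(p^r) = −(p^{3⌊r/2⌋+3}−1)/(p³−1) + (3p^r/4)·(p^{r+1}−1)/(p−1) − p^r·(p^{⌊(r+1)/2⌋}−1)/(p−1) + (1/4)·a(p^r), and if r is odd, H_{2,m,3}(p^r) = (p^r/2)·(p^{r+1}−1)/(p−1). -/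

import Mathlib

open scoped BigOperators

namespace HurwitzPaper

/-- Evaluation of the binary quadratic form `(a,b,c)` (i.e. `a x² + b x y + c y²`). -/
def formEval (Q : ℤ × ℤ × ℤ) (x y : ℤ) : ℤ :=
  Q.1 * x ^ 2 + Q.2.1 * x * y + Q.2.2 * y ^ 2

/-- Discriminant `b² - 4ac` of the form `(a,b,c)`. -/
def formDisc (Q : ℤ × ℤ × ℤ) : ℤ := Q.2.1 ^ 2 - 4 * Q.1 * Q.2.2

/-- Right action of `γ ∈ SL₂(ℤ)` on a binary quadratic form: `(Q∘γ)(x,y) = Q(ax+by, cx+dy)`. -/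
def formAct (γ : Matrix.SpecialLinearGroup (Fin 2) ℤ) (Q : ℤ × ℤ × ℤ) : ℤ × ℤ × ℤ :=
  (formEval Q (γ.1 0 0) (γ.1 1 0),
   formEval Q (γ.1 0 0 + γ.1 0 1) (γ.1 1 0 + γ.1 1 1)
     - formEval Q (γ.1 0 0) (γ.1 1 0) - formEval Q (γ.1 0 1) (γ.1 1 1),
   formEval Q (γ.1 0 1) (γ.1 1 1))

/-- A form is positive definite iff its leading coefficient is positive and its
discriminant is negative. -/
def IsPosDef (Q : ℤ × ℤ × ℤ) : Prop := 0 < Q.1 ∧ formDisc Q < 0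

/-- `SL₂(ℤ)`-equivalence classes of positive definite integral binary quadratic forms
of discriminant `-N`. -/
abbrev FormClasses (N : ℤ) :=
  Quot (fun (Q Q' : {Q : ℤ × ℤ × ℤ // formDisc Q = -N ∧ IsPosDef Q}) =>
    ∃ γ : Matrix.SpecialLinearGroup (Fin 2) ℤ, formAct γ Q.1 = Q'.1)

/-- The Hurwitz class number `H(N)`: each class of positive definite forms of
discriminant `-N` is counted with weight `1/ω_Q = 2/#Γ_Q`, where `Γ_Q` is the stabilizer
of (a representative of) the class in `SL₂(ℤ)`; `H(0) = -1/12`, and `H(N) = 0` when no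
such forms exist (in particular for `N < 0` and `N ≡ 1, 2 (mod 4)`). -/
noncomputable def hurwitzClassNumber (N : ℤ) : ℝ :=
  if N = 0 then -(1 / 12)
  else ∑ᶠ c : FormClasses N,
    (2 : ℝ) / (Nat.card {γ : Matrix.SpecialLinearGroup (Fin 2) ℤ //
      formAct γ c.out.1 = c.out.1})

/-- `H_{κ,m,M}(n) = ∑_{t ≡ m (mod M)} t^κ H(4n - t²)`. -/
noncomputable def HH (κ : ℕ) (m : ℤ) (M : ℕ) (n : ℕ) : ℝ :=
  ∑ᶠ t : ℤ, if t % (M : ℤ) = m % (M : ℤ) then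
    (t : ℝ) ^ κ * hurwitzClassNumber (4 * n - t ^ 2) else 0

/-- `a(n)`: the `n`-th Fourier coefficient of `η(3τ)⁸ = q ∏_{k≥1} (1-q^{3k})⁸`
(the factors with `k > n` do not affect the coefficient of `q^n`). -/
noncomputable def etaCoeff (n : ℕ) : ℤ :=
  Polynomial.coeff (Polynomial.X * ∏ k ∈ Finset.Icc 1 n, (1 - Polynomial.X ^ (3 * k)) ^ 8 : Polynomial ℤ) n


section

/-- finite-support sum bookkeeping -/
def HF {ι : Type*} (g : ι → ℝ) (s : ℝ) : Prop := g.support.Finite ∧ ∑ᶠ i, g i = s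

theorem HF.unique {ι : Type*} {g : ι → ℝ} {s t : ℝ} (h : HF g s) (h' : HF g t) : s = t :=
  h.2.symm.trans h'.2

theorem HF.add {ι : Type*} {g g' : ι → ℝ} {s t : ℝ} (h : HF g s) (h' : HF g' t) :
    HF (fun i => g i + g' i) (s + t) :=
  ⟨(h.1.union h'.1).subset (Function.support_add g g'), by
    rw [finsum_add_distrib h.1 h'.1, h.2, h'.2]⟩

theorem HF.mul {ι : Type*} {g : ι → ℝ} {s : ℝ} (c : ℝ) (h : HF g s) :
    HF (fun i => c * g i) (c * s) :=
  ⟨h.1.subset (fun i hi hh => hi (by simp [hh])), by rw [← mul_finsum, h.2]⟩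

theorem HF.sub {ι : Type*} {g g' : ι → ℝ} {s t : ℝ} (h : HF g s) (h' : HF g' t) :
    HF (fun i => g i - g' i) (s - t) := by
  have := h.add (h'.mul (-1))
  convert this using 1
  · funext i; ring
  · ring

theorem HF.congr {ι : Type*} {g g' : ι → ℝ} {s t : ℝ} (h : HF g s) (e : ∀ i, g' i = g i)
    (hst : s = t) : HF g' t := by
  have : g' = g := funext e
  rw [this, ← hst]; exact h

theorem HF.equiv {ι κ : Type*} {g : ι → ℝ} {s : ℝ} (h : HF g s) (e : κ ≃ ι) :
    HF (fun k => g (e k)) s :=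
  ⟨by
    have : (fun k => g (e k)).support = e ⁻¹' g.support := rfl
    rw [this]; exact h.1.preimage e.injective.injOn, by
    rw [finsum_comp_equiv e, h.2]⟩

theorem HF.of_finset {ι : Type*} {g : ι → ℝ} (s : Finset ι) (h : ∀ i, i ∉ s → g i = 0) :
    HF g (∑ i ∈ s, g i) := by
  have hs : g.support ⊆ s := fun i hi => by
    by_contra hh; exact hi (h i hh)
  exact ⟨s.finite_toSet.subset hs, finsum_eq_sum_of_support_subset g hs⟩

/-- sums over integer quadruples with `xy+zw=n` -/
def HN (n : ℤ) (G : ℤ → ℤ → ℤ → ℤ → ℝ) (s : ℝ) : Prop :=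
  HF (fun v : ℤ × ℤ × ℤ × ℤ =>
    if v.1 * v.2.1 + v.2.2.1 * v.2.2.2 = n then G v.1 v.2.1 v.2.2.1 v.2.2.2 else 0) s

theorem HN.unique {n : ℤ} {G} {s t : ℝ} (h : HN n G s) (h' : HN n G t) : s = t :=
  HF.unique h h'

theorem HN.congr {n : ℤ} {G G'} {s : ℝ} (h : HN n G s)
    (e : ∀ x y z w, x * y + z * w = n → G' x y z w = G x y z w) : HN n G' s := by
  refine HF.congr h ?_ rfl
  rintro ⟨x, y, z, w⟩
  dsimp only
  split_ifs with hh
  · exact e x y z w hh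
  · rfl

theorem HN.add {n : ℤ} {G G'} {s t : ℝ} (h : HN n G s) (h' : HN n G' t) :
    HN n (fun x y z w => G x y z w + G' x y z w) (s + t) :=
  HF.congr (HF.add h h') (by rintro ⟨x, y, z, w⟩; dsimp only; split_ifs <;> simp) rfl

theorem HN.sub {n : ℤ} {G G'} {s t : ℝ} (h : HN n G s) (h' : HN n G' t) :
    HN n (fun x y z w => G x y z w - G' x y z w) (s - t) :=
  HF.congr (HF.sub h h') (by rintro ⟨x, y, z, w⟩; dsimp only; split_ifs <;> simp) rfl

theorem HN.mul {n : ℤ} {G} {s : ℝ} (c : ℝ) (h : HN n G s) :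
    HN n (fun x y z w => c * G x y z w) (c * s) :=
  HF.congr (HF.mul c h) (by rintro ⟨x, y, z, w⟩; dsimp only; split_ifs <;> simp) rfl

theorem HN.equiv {n : ℤ} {G G'} {s : ℝ} (h : HN n G s)
    (f1 f2 f3 f4 g1 g2 g3 g4 : ℤ → ℤ → ℤ → ℤ → ℤ)
    (hd : ∀ x y z w, f1 x y z w * f2 x y z w + f3 x y z w * f4 x y z w = x * y + z * w)
    (h1 : ∀ x y z w, f1 (g1 x y z w) (g2 x y z w) (g3 x y z w) (g4 x y z w) = x ∧
      f2 (g1 x y z w) (g2 x y z w) (g3 x y z w) (g4 x y z w) = y ∧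
      f3 (g1 x y z w) (g2 x y z w) (g3 x y z w) (g4 x y z w) = z ∧
      f4 (g1 x y z w) (g2 x y z w) (g3 x y z w) (g4 x y z w) = w)
    (h2 : ∀ x y z w, g1 (f1 x y z w) (f2 x y z w) (f3 x y z w) (f4 x y z w) = x ∧
      g2 (f1 x y z w) (f2 x y z w) (f3 x y z w) (f4 x y z w) = y ∧
      g3 (f1 x y z w) (f2 x y z w) (f3 x y z w) (f4 x y z w) = z ∧
      g4 (f1 x y z w) (f2 x y z w) (f3 x y z w) (f4 x y z w) = w)
    (e : ∀ x y z w, x * y + z * w = n →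
      G' x y z w = G (f1 x y z w) (f2 x y z w) (f3 x y z w) (f4 x y z w)) : HN n G' s := by
  let E : (ℤ × ℤ × ℤ × ℤ) ≃ (ℤ × ℤ × ℤ × ℤ) :=
    { toFun := fun v => (f1 v.1 v.2.1 v.2.2.1 v.2.2.2, f2 v.1 v.2.1 v.2.2.1 v.2.2.2,
        f3 v.1 v.2.1 v.2.2.1 v.2.2.2, f4 v.1 v.2.1 v.2.2.1 v.2.2.2)
      invFun := fun v => (g1 v.1 v.2.1 v.2.2.1 v.2.2.2, g2 v.1 v.2.1 v.2.2.1 v.2.2.2,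
        g3 v.1 v.2.1 v.2.2.1 v.2.2.2, g4 v.1 v.2.1 v.2.2.1 v.2.2.2)
      left_inv := by
        rintro ⟨x, y, z, w⟩
        obtain ⟨a, b, c, d⟩ := h2 x y z w
        simp only [a, b, c, d]
      right_inv := by
        rintro ⟨x, y, z, w⟩
        obtain ⟨a, b, c, d⟩ := h1 x y z w
        simp only [a, b, c, d] }
  refine HF.congr (HF.equiv h E) ?_ rfl
  rintro ⟨x, y, z, w⟩
  simp only [E, Equiv.coe_fn_mk, hd]
  split_ifs with hh
  · exact e x y z w hh
  · rfl

theorem HN.fin (n : ℤ) (G : ℤ → ℤ → ℤ → ℤ → ℝ) (B : ℤ)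
    (h : ∀ x y z w, x * y + z * w = n → G x y z w ≠ 0 →
      |x| ≤ B ∧ |y| ≤ B ∧ |z| ≤ B ∧ |w| ≤ B) : ∃ s, HN n G s := by
  refine ⟨_, HF.of_finset (Finset.Icc (-B) B ×ˢ Finset.Icc (-B) B ×ˢ Finset.Icc (-B) B ×ˢ
    Finset.Icc (-B) B) ?_⟩
  rintro ⟨x, y, z, w⟩ hv
  dsimp only
  split_ifs with hh
  · by_contra h0
    obtain ⟨a, b, c, d⟩ := h x y z w hh h0
    rw [abs_le] at a b c d
    apply hv
    simp only [Finset.mem_product, Finset.mem_Icc]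
    exact ⟨a, b, c, d⟩
  · rfl

/-- positivity indicator -/
abbrev Pos4 (x y z w : ℤ) : Prop := 0 < x ∧ 0 < y ∧ 0 < z ∧ 0 < w

theorem pos_bd {n x y z w : ℤ} (h : x * y + z * w = n) (p : Pos4 x y z w) :
    x ≤ n ∧ y ≤ n ∧ z ≤ n ∧ w ≤ n := by
  obtain ⟨a, b, c, d⟩ := p
  refine ⟨?_, ?_, ?_, ?_⟩ <;> nlinarith [mul_pos a b, mul_pos c d]

theorem HN.pos (n : ℤ) (G : ℤ → ℤ → ℤ → ℤ → ℝ)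
    (h : ∀ x y z w, G x y z w ≠ 0 → Pos4 x y z w) : ∃ s, HN n G s := by
  refine HN.fin n G n fun x y z w hd h0 => ?_
  have hp := h x y z w h0
  have := pos_bd hd hp
  obtain ⟨a, b, c, d⟩ := hp
  simp only [abs_of_pos, a, b, c, d]
  exact this


end

section

/-- twice the ideal-triangle weight -/
def wt2 (p q r : ℤ) : ℤ :=
  if 0 < p ∧ 0 < q ∧ 0 < r then 2 else
  if 0 ≤ p ∧ 0 ≤ q ∧ 0 ≤ r ∧ 0 < p + q ∧ 0 < q + r ∧ 0 < p + r then 1 else 0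

theorem core1 (p q r t : ℤ) (ht : 0 < t) (hU : 0 < p + q ∧ 0 < q + r ∧ 0 < p + r) :
    ((if t < r ∧ -t < p ∧ -t < q ∧ 0 < p + q then 1 else 0)
      + (if t < p ∧ t < q ∧ -t < r then 1 else 0)
      - (if p < t ∧ q < t ∧ 0 < p + q ∧ -t < r then 1 else 0) - wt2 p q r : ℤ)
    = (if -t < p ∧ p < 0 then 1 else 0)
      + (if -t < q ∧ q < 0 then 1 else 0)
      + (if -t < r ∧ r < 0 then 1 else 0)
      - (if 0 < p ∧ p < t then 1 else 0)
      - (if 0 < q ∧ q < t then 1 else 0)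
      - (if 0 < r ∧ r < t then 1 else 0)
      - (if r = t then 1 else 0)
      - (if t ≤ p ∧ t ≤ q ∧ (p = t ∨ q = t) then 1 else 0) := by
  unfold wt2
  rcases lt_trichotomy p 0 with hp | hp | hp <;> rcases lt_trichotomy q 0 with hq | hq | hq <;>
    rcases lt_trichotomy r 0 with hr | hr | hr <;> first | (exfalso; omega) | skip
  all_goals
    rcases lt_trichotomy p t with hp1 | hp1 | hp1 <;> rcases lt_trichotomy q t with hq1 | hq1 | hq1 <;>
    rcases lt_trichotomy r t with hr1 | hr1 | hr1 <;> first | (exfalso; omega) | skip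
  all_goals grind

theorem core2 (p q r t : ℤ) (ht : 0 < t) (hU : ¬ (0 < p + q ∧ 0 < q + r ∧ 0 < p + r)) :
    ((if t < r ∧ -t < p ∧ -t < q ∧ 0 < p + q then 1 else 0)
      + (if t < p ∧ t < q ∧ -t < r then 1 else 0)
      - (if p < t ∧ q < t ∧ 0 < p + q ∧ -t < r then 1 else 0) - wt2 p q r : ℤ)
    = 
      - (if 0 < p ∧ p < t ∧ 0 < p + q ∧ 0 < p + r then 1 else 0)
      - (if 0 < q ∧ q < t ∧ 0 < p + q ∧ 0 < q + r then 1 else 0)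
      - (if -t < r ∧ r < 0 ∧ p + r ≤ 0 ∧ q + r ≤ 0 ∧ 0 < p + q then 1 else 0) := by
  unfold wt2
  by_cases h1 : 0 < p + q
  · by_cases h2 : 0 < q + r <;> by_cases h3 : 0 < p + r <;>
    rcases lt_or_ge p t with hp1 | hp1 <;> rcases lt_or_ge q t with hq1 | hq1 <;>
    first | (exfalso; omega) | grind
  · grind

end

section

theorem core3 (p q r t : ℤ) (ht : 0 < t) :
    ((if t < r ∧ -t < p ∧ -t < q ∧ 0 < p + q then 1 else 0)
      + (if t < p ∧ t < q ∧ -t < r then 1 else 0)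
      - (if p < t ∧ q < t ∧ 0 < p + q ∧ -t < r then 1 else 0) - wt2 p q r : ℤ)
    = (if -t < p ∧ p < 0 ∧ 0 < p + q ∧ 0 < p + r then 1 else 0)
      + (if -t < q ∧ q < 0 ∧ 0 < p + q ∧ 0 < q + r then 1 else 0)
      + (if -t < r ∧ r < 0 ∧ 0 < p + r ∧ 0 < q + r then 1 else 0)
      - (if 0 < p ∧ p < t ∧ 0 < p + q ∧ 0 < p + r then 1 else 0)
      - (if 0 < q ∧ q < t ∧ 0 < p + q ∧ 0 < q + r then 1 else 0)
      - (if 0 < r ∧ r < t ∧ 0 < p + r ∧ 0 < q + r ∧ 0 < p + q then 1 else 0)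
      - (if -t < r ∧ r < 0 ∧ p + r ≤ 0 ∧ q + r ≤ 0 ∧ 0 < p + q then 1 else 0)
      - (if r = t ∧ 0 < p + r ∧ 0 < q + r ∧ 0 < p + q then 1 else 0)
      - (if t ≤ p ∧ t ≤ q ∧ (p = t ∨ q = t) ∧ 0 < p + r ∧ 0 < q + r then 1 else 0) := by
  by_cases hU : 0 < p + q ∧ 0 < q + r ∧ 0 < p + r
  · rw [core1 p q r t ht hU]
    obtain ⟨h1, h2, h3⟩ := hU
    have e : ¬ (p + r ≤ 0) := by omega
    simp [h1, h2, h3, e]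
  · rw [core2 p q r t ht hU]
    have e1 : ¬ (-t < p ∧ p < 0 ∧ 0 < p + q ∧ 0 < p + r) := by omega
    have e2 : ¬ (-t < q ∧ q < 0 ∧ 0 < p + q ∧ 0 < q + r) := by omega
    have e3 : ¬ (-t < r ∧ r < 0 ∧ 0 < p + r ∧ 0 < q + r) := by omega
    have e4 : ¬ (0 < r ∧ r < t ∧ 0 < p + r ∧ 0 < q + r ∧ 0 < p + q) := by omega
    have e5 : ¬ (r = t ∧ 0 < p + r ∧ 0 < q + r ∧ 0 < p + q) := by omega
    have e6 : ¬ (t ≤ p ∧ t ≤ q ∧ (p = t ∨ q = t) ∧ 0 < p + r ∧ 0 < q + r) := by omega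
    rw [if_neg e1, if_neg e2, if_neg e3, if_neg e4, if_neg e5, if_neg e6]
    ring

theorem HN.div (n : ℕ) (hn : 0 < n) (I : ℤ → ℤ → Finset ℤ) (F : ℤ → ℤ → ℤ → ℝ) :
    HN n (fun x y z w => if w = 0 ∧ 0 < x ∧ z ∈ I x y then F x y z else 0)
      (∑ u ∈ n.divisorsAntidiagonal, ∑ z ∈ I u.1 u.2, F u.1 u.2 z) := by
  classical
  let s : Finset (ℤ × ℤ × ℤ × ℤ) := n.divisorsAntidiagonal.biUnion fun u =>
    (I u.1 u.2).image fun z => ((u.1 : ℤ), (u.2 : ℤ), z, (0 : ℤ))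
  refine HF.congr (HF.of_finset s ?_) (fun _ => rfl) ?_
  · rintro ⟨x, y, z, w⟩ hv
    dsimp only
    split_ifs with hd hc
    · exfalso
      apply hv
      obtain ⟨rfl, hx, hz⟩ := hc
      simp only [mul_zero, add_zero] at hd
      have hy : 0 < y := by
        have : (0:ℤ) < x * y := by rw [hd]; exact_mod_cast hn
        exact (mul_pos_iff_of_pos_left hx).mp this
      simp only [s, Finset.mem_biUnion, Finset.mem_image]
      refine ⟨(x.toNat, y.toNat), ?_, z, ?_, ?_⟩
      · rw [Nat.mem_divisorsAntidiagonal]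
        refine ⟨?_, hn.ne'⟩
        zify
        rw [Int.toNat_of_nonneg hx.le, Int.toNat_of_nonneg hy.le, hd]
      · simpa [Int.toNat_of_nonneg hx.le, Int.toNat_of_nonneg hy.le] using hz
      · simp [Int.toNat_of_nonneg hx.le, Int.toNat_of_nonneg hy.le]
    · rfl
    · rfl
  · rw [Finset.sum_biUnion]
    · refine Finset.sum_congr rfl fun u hu => ?_
      rw [Nat.mem_divisorsAntidiagonal] at hu
      rw [Finset.sum_image]
      · refine Finset.sum_congr rfl fun z hz => ?_
        have h1 : ((u.1 : ℤ) * u.2 + z * 0 = n) := by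
          rw [← hu.1]; push_cast; ring
        have h2 : (0:ℤ) < u.1 := by
          have : 0 < u.1 := Nat.pos_of_ne_zero (by rintro h; apply hu.2; rw [← hu.1, h]; simp)
          exact_mod_cast this
        dsimp only
        rw [if_pos h1, if_pos ⟨rfl, h2, hz⟩]
      · intro a _ b _ h
        simpa using h
    · intro u hu v hv huv
      rw [Function.onFun, Finset.disjoint_left]
      rintro a ha hb
      simp only [Finset.mem_image] at ha hb
      obtain ⟨z, _, rfl⟩ := ha
      obtain ⟨z', _, h⟩ := hb
      apply huv
      simp only [Prod.mk.injEq, Nat.cast_inj] at h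
      exact Prod.ext h.1.symm h.2.1.symm


end

section

theorem HN.ex_of {n : ℤ} {G G'} {s : ℝ} (h : HN n G s)
    (e : ∀ x y z w, x * y + z * w = n → G' x y z w ≠ 0 → G x y z w ≠ 0) : ∃ s', HN n G' s' := by
  refine ⟨_, ?_, rfl⟩
  refine h.1.subset ?_
  rintro ⟨x, y, z, w⟩ hv
  simp only [Function.mem_support] at hv ⊢
  split_ifs at hv ⊢ with hd
  · exact e x y z w hd hv
  · exact hv

abbrev ind (P : Prop) [Decidable P] (a : ℝ) : ℝ := if P then a else 0

theorem ind_eq (P : Prop) [Decidable P] (a : ℝ) : ind P a = a * ((if P then 1 else 0 : ℤ) : ℝ) := by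
  unfold ind; split_ifs <;> simp

theorem pV (x y z w : ℤ) (a : ℝ) :
    (if y - x < 2 * z ∧ z < y ∧ 0 ≤ z ∧ 0 ≤ x + z + w - y ∧ w < 0 then a else 0) =
    (if y - x < 2 * z ∧ z < y ∧ 0 < z ∧ 0 < x + z + w - y then a else 0)
    - (if y - x < 2 * z ∧ z < y ∧ 0 < z ∧ 0 < x + z + w - y ∧ 0 < w then a else 0)
    - (if w = 0 ∧ y - x < 2 * z ∧ z < y ∧ 0 < z ∧ 0 < x + z + w - y then a else 0)
    + (if z = 0 ∧ w < 0 ∧ z < y ∧ y - x < 2 * z ∧ 0 ≤ x + z + w - y then a else 0)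
    + (if 0 ≤ z ∧ w < 0 ∧ z < y ∧ y - x < 2 * z ∧ x + z + w - y = 0 then a else 0)
    - (if z = 0 ∧ w < 0 ∧ z < y ∧ y - x < 2 * z ∧ x + z + w - y = 0 then a else 0) := by
  by_cases h : y - x < 2 * z ∧ z < y
  · obtain ⟨h1, h2⟩ := h
    simp only [h1, h2, true_and]
    generalize x + z + w - y = X
    clear h1 h2
    split_ifs <;> first | (exfalso; omega) | ring
  · rw [if_neg (by omega), if_neg (by omega), if_neg (by omega), if_neg (by omega), if_neg (by omega),
      if_neg (by omega), if_neg (by omega)]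
    ring

theorem pT (x y z w : ℤ) (a : ℝ) :
    (if 0 < x + y ∧ x ≤ 0 ∧ y ≤ w ∧ (x = 0 ∨ y = w) ∧ 0 < z ∧ 0 < x + z + w - y then a else 0) =
    (if x = 0 ∧ 0 < x + y ∧ y ≤ w ∧ 0 < z ∧ 0 < x + z + w - y then a else 0)
    + (if y = w ∧ x ≤ 0 ∧ 0 < x + y ∧ 0 < z ∧ 0 < x + z + w - y then a else 0)
    - (if x = 0 ∧ y = w ∧ 0 < x + y ∧ 0 < z ∧ 0 < x + z + w - y then a else 0) := by
  by_cases h : 0 < x + y ∧ 0 < z ∧ 0 < x + z + w - y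
  · obtain ⟨h1, h2, h3⟩ := h
    simp only [h1, h2, h3, true_and, and_true]
    by_cases hx : x = 0 <;> by_cases hy : y = w <;> simp [hx, hy]
  · rw [if_neg (by omega), if_neg (by omega), if_neg (by omega), if_neg (by omega)]
    ring

set_option maxHeartbeats 4000000 in
theorem partB (n : ℕ) (hn : 0 < n) (f : ℤ → ℝ) (hf : ∀ t, f (-t) = f t) (f0 : f 0 = 0)
    (A B : ℝ) (hA : HN n (fun x y z w => ind (Pos4 x y z w) (f (x + y - z))) A)
    (hB : HN n (fun x y z w => ind (Pos4 x y z w) (f (x + y + z))) B) :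
    HN n (fun x y z w => ind (0 < x + y)
      ((wt2 (y - x) (2 * w - y + x) (2 * z - y + x) : ℝ) * f (x + y)))
     (A - B
      - (∑ u ∈ n.divisorsAntidiagonal, ∑ z ∈ Finset.Ioo (max 0 ((u.2:ℤ) - u.1)) u.2, f (u.1 + u.2))
      + (∑ u ∈ n.divisorsAntidiagonal, ∑ z ∈ Finset.Ico ((u.2:ℤ) - u.1) 0, f (u.1 + u.2))
      + (∑ u ∈ n.divisorsAntidiagonal, ∑ z ∈ Finset.Ico 0 ((u.1:ℤ) - u.2), f (u.1 + u.2))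
      - (∑ u ∈ n.divisorsAntidiagonal, ∑ z ∈ (if (u.2:ℤ) < u.1 then {0} else (∅:Finset ℤ)), f (u.1 + u.2))
      + (∑ u ∈ n.divisorsAntidiagonal, ∑ z ∈ Finset.Ioo 0 ((u.1:ℤ) + u.2), f (u.1 + u.2 - z))
      + (∑ u ∈ n.divisorsAntidiagonal, ∑ z ∈ Finset.Ioc 0 (u.2:ℤ), f z)
      + (∑ u ∈ n.divisorsAntidiagonal, ∑ z ∈ Finset.Ioc (-(u.2:ℤ)) 0, f (u.2 + z))
      - (∑ u ∈ n.divisorsAntidiagonal, ∑ z ∈ {(u.2 : ℤ)}, f z)) := by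
  have hn' : (0:ℤ) < n := by exact_mod_cast hn
  -- divisor pieces
  have dZ1 := HN.div n hn (fun x y => Finset.Ioo (max 0 (y - x)) y) (fun x y z => f (x + y))
  have dZa := HN.div n hn (fun x y => Finset.Ico (y - x) 0) (fun x y z => f (x + y))
  have dZb := HN.div n hn (fun x y => Finset.Ico 0 (x - y)) (fun x y z => f (x + y))
  have dZc := HN.div n hn (fun x y => if y < x then {0} else ∅) (fun x y z => f (x + y))
  have dT1 := HN.div n hn (fun x y => Finset.Ioo 0 (x + y)) (fun x y z => f (x + y - z))
  have dTa := HN.div n hn (fun x y => Finset.Ioc 0 y) (fun x y z => f z)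
  have dTb := HN.div n hn (fun x y => Finset.Ioc (-y) 0) (fun x y z => f (y + z))
  have dTc := HN.div n hn (fun x y => {y}) (fun x y z => f z)
  generalize (∑ u ∈ n.divisorsAntidiagonal, ∑ z ∈ Finset.Ioo (max 0 ((u.2:ℤ) - u.1)) u.2, f (u.1 + u.2)) = Z1 at *
  generalize (∑ u ∈ n.divisorsAntidiagonal, ∑ z ∈ Finset.Ico ((u.2:ℤ) - u.1) 0, f (u.1 + u.2)) = Za at *
  generalize (∑ u ∈ n.divisorsAntidiagonal, ∑ z ∈ Finset.Ico 0 ((u.1:ℤ) - u.2), f (u.1 + u.2)) = Zb at *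
  generalize (∑ u ∈ n.divisorsAntidiagonal, ∑ z ∈ (if (u.2:ℤ) < u.1 then {0} else (∅:Finset ℤ)), f (u.1 + u.2)) = Zc at *
  generalize (∑ u ∈ n.divisorsAntidiagonal, ∑ z ∈ Finset.Ioo 0 ((u.1:ℤ) + u.2), f (u.1 + u.2 - z)) = T1 at *
  generalize (∑ u ∈ n.divisorsAntidiagonal, ∑ z ∈ Finset.Ioc 0 (u.2:ℤ), f z) = Ta at *
  generalize (∑ u ∈ n.divisorsAntidiagonal, ∑ z ∈ Finset.Ioc (-(u.2:ℤ)) 0, f (u.2 + z)) = Tb at *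
  generalize (∑ u ∈ n.divisorsAntidiagonal, ∑ z ∈ {(u.2 : ℤ)}, f z) = Tc at *
  have ypos : ∀ x y z w : ℤ, x * y + z * w = n → w = 0 → 0 < x → 0 < y := by
    intro x y z w h hw hx
    subst hw
    have : 0 < x * y := by linarith
    exact (mul_pos_iff_of_pos_left hx).mp this
  have ypos' : ∀ x y z w : ℤ, x * y + z * w = n → w = 0 → 0 < y → 0 < x := by
    intro x y z w h hw hx
    exact ypos y x z w (by linarith) hw hx
  -- F1
  have hF1 : HN n (fun x y z w => ind (y < z ∧ 0 < y ∧ 0 < x + w ∧ 0 < w) (f (x + y))) A := by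
    refine hA.equiv (fun x y z w => x + w) (fun x y z w => y) (fun x y z w => w)
      (fun x y z w => z - y) (fun x y z w => x - z) (fun x y z w => y) (fun x y z w => y + w)
      (fun x y z w => z) (by intros; ring) (by intros; simp) (by intros; simp) ?_
    intro x y z w _
    have e : x + w + y - w = x + y := by ring
    simp only [ind, Pos4, e]
    congr 1
    apply propext; omega
  obtain ⟨a1, hF1p⟩ := hF1.ex_of (G' := fun x y z w =>
    ind (0 < x + y ∧ y < z ∧ 0 < y ∧ 0 < x + w ∧ 0 < w) (f (x + y))) (by
      intro x y z w _ h
      simp only [ind, ne_eq, ite_eq_right_iff, Classical.not_imp] at h ⊢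
      tauto)
  have hF1n : HN n (fun x y z w =>
    ind (x + y < 0 ∧ y < z ∧ 0 < y ∧ 0 < x + w ∧ 0 < w) (f (x + y))) (A - a1) := by
    refine (hF1.sub hF1p).congr ?_
    intro x y z w _
    simp only [ind]
    rcases lt_trichotomy (x + y) 0 with h | h | h
    · have h' : ¬ (0 < x + y) := by omega
      simp [h, h']
    · simp [h, f0]
    · have h' : ¬ (x + y < 0) := by omega
      simp [h, h']
  have hF2 : HN n (fun x y z w =>
    ind (0 < x + y ∧ x < 0 ∧ y < w ∧ 0 < x + z) (f (x + y))) (A - a1) := by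
    refine hF1n.equiv (fun x y z w => -y) (fun x y z w => -x) (fun x y z w => z)
      (fun x y z w => w) (fun x y z w => -y) (fun x y z w => -x) (fun x y z w => z)
      (fun x y z w => w) (by intros; ring) (by intros; simp) (by intros; simp) ?_
    intro x y z w _
    have e : f (-y + -x) = f (x + y) := by rw [← hf]; congr 1; ring
    simp only [ind, e]
    congr 1
    apply propext; omega
  have hF3 : HN n (fun x y z w =>
    ind (0 < x + y ∧ 0 < x ∧ w < y ∧ 0 < w ∧ 0 < x + z) (f (x + y))) B := by
    refine hB.equiv (fun x y z w => x) (fun x y z w => y - w) (fun x y z w => w)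
      (fun x y z w => x + z) (fun x y z w => x) (fun x y z w => y + z) (fun x y z w => w - x)
      (fun x y z w => z) (by intros; ring) (by intros; simp) (by intros; simp) ?_
    intro x y z w _
    have e : x + (y - w) + w = x + y := by ring
    simp only [ind, Pos4, e]
    congr 1
    apply propext; omega
  -- P
  obtain ⟨P, hPp⟩ := HN.pos n (fun x y z w => ind (0 < y ∧ y < x ∧ 0 < w ∧ 0 < z) (f (x + y))) (by
    intro x y z w h
    simp only [ind, ne_eq, ite_eq_right_iff, Classical.not_imp] at h
    simp only [Pos4]; omega)
  have hcyc : ∀ {G : ℤ → ℤ → ℤ → ℤ → ℝ} {s : ℝ}, HN n G s →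
      HN n (fun x y z w => G (y - w) (x + w) w (x + z + w - y)) s := by
    intro G s h
    refine h.equiv (fun x y z w => y - w) (fun x y z w => x + w) (fun x y z w => w)
      (fun x y z w => x + z + w - y) (fun x y z w => y - z) (fun x y z w => x + z)
      (fun x y z w => w + x + z - y) (fun x y z w => z)
      (by intros; ring) (by intros; refine ⟨?_, ?_, ?_, ?_⟩ <;> ring) (by intros; refine ⟨?_, ?_, ?_, ?_⟩ <;> ring) (fun _ _ _ _ _ => rfl)
  have hflip : ∀ {G : ℤ → ℤ → ℤ → ℤ → ℝ} {s : ℝ}, HN n G s → HN n (fun x y z w => G y x z w) s := by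
    intro G s h
    refine h.equiv (fun x y z w => y) (fun x y z w => x) (fun x y z w => z)
      (fun x y z w => w) (fun x y z w => y) (fun x y z w => x)
      (fun x y z w => z) (fun x y z w => w)
      (by intros; ring) (by intros; simp) (by intros; simp) (fun _ _ _ _ _ => rfl)
  have hPp' : HN n (fun x y z w => ind (x < y ∧ 0 < x ∧ 0 < w ∧ 0 < z) (f (x + y))) P := by
    refine (hflip hPp).congr fun x y z w _ => ?_
    simp only [ind, add_comm y x]
    congr 1; apply propext; omega
  have ec : ∀ x y w : ℤ, y - w + (x + w) = x + y := by intros; ring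
  have hPq : HN n (fun x y z w => ind (0 < x + w ∧ 2 * w < y - x ∧ 0 < w ∧ 0 < x + z + w - y) (f (x + y))) P := by
    refine (hcyc hPp).congr fun x y z w _ => ?_
    simp only [ind, ec]
    congr 1; apply propext; omega
  have hPr : HN n (fun x y z w => ind (0 < x + z ∧ 2 * z < y - x ∧ 0 < z ∧ 0 < x + z + w - y) (f (x + y))) P := by
    refine (hcyc hPq).congr fun x y z w _ => ?_
    simp only [ind, ec]
    congr 1; apply propext; omega
  have hPq' : HN n (fun x y z w => ind (y - x < 2 * w ∧ w < y ∧ 0 < w ∧ 0 < x + z + w - y) (f (x + y))) P := by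
    refine (hcyc hPp').congr fun x y z w _ => ?_
    simp only [ind, ec]
    congr 1; apply propext; omega
  have hPr' : HN n (fun x y z w => ind (y - x < 2 * z ∧ z < y ∧ 0 < z ∧ 0 < x + z + w - y) (f (x + y))) P := by
    refine (hcyc hPq').congr fun x y z w _ => ?_
    simp only [ind, ec]
    congr 1; apply propext; omega
  have hZ1 : HN n (fun x y z w => ind (w = 0 ∧ y - x < 2 * z ∧ z < y ∧ 0 < z ∧ 0 < x + z + w - y) (f (x + y))) Z1 := by
    refine dZ1.congr fun x y z w h => ?_
    simp only [ind, Finset.mem_Ioo, max_lt_iff]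
    congr 1; apply propext
    constructor
    · rintro ⟨hw, h1⟩
      have := ypos' x y z w h hw (by omega)
      omega
    · rintro ⟨hw, h1⟩
      omega
  have hZa : HN n (fun x y z w => ind (z = 0 ∧ w < 0 ∧ z < y ∧ y - x < 2 * z ∧ 0 ≤ x + z + w - y) (f (x + y))) Za := by
    refine dZa.equiv (fun x y z w => x) (fun x y z w => y) (fun x y z w => w)
      (fun x y z w => z) (fun x y z w => x) (fun x y z w => y)
      (fun x y z w => w) (fun x y z w => z)
      (by intros; ring) (by intros; simp) (by intros; simp) (fun x y z w h => ?_)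
    simp only [ind, Finset.mem_Ico]
    congr 1; apply propext
    constructor
    · rintro ⟨hw, h1⟩
      omega
    · rintro ⟨hw, h1⟩
      have := ypos x y w z (by linarith) hw (by omega)
      omega
  have hZb : HN n (fun x y z w => ind (0 ≤ z ∧ w < 0 ∧ z < y ∧ y - x < 2 * z ∧ x + z + w - y = 0) (f (x + y))) Zb := by
    refine dZb.equiv (fun x y z w => x + z) (fun x y z w => y - z) (fun x y z w => z)
      (fun x y z w => x + z + w - y) (fun x y z w => x - z) (fun x y z w => y + z)
      (fun x y z w => z) (fun x y z w => w + y + z - x)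
      (by intros; ring) (by intros; refine ⟨?_, ?_, ?_, ?_⟩ <;> ring) (by intros; refine ⟨?_, ?_, ?_, ?_⟩ <;> ring) (fun x y z w h => ?_)
    have e : x + z + (y - z) = x + y := by ring
    simp only [ind, Finset.mem_Ico, e]
    congr 1; apply propext
    constructor
    · rintro ⟨hw, h1⟩
      omega
    · rintro ⟨hw, h1⟩
      have := ypos (x + z) (y - z) z (x + z + w - y) (by linarith) hw (by omega)
      omega
  have hZc : HN n (fun x y z w => ind (z = 0 ∧ w < 0 ∧ z < y ∧ y - x < 2 * z ∧ x + z + w - y = 0) (f (x + y))) Zc := by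
    refine dZc.equiv (fun x y z w => x + z) (fun x y z w => y - z) (fun x y z w => z)
      (fun x y z w => x + z + w - y) (fun x y z w => x - z) (fun x y z w => y + z)
      (fun x y z w => z) (fun x y z w => w + y + z - x)
      (by intros; ring) (by intros; refine ⟨?_, ?_, ?_, ?_⟩ <;> ring) (by intros; refine ⟨?_, ?_, ?_, ?_⟩ <;> ring) (fun x y z w h => ?_)
    have e : x + z + (y - z) = x + y := by ring
    simp only [ind, e]
    congr 1; apply propext
    constructor
    · rintro ⟨hw, h1⟩
      have : y - z < x + z := by omega
      rw [if_pos this]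
      simp only [Finset.mem_singleton]
      omega
    · rintro ⟨hw, h1, h2⟩
      have := ypos (x + z) (y - z) z (x + z + w - y) (by linarith) hw (by omega)
      split_ifs at h2 with h3
      · simp only [Finset.mem_singleton] at h2
        omega
      · simp at h2
  obtain ⟨u, hU⟩ := hPr'.ex_of (G' := fun x y z w =>
    ind (y - x < 2 * z ∧ z < y ∧ 0 < z ∧ 0 < x + z + w - y ∧ 0 < w) (f (x + y))) (by
      intro x y z w _ h
      simp only [ind, ne_eq, ite_eq_right_iff, Classical.not_imp] at h ⊢
      tauto)
  have hV : HN n (fun x y z w =>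
    ind (y - x < 2 * z ∧ z < y ∧ 0 ≤ z ∧ 0 ≤ x + z + w - y ∧ w < 0) (f (x + y)))
      (P - u - Z1 + Za + Zb - Zc) := by
    refine (((((hPr'.sub hU).sub hZ1).add hZa).add hZb).sub hZc).congr fun x y z w _ => ?_
    simp only [ind]
    generalize f (x + y) = a
    exact pV x y z w a
  have hIII : HN n (fun x y z w =>
    ind (0 < x + z ∧ 2 * z < y - x ∧ z ≤ 0 ∧ x + z + w - y ≤ 0 ∧ 0 < w) (f (x + y)))
      (P - u - Z1 + Za + Zb - Zc) := by
    refine hV.equiv (fun x y z w => y) (fun x y z w => x) (fun x y z w => -z)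
      (fun x y z w => -w) (fun x y z w => y) (fun x y z w => x) (fun x y z w => -z)
      (fun x y z w => -w) (by intros; ring) (by intros; simp) (by intros; simp) ?_
    intro x y z w _
    simp only [ind, add_comm y x]
    congr 1
    apply propext; omega
  have hT1 : HN n (fun x y z w => ind (0 < x + y ∧ z = y ∧ 0 < z ∧ 0 < x + z + w - y ∧ 0 < w) (f (x + y))) T1 := by
    refine dT1.equiv (fun x y z w => x + w) (fun x y z w => y) (fun x y z w => w)
      (fun x y z w => z - y) (fun x y z w => x - z) (fun x y z w => y) (fun x y z w => y + w)
      (fun x y z w => z) (by intros; ring) (by intros; simp) (by intros; simp) ?_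
    intro x y z w h
    have e : x + w + y - w = x + y := by ring
    simp only [ind, Finset.mem_Ioo, e]
    congr 1
    apply propext
    constructor
    · omega
    · rintro ⟨hw, h1⟩
      have := ypos (x + w) (y) w (z - y) (by linarith) hw (by omega)
      omega
  have hTa : HN n (fun x y z w => ind (x = 0 ∧ 0 < x + y ∧ y ≤ w ∧ 0 < z ∧ 0 < x + z + w - y) (f (x + y))) Ta := by
    refine dTa.equiv (fun x y z w => z) (fun x y z w => w) (fun x y z w => y)
      (fun x y z w => x) (fun x y z w => w) (fun x y z w => z) (fun x y z w => x)
      (fun x y z w => y) (by intros; ring) (by intros; simp) (by intros; simp) ?_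
    intro x y z w h
    simp only [ind, Finset.mem_Ioc]
    by_cases hx : x = 0
    · subst hx
      simp only [zero_add, true_and]
      congr 1
      apply propext
      omega
    · simp [hx]
  have hTb : HN n (fun x y z w => ind (y = w ∧ x ≤ 0 ∧ 0 < x + y ∧ 0 < z ∧ 0 < x + z + w - y) (f (x + y))) Tb := by
    refine dTb.equiv (fun x y z w => x + z) (fun x y z w => w) (fun x y z w => x)
      (fun x y z w => y - w) (fun x y z w => z) (fun x y z w => w + y) (fun x y z w => x - z)
      (fun x y z w => y) (by intros; ring) (by intros; simp) (by intros; simp) ?_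
    intro x y z w h
    simp only [ind, Finset.mem_Ioc]
    by_cases hx : y = w
    · subst hx
      have e : y + x = x + y := by ring
      simp only [e, sub_self, true_and]
      congr 1
      apply propext
      omega
    · have : ¬ (y - w = 0) := by omega
      simp [hx, this]
  have hTc : HN n (fun x y z w => ind (x = 0 ∧ y = w ∧ 0 < x + y ∧ 0 < z ∧ 0 < x + z + w - y) (f (x + y))) Tc := by
    refine dTc.equiv (fun x y z w => z) (fun x y z w => w) (fun x y z w => y)
      (fun x y z w => x) (fun x y z w => w) (fun x y z w => z) (fun x y z w => x)
      (fun x y z w => y) (by intros; ring) (by intros; simp) (by intros; simp) ?_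
    intro x y z w h
    simp only [ind, Finset.mem_singleton]
    by_cases hx : x = 0
    · subst hx
      simp only [zero_add, true_and]
      congr 1
      apply propext
      constructor
      · omega
      · rintro ⟨hz, rfl⟩
        have : 0 < z * y := by linarith
        have := (mul_pos_iff_of_pos_left hz).mp this
        omega
    · simp [hx]
  have hT2 : HN n (fun x y z w => ind (0 < x + y ∧ x ≤ 0 ∧ y ≤ w ∧ (x = 0 ∨ y = w) ∧ 0 < z ∧ 0 < x + z + w - y) (f (x + y))) (Ta + Tb - Tc) := by
    refine ((hTa.add hTb).sub hTc).congr fun x y z w _ => ?_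
    simp only [ind]
    generalize f (x + y) = a
    exact pT x y z w a
  have fin := ((((((((((((hF1p.add hF2).sub hF3).sub hPp).sub hPq).sub hPr).add hPp').add hPq').add hU).add hIII).add hT1).add hT2))
  have es : a1 + (A - a1) - B - P - P - P + P + P + u + (P - u - Z1 + Za + Zb - Zc) + T1 + (Ta + Tb - Tc)
    = A - B - Z1 + Za + Zb - Zc + T1 + Ta + Tb - Tc := by ring
  rw [← es]
  refine fin.congr fun x y z w _ => ?_
  by_cases ht : 0 < x + y
  · have key := core3 (y - x) (2 * w - y + x) (2 * z - y + x) (x + y) ht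
    have c1 : (x + y < 2 * z - y + x ∧ -(x+y) < y - x ∧ -(x+y) < 2 * w - y + x ∧ 0 < y - x + (2 * w - y + x)) ↔
      (0 < x + y ∧ y < z ∧ 0 < y ∧ 0 < x + w ∧ 0 < w) := by omega
    have c2 : (x + y < y - x ∧ x+y < 2 * w - y + x ∧ -(x+y) < 2 * z - y + x) ↔
      (0 < x + y ∧ x < 0 ∧ y < w ∧ 0 < x + z) := by omega
    have c3 : (y - x < x + y ∧ 2 * w - y + x < x + y ∧ 0 < y - x + (2 * w - y + x) ∧ -(x+y) < 2 * z - y + x) ↔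
      (0 < x + y ∧ 0 < x ∧ w < y ∧ 0 < w ∧ 0 < x + z) := by omega
    have c4 : (-(x+y) < y - x ∧ y - x < 0 ∧ 0 < y - x + (2 * w - y + x) ∧ 0 < y - x + (2 * z - y + x)) ↔
      (0 < y ∧ y < x ∧ 0 < w ∧ 0 < z) := by omega
    have c5 : (-(x+y) < 2 * w - y + x ∧ 2 * w - y + x < 0 ∧ 0 < y - x + (2 * w - y + x) ∧ 0 < 2 * w - y + x + (2 * z - y + x)) ↔
      (0 < x + w ∧ 2 * w < y - x ∧ 0 < w ∧ 0 < x + z + w - y) := by omega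
    have c6 : (-(x+y) < 2 * z - y + x ∧ 2 * z - y + x < 0 ∧ 0 < y - x + (2 * z - y + x) ∧ 0 < 2 * w - y + x + (2 * z - y + x)) ↔
      (0 < x + z ∧ 2 * z < y - x ∧ 0 < z ∧ 0 < x + z + w - y) := by omega
    have c7 : (0 < y - x ∧ y - x < x + y ∧ 0 < y - x + (2 * w - y + x) ∧ 0 < y - x + (2 * z - y + x)) ↔
      (x < y ∧ 0 < x ∧ 0 < w ∧ 0 < z) := by omega
    have c8 : (0 < 2 * w - y + x ∧ 2 * w - y + x < x + y ∧ 0 < y - x + (2 * w - y + x) ∧ 0 < 2 * w - y + x + (2 * z - y + x)) ↔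
      (y - x < 2 * w ∧ w < y ∧ 0 < w ∧ 0 < x + z + w - y) := by omega
    have c9 : (0 < 2 * z - y + x ∧ 2 * z - y + x < x + y ∧ 0 < y - x + (2 * z - y + x) ∧ 0 < 2 * w - y + x + (2 * z - y + x) ∧ 0 < y - x + (2 * w - y + x)) ↔
      (y - x < 2 * z ∧ z < y ∧ 0 < z ∧ 0 < x + z + w - y ∧ 0 < w) := by omega
    have c10 : (-(x+y) < 2 * z - y + x ∧ 2 * z - y + x < 0 ∧ y - x + (2 * z - y + x) ≤ 0 ∧ 2 * w - y + x + (2 * z - y + x) ≤ 0 ∧ 0 < y - x + (2 * w - y + x)) ↔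
      (0 < x + z ∧ 2 * z < y - x ∧ z ≤ 0 ∧ x + z + w - y ≤ 0 ∧ 0 < w) := by omega
    have c11 : (2 * z - y + x = x + y ∧ 0 < y - x + (2 * z - y + x) ∧ 0 < 2 * w - y + x + (2 * z - y + x) ∧ 0 < y - x + (2 * w - y + x)) ↔
      (0 < x + y ∧ z = y ∧ 0 < z ∧ 0 < x + z + w - y ∧ 0 < w) := by omega
    have c12 : (x + y ≤ y - x ∧ x + y ≤ 2 * w - y + x ∧ (y - x = x + y ∨ 2 * w - y + x = x + y) ∧ 0 < y - x + (2 * z - y + x) ∧ 0 < 2 * w - y + x + (2 * z - y + x)) ↔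
      (0 < x + y ∧ x ≤ 0 ∧ y ≤ w ∧ (x = 0 ∨ y = w) ∧ 0 < z ∧ 0 < x + z + w - y) := by omega
    rw [if_congr c1 rfl rfl, if_congr c2 rfl rfl, if_congr c3 rfl rfl, if_congr c4 rfl rfl,
      if_congr c5 rfl rfl, if_congr c6 rfl rfl, if_congr c7 rfl rfl, if_congr c8 rfl rfl,
      if_congr c9 rfl rfl, if_congr c10 rfl rfl, if_congr c11 rfl rfl, if_congr c12 rfl rfl] at key
    rw [show ind (0 < x + y) ((wt2 (y - x) (2 * w - y + x) (2 * z - y + x) : ℝ) * f (x + y)) =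
      (wt2 (y - x) (2 * w - y + x) (2 * z - y + x) : ℝ) * f (x + y) from if_pos ht]
    simp only [ind_eq]
    generalize f (x + y) = a
    have key' := congrArg (fun i : ℤ => (i : ℝ)) key
    simp only [Int.cast_add, Int.cast_sub] at key'
    linear_combination (-a) * key'
  · simp only [ind]
    generalize f (x + y) = a
    rw [if_neg ht, if_neg (by omega), if_neg (by omega), if_neg (by omega), if_neg (by omega),
      if_neg (by omega), if_neg (by omega), if_neg (by omega), if_neg (by omega), if_neg (by omega),
      if_neg (by omega), if_neg (by omega), if_neg (by omega)]
    ring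


end

section

abbrev SL2 := Matrix.SpecialLinearGroup (Fin 2) ℤ

/-- weight of a form -/
def wtQ (Q : ℤ × ℤ × ℤ) : ℤ := wt2 Q.2.1 (2 * Q.1 - Q.2.1) (2 * Q.2.2 - Q.2.1)

/-- size of a form -/
def szQ (Q : ℤ × ℤ × ℤ) : ℤ := 2 * Q.1 + 2 * Q.2.2 - Q.2.1

theorem sl2_det (γ : SL2) : γ.1 0 0 * γ.1 1 1 - γ.1 0 1 * γ.1 1 0 = 1 := by
  have := γ.2
  rwa [Matrix.det_fin_two] at this

/-- explicit element -/
def mk2 (a b c d : ℤ) (h : a * d - b * c = 1) : SL2 :=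
  ⟨!![a, b; c, d], by rw [Matrix.det_fin_two_of]; exact h⟩

theorem formAct_eq (γ : SL2) (Q : ℤ × ℤ × ℤ) : formAct γ Q =
    (Q.1 * γ.1 0 0 ^ 2 + Q.2.1 * γ.1 0 0 * γ.1 1 0 + Q.2.2 * γ.1 1 0 ^ 2,
     2 * Q.1 * γ.1 0 0 * γ.1 0 1 + Q.2.1 * (γ.1 0 0 * γ.1 1 1 + γ.1 0 1 * γ.1 1 0)
       + 2 * Q.2.2 * γ.1 1 0 * γ.1 1 1,
     Q.1 * γ.1 0 1 ^ 2 + Q.2.1 * γ.1 0 1 * γ.1 1 1 + Q.2.2 * γ.1 1 1 ^ 2) := by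
  simp only [formAct, formEval]
  refine Prod.ext rfl (Prod.ext ?_ rfl)
  dsimp only
  ring

theorem formAct_mk2 (a b c d : ℤ) (h) (Q : ℤ × ℤ × ℤ) : formAct (mk2 a b c d h) Q =
    (Q.1 * a ^ 2 + Q.2.1 * a * c + Q.2.2 * c ^ 2,
     2 * Q.1 * a * b + Q.2.1 * (a * d + b * c) + 2 * Q.2.2 * c * d,
     Q.1 * b ^ 2 + Q.2.1 * b * d + Q.2.2 * d ^ 2) := by
  rw [formAct_eq]; rfl

theorem formAct_mul (γ δ : SL2) (Q : ℤ × ℤ × ℤ) :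
    formAct (γ * δ) Q = formAct δ (formAct γ Q) := by
  simp only [formAct_eq, Matrix.SpecialLinearGroup.coe_mul, Matrix.mul_apply, Fin.sum_univ_two]
  refine Prod.ext ?_ (Prod.ext ?_ ?_) <;> dsimp only <;> ring

theorem formAct_one (Q : ℤ × ℤ × ℤ) : formAct 1 Q = Q := by
  simp only [formAct_eq]
  refine Prod.ext ?_ (Prod.ext ?_ ?_) <;> simp

theorem formAct_disc (γ : SL2) (Q : ℤ × ℤ × ℤ) : formDisc (formAct γ Q) = formDisc Q := by
  have h := sl2_det γ
  simp only [formAct_eq, formDisc]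
  have : Q.2.1 ^ 2 - 4 * Q.1 * Q.2.2 = (Q.2.1 ^ 2 - 4 * Q.1 * Q.2.2) * (γ.1 0 0 * γ.1 1 1 - γ.1 0 1 * γ.1 1 0)^2 := by
    rw [h]; ring
  rw [this]
  ring

theorem posdef_eval {Q : ℤ × ℤ × ℤ} (h : IsPosDef Q) {x y : ℤ} (hxy : ¬ (x = 0 ∧ y = 0)) :
    0 < Q.1 * x ^ 2 + Q.2.1 * x * y + Q.2.2 * y ^ 2 := by
  obtain ⟨h1, h2⟩ := h
  unfold formDisc at h2
  by_contra hc
  push Not at hc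
  have e : 4 * Q.1 * (Q.1 * x ^ 2 + Q.2.1 * x * y + Q.2.2 * y ^ 2) =
    (2 * Q.1 * x + Q.2.1 * y) ^ 2 - (Q.2.1 ^ 2 - 4 * Q.1 * Q.2.2) * y ^ 2 := by ring
  have l : 4 * Q.1 * (Q.1 * x ^ 2 + Q.2.1 * x * y + Q.2.2 * y ^ 2) ≤ 0 :=
    mul_nonpos_of_nonneg_of_nonpos (by linarith) hc
  by_cases hy : y = 0
  · subst hy
    have hx : x ≠ 0 := fun hx => hxy ⟨hx, rfl⟩
    have : 0 < x ^ 2 := by positivity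
    nlinarith
  · have : 0 < y ^ 2 := by positivity
    nlinarith [sq_nonneg (2 * Q.1 * x + Q.2.1 * y)]

theorem formAct_posdef (γ : SL2) {Q : ℤ × ℤ × ℤ} (h : IsPosDef Q) : IsPosDef (formAct γ Q) := by
  refine ⟨?_, by rw [formAct_disc]; exact h.2⟩
  rw [formAct_eq]
  refine posdef_eval h ?_
  rintro ⟨a, b⟩
  have := sl2_det γ
  rw [a, b] at this
  simp at this

theorem wtQ_pos_iff (Q : ℤ × ℤ × ℤ) : wtQ Q ≠ 0 ↔ (0 ≤ Q.2.1 ∧ 0 ≤ 2 * Q.1 - Q.2.1 ∧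
    0 ≤ 2 * Q.2.2 - Q.2.1 ∧ 0 < Q.1 ∧ 0 < Q.2.2 ∧ Q.2.1 < Q.1 + Q.2.2) := by
  unfold wtQ wt2
  split_ifs <;> simp <;> omega

theorem wtQ_posdef {Q : ℤ × ℤ × ℤ} (h : wtQ Q ≠ 0) : IsPosDef Q := by
  rw [wtQ_pos_iff] at h
  obtain ⟨h1, h2, h3, h4, h5, h6⟩ := h
  refine ⟨h4, ?_⟩
  unfold formDisc
  rcases h1.eq_or_lt with h | h
  · rw [← h]; nlinarith
  · rcases h2.eq_or_lt with h' | h'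
    · nlinarith
    · nlinarith

theorem exists_red : ∀ (k : ℕ) (Q : ℤ × ℤ × ℤ), IsPosDef Q → szQ Q ≤ k →
    ∃ γ : SL2, wtQ (formAct γ Q) ≠ 0 := by
  intro k
  induction k with
  | zero =>
    intro Q h hs
    have h1 := posdef_eval h (x := 1) (y := 0) (by simp)
    have h2 := posdef_eval h (x := 0) (y := 1) (by simp)
    have h3 := posdef_eval h (x := 1) (y := -1) (by simp)
    unfold szQ at hs
    norm_num at *
    omega
  | succ k ih =>
    intro Q h hs
    have h1 := posdef_eval h (x := 1) (y := 0) (by simp)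
    have h2 := posdef_eval h (x := 0) (y := 1) (by simp)
    have h3 := posdef_eval h (x := 1) (y := -1) (by simp)
    norm_num at h1 h2 h3
    have step : ∀ γ : SL2, szQ (formAct γ Q) < szQ Q → ∃ γ : SL2, wtQ (formAct γ Q) ≠ 0 := by
      intro γ hγ
      obtain ⟨δ, hδ⟩ := ih (formAct γ Q) (formAct_posdef γ h) (by push_cast at hs; omega)
      exact ⟨γ * δ, by rwa [formAct_mul]⟩
    by_cases c1 : Q.2.1 < 0
    · apply step (mk2 0 (-1) 1 0 (by norm_num))
      rw [formAct_mk2]; simp only [szQ]; ring_nf; omega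
    by_cases c2 : 2 * Q.1 - Q.2.1 < 0
    · apply step (mk2 (-1) 1 0 (-1) (by norm_num) )
      rw [formAct_mk2]; simp only [szQ]; ring_nf; omega
    by_cases c3 : 2 * Q.2.2 - Q.2.1 < 0
    · apply step (mk2 (-1) 0 1 (-1) (by norm_num) )
      rw [formAct_mk2]; simp only [szQ]; ring_nf; omega
    refine ⟨1, ?_⟩
    rw [formAct_one, wtQ_pos_iff]
    omega

theorem nrm_pos {a b : ℤ} (h : ¬ (a = 0 ∧ b = 0)) : 1 ≤ a ^ 2 - a * b + b ^ 2 := by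
  by_contra hc
  have : a ^ 2 - a * b + b ^ 2 ≤ 0 := by omega
  apply h
  constructor <;> nlinarith [sq_nonneg (a - b), sq_nonneg (a + b), sq_nonneg a, sq_nonneg b]

theorem szQ_act (γ : SL2) (Q : ℤ × ℤ × ℤ) : szQ (formAct γ Q) =
    Q.2.1 * ((γ.1 0 0 + γ.1 1 0) ^ 2 - (γ.1 0 0 + γ.1 1 0) * (γ.1 0 1 + γ.1 1 1) + (γ.1 0 1 + γ.1 1 1) ^ 2)
    + (2 * Q.1 - Q.2.1) * (γ.1 0 0 ^ 2 - γ.1 0 0 * γ.1 0 1 + γ.1 0 1 ^ 2)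
    + (2 * Q.2.2 - Q.2.1) * (γ.1 1 0 ^ 2 - γ.1 1 0 * γ.1 1 1 + γ.1 1 1 ^ 2) := by
  simp only [szQ, formAct_eq]; ring

theorem nrms (γ : SL2) :
    1 ≤ (γ.1 0 0 + γ.1 1 0) ^ 2 - (γ.1 0 0 + γ.1 1 0) * (γ.1 0 1 + γ.1 1 1) + (γ.1 0 1 + γ.1 1 1) ^ 2
    ∧ 1 ≤ γ.1 0 0 ^ 2 - γ.1 0 0 * γ.1 0 1 + γ.1 0 1 ^ 2
    ∧ 1 ≤ γ.1 1 0 ^ 2 - γ.1 1 0 * γ.1 1 1 + γ.1 1 1 ^ 2 := by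
  have h := sl2_det γ
  refine ⟨nrm_pos ?_, nrm_pos ?_, nrm_pos ?_⟩
  · rintro ⟨a, b⟩
    have a' : γ.1 1 0 = - γ.1 0 0 := by linarith
    have b' : γ.1 1 1 = - γ.1 0 1 := by linarith
    rw [a', b'] at h; ring_nf at h; omega
  · rintro ⟨a, b⟩; rw [a, b] at h; simp at h
  · rintro ⟨a, b⟩; rw [a, b] at h; simp at h

theorem szQ_le (γ : SL2) {Q : ℤ × ℤ × ℤ} (h : wtQ Q ≠ 0) : szQ Q ≤ szQ (formAct γ Q) := by
  rw [wtQ_pos_iff] at h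
  rw [szQ_act]
  obtain ⟨n1, n2, n3⟩ := nrms γ
  obtain ⟨h1, h2, h3, -⟩ := h
  have := mul_le_mul_of_nonneg_left n1 h1
  have := mul_le_mul_of_nonneg_left n2 h2
  have := mul_le_mul_of_nonneg_left n3 h3
  unfold szQ
  linarith

theorem nrm_one {a b : ℤ} (h : a ^ 2 - a * b + b ^ 2 = 1) :
    (-1 ≤ a ∧ a ≤ 1) ∧ (-1 ≤ b ∧ b ≤ 1) ∧ (-1 ≤ a - b ∧ a - b ≤ 1) := by
  refine ⟨⟨?_, ?_⟩, ⟨?_, ?_⟩, ⟨?_, ?_⟩⟩ <;> 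
  nlinarith [sq_nonneg (a - 2 * b), sq_nonneg (2 * a - b), sq_nonneg (a + b)]

theorem exists_red' {Q : ℤ × ℤ × ℤ} (h : IsPosDef Q) : ∃ γ : SL2, wtQ (formAct γ Q) ≠ 0 ∧
    0 < 2 * (formAct γ Q).1 - (formAct γ Q).2.1 ∧ 0 < 2 * (formAct γ Q).2.2 - (formAct γ Q).2.1 := by
  obtain ⟨γ, hγ⟩ := exists_red (szQ Q).toNat Q h (Int.self_le_toNat _)
  by_cases c1 : 2 * (formAct γ Q).1 - (formAct γ Q).2.1 = 0
  · refine ⟨γ * mk2 1 1 (-1) 0 (by norm_num), ?_⟩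
    rw [formAct_mul, formAct_mk2]
    rw [wtQ_pos_iff] at hγ ⊢
    ring_nf at *
    omega
  by_cases c2 : 2 * (formAct γ Q).2.2 - (formAct γ Q).2.1 = 0
  · refine ⟨γ * mk2 0 1 (-1) (-1) (by norm_num), ?_⟩
    rw [formAct_mul, formAct_mk2]
    rw [wtQ_pos_iff] at hγ ⊢
    ring_nf at *
    omega
  · refine ⟨γ, hγ, ?_⟩
    rw [wtQ_pos_iff] at hγ
    omega

theorem entries (γ : SL2) {Q : ℤ × ℤ × ℤ} (h : wtQ Q ≠ 0) (p2 : 0 < 2 * Q.1 - Q.2.1)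
    (p3 : 0 < 2 * Q.2.2 - Q.2.1) (h' : wtQ (formAct γ Q) ≠ 0) :
    (-1 ≤ γ.1 0 0 ∧ γ.1 0 0 ≤ 1) ∧ (-1 ≤ γ.1 0 1 ∧ γ.1 0 1 ≤ 1) ∧ (-1 ≤ γ.1 1 0 ∧ γ.1 1 0 ≤ 1) ∧
    (-1 ≤ γ.1 1 1 ∧ γ.1 1 1 ≤ 1) := by
  have s1 := szQ_le γ h
  have s2 := szQ_le γ⁻¹ h'
  rw [← formAct_mul, mul_inv_cancel, formAct_one] at s2
  have s3 : szQ (formAct γ Q) = szQ Q := le_antisymm s2 s1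
  rw [szQ_act, szQ] at s3
  rw [wtQ_pos_iff] at h
  obtain ⟨n1, n2, n3⟩ := nrms γ
  obtain ⟨h1, h2, h3, h4, h5, h6⟩ := h
  have k1 := mul_nonneg h1 (sub_nonneg.mpr n1)
  have k2 := mul_nonneg h2 (sub_nonneg.mpr n2)
  have k3 := mul_nonneg h3 (sub_nonneg.mpr n3)
  have z2 : (2 * Q.1 - Q.2.1) * (γ.1 0 0 ^ 2 - γ.1 0 0 * γ.1 0 1 + γ.1 0 1 ^ 2 - 1) = 0 := by linarith
  have z3 : (2 * Q.2.2 - Q.2.1) * (γ.1 1 0 ^ 2 - γ.1 1 0 * γ.1 1 1 + γ.1 1 1 ^ 2 - 1) = 0 := by linarith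
  rw [mul_eq_zero] at z2 z3
  have y2 := nrm_one (a := γ.1 0 0) (b := γ.1 0 1) (by omega)
  have y3 := nrm_one (a := γ.1 1 0) (b := γ.1 1 1) (by omega)
  omega


end

section

theorem HF.inj {ι κ : Type*} {g : κ → ℝ} {s : ℝ} (h : HF g s) (i : ι → κ) (hi : Function.Injective i)
    (hr : ∀ k, g k ≠ 0 → k ∈ Set.range i) : HF (fun j => g (i j)) s := by
  refine ⟨?_, ?_⟩
  · have : (fun j => g (i j)).support = i ⁻¹' g.support := rfl
    rw [this]; exact h.1.preimage hi.injOn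
  · rw [← h.2, ← finsum_mem_range hi, ← finsum_mem_univ g]
    apply finsum_mem_inter_support_eq
    ext k
    simp only [Set.mem_inter_iff, Set.mem_univ, true_and, Function.mem_support]
    exact ⟨fun h => h.2, fun h => ⟨hr k h, h⟩⟩

theorem HN.sl2 {G : ℤ → ℤ → ℤ → ℤ → ℝ} {s : ℝ} (h : HN 1 G s) :
    HF (fun γ : SL2 => G (γ.1 0 0) (γ.1 1 1) (- γ.1 0 1) (γ.1 1 0)) s := by
  have := HF.inj h (fun γ : SL2 => (γ.1 0 0, γ.1 1 1, - γ.1 0 1, γ.1 1 0)) ?_ ?_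
  · refine this.congr ?_ rfl
    intro γ
    have := sl2_det γ
    dsimp only
    rw [if_pos (by linarith)]
  · intro γ δ hh
    simp only [Prod.mk.injEq, neg_inj] at hh
    apply Subtype.ext
    ext i j
    fin_cases i <;> fin_cases j <;> simp_all
  · rintro ⟨x, y, z, w⟩ hk
    dsimp only at hk
    split_ifs at hk with hd
    · refine ⟨mk2 x (-z) w y (by linarith), ?_⟩
      simp [mk2]
    · exact absurd rfl hk

theorem wt2_2 {p q r : ℤ} (h1 : 0 < p) (h2 : 0 < q) (h3 : 0 < r) : wt2 p q r = 2 := by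
  unfold wt2; rw [if_pos ⟨h1, h2, h3⟩]

theorem wt2_0 {p q r : ℤ} (h : p < 0 ∨ q < 0 ∨ r < 0 ∨ p + q ≤ 0 ∨ p + r ≤ 0 ∨ q + r ≤ 0) : wt2 p q r = 0 := by
  unfold wt2; rw [if_neg (by omega), if_neg (by omega)]

theorem wt2_1 {p q r : ℤ} (h : 0 ≤ p ∧ 0 ≤ q ∧ 0 ≤ r ∧ 0 < p + q ∧ 0 < q + r ∧ 0 < p + r)
    (h' : p = 0 ∨ q = 0 ∨ r = 0) : wt2 p q r = 1 := by
  unfold wt2; rw [if_neg (by omega), if_pos h]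

set_option maxHeartbeats 2000000 in
theorem sum12 {Q : ℤ × ℤ × ℤ} (h : wtQ Q ≠ 0) (p2 : 0 < 2 * Q.1 - Q.2.1)
    (p3 : 0 < 2 * Q.2.2 - Q.2.1) : HF (fun γ : SL2 => (wtQ (formAct γ Q) : ℝ)) 12 := by
  have key : HN 1 (fun a d b c => ((wtQ 
    (Q.1 * a ^ 2 + Q.2.1 * a * c + Q.2.2 * c ^ 2,
     2 * Q.1 * a * (-b) + Q.2.1 * (a * d + (-b) * c) + 2 * Q.2.2 * c * d,
     Q.1 * (-b) ^ 2 + Q.2.1 * (-b) * d + Q.2.2 * d ^ 2) : ℤ) : ℝ)) 12 := by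
    refine HF.congr (HF.of_finset (Finset.Icc (-1) 1 ×ˢ Finset.Icc (-1) 1 ×ˢ Finset.Icc (-1) 1 ×ˢ
      Finset.Icc (-1) 1) ?_) (fun _ => rfl) ?_
    · rintro ⟨a, d, b, c⟩ hv
      dsimp only
      split_ifs with hh
      · by_contra h0
        have e := entries (mk2 a (-b) c d (by linarith)) h p2 p3 (by
          rw [formAct_mk2]; intro hz; apply h0; rw [hz]; simp)
        simp [mk2] at e
        apply hv
        simp only [Finset.mem_product, Finset.mem_Icc]
        omega
      · rfl
    · rw [wtQ_pos_iff] at h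
      obtain ⟨A, B, C⟩ := Q
      dsimp only at *
      have hb : Finset.Icc (-1:ℤ) 1 = {-1,0,1} := by decide
      obtain ⟨h1, -, -, h4, h5, h6⟩ := h
      simp only [hb, Finset.sum_product]
      simp
      simp only [wtQ]
      rcases h1.eq_or_lt with h1 | h1
      · subst h1
        simp (disch := omega) only [wt2_0, wt2_1]
        norm_num
      · simp (disch := omega) only [wt2_0, wt2_2]
        norm_num
  refine key.sl2.congr ?_ rfl
  intro γ
  rw [formAct_eq]
  simp only [neg_neg]


end

section

theorem sum12' {Q : ℤ × ℤ × ℤ} (h : IsPosDef Q) :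
    HF (fun γ : SL2 => (wtQ (formAct γ Q) : ℝ)) 12 := by
  obtain ⟨γ0, h1, h2, h3⟩ := exists_red' h
  have := (sum12 h1 h2 h3).equiv (Equiv.mulLeft γ0⁻¹)
  refine this.congr ?_ rfl
  intro γ
  rw [← formAct_mul]; simp

theorem stab_card (P : ℤ × ℤ × ℤ) (γ1 : SL2) :
    Nat.card {γ : SL2 // formAct γ P = formAct γ1 P} = Nat.card {γ : SL2 // formAct γ P = P} := by
  refine Nat.card_congr ⟨fun γ => ⟨γ.1 * γ1⁻¹, ?_⟩, fun γ => ⟨γ.1 * γ1, ?_⟩, ?_, ?_⟩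
  · rw [formAct_mul, γ.2, ← formAct_mul]; simp [formAct_one]
  · rw [formAct_mul, γ.2]
  · intro γ; simp
  · intro γ; simp

theorem wtQ_fin (D : ℤ) : {Q : ℤ × ℤ × ℤ | wtQ Q ≠ 0 ∧ formDisc Q = -D}.Finite := by
  refine Set.Finite.subset (Set.finite_Icc ((-D-1, -D-1, -D-1) : ℤ × ℤ × ℤ) (D+1, D+1, D+1)) ?_
  rintro ⟨a, b, c⟩ ⟨h, hd⟩
  rw [wtQ_pos_iff] at h
  unfold formDisc at hd
  dsimp only at *
  obtain ⟨h1, h2, h3, h4, h5, h6⟩ := h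
  have k1 : a + c ≤ D + 1 := by
    nlinarith [mul_nonneg h1 h2, mul_nonneg h1 h3, mul_nonneg h2 h3, mul_nonneg h1 h4.le]
  simp only [Set.mem_Icc, Prod.mk_le_mk]
  refine ⟨⟨?_, ?_, ?_⟩, ?_, ?_, ?_⟩ <;> omega

theorem class_rel (D : ℤ) (Q Q' : {Q : ℤ × ℤ × ℤ // formDisc Q = -D ∧ IsPosDef Q})
    (h : (Quot.mk _ Q : FormClasses D) = Quot.mk _ Q') : ∃ γ : SL2, formAct γ Q.1 = Q'.1 := by
  have := Quot.eqvGen_exact h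
  rwa [Equivalence.eqvGen_iff] at this
  refine ⟨fun x => ⟨1, formAct_one _⟩, ?_, ?_⟩
  · rintro x y ⟨γ, hγ⟩
    refine ⟨γ⁻¹, ?_⟩
    rw [← hγ, ← formAct_mul]; simp [formAct_one]
  · rintro x y z ⟨γ, hγ⟩ ⟨δ, hδ⟩
    exact ⟨γ * δ, by rw [formAct_mul, hγ, hδ]⟩

theorem partA (D : ℤ) (hD : D ≠ 0) :
    HF (fun Q : ℤ × ℤ × ℤ => if formDisc Q = -D then (wtQ Q : ℝ) else 0)
      (6 * hurwitzClassNumber D) := by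
  classical
  let S := (wtQ_fin D).toFinset
  have hS : ∀ Q, Q ∈ S ↔ wtQ Q ≠ 0 ∧ formDisc Q = -D := fun Q => by simp [S]
  have hs : ∀ c : FormClasses D, ∃ γ : SL2, wtQ (formAct γ c.out.1) ≠ 0 := fun c => by
    obtain ⟨γ, h, -⟩ := exists_red' c.out.2.2
    exact ⟨γ, h⟩
  let cl : {Q // Q ∈ S} → FormClasses D := fun Q =>
    Quot.mk _ ⟨Q.1, ((hS _).1 Q.2).2, wtQ_posdef ((hS _).1 Q.2).1⟩
  have cl_iff : ∀ Q c, cl Q = c ↔ ∃ γ : SL2, formAct γ c.out.1 = Q.1 := by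
    intro Q c
    constructor
    · intro h
      have : (Quot.mk _ c.out : FormClasses D) = cl Q := by rw [Quot.out_eq, h]
      exact class_rel D _ _ this
    · rintro ⟨γ, h⟩
      have : (Quot.mk _ c.out : FormClasses D) = cl Q := Quot.sound ⟨γ, h⟩
      rw [← this, Quot.out_eq]
  have hsurj : Function.Surjective cl := by
    intro c
    obtain ⟨γ, h⟩ := hs c
    refine ⟨⟨formAct γ c.out.1, (hS _).2 ⟨h, ?_⟩⟩, (cl_iff _ _).2 ⟨γ, rfl⟩⟩
    rw [formAct_disc]; exact c.out.2.1
  haveI : Finite (FormClasses D) := Finite.of_surjective cl hsurj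
  haveI := Fintype.ofFinite (FormClasses D)
  have key : ∀ c : FormClasses D, (12:ℝ) = (Nat.card {γ : SL2 // formAct γ c.out.1 = c.out.1}) *
      ∑ Q : {Q // Q ∈ S}, if cl Q = c then (wtQ Q.1 : ℝ) else 0 := by
    intro c
    have h12 := sum12' c.out.2.2
    have := h12.2
    rw [finsum_eq_sum_of_support_subset (s := h12.1.toFinset) _ (by simp)] at this
    rw [← this, Finset.mul_sum]
    have hm : ∀ γ ∈ h12.1.toFinset, formAct γ c.out.1 ∈ S := by
      intro γ hγ
      rw [hS]
      refine ⟨by simpa using hγ, by rw [formAct_disc]; exact c.out.2.1⟩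
    rw [← Finset.sum_fiberwise_of_maps_to hm, ← Finset.sum_coe_sort S]
    refine Finset.sum_congr rfl fun Q _ => ?_
    have e1 : ∑ γ ∈ h12.1.toFinset with formAct γ c.out.1 = Q.1, (wtQ (formAct γ c.out.1) : ℝ) =
        ∑ γ ∈ h12.1.toFinset with formAct γ c.out.1 = Q.1, (wtQ Q.1 : ℝ) :=
      Finset.sum_congr rfl fun γ hγ => by rw [(Finset.mem_filter.1 hγ).2]
    rw [e1, Finset.sum_const, nsmul_eq_mul]
    split_ifs with hc
    · obtain ⟨γ1, h1⟩ := (cl_iff _ _).1 hc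
      congr 2
      rw [← stab_card _ γ1, h1]
      refine (Nat.subtype_card _ fun γ => ?_).symm
      simp only [Finset.mem_filter, Set.Finite.mem_toFinset, Function.mem_support]
      refine ⟨fun h => h.2, fun h => ⟨?_, h⟩⟩
      rw [h]; exact_mod_cast ((hS _).1 Q.2).1
    · rw [mul_zero]
      rw [Finset.filter_false_of_mem, Finset.card_empty]; simp
      intro γ _ h
      exact hc ((cl_iff _ _).2 ⟨γ, h⟩)
  refine HF.congr (HF.of_finset S ?_) (fun _ => rfl) ?_
  · intro Q hQ
    rw [hS] at hQ
    split_ifs with h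
    · by_contra h0
      exact hQ ⟨by simpa using h0, h⟩
    · rfl
  · unfold hurwitzClassNumber
    rw [if_neg hD, finsum_eq_sum_of_fintype, Finset.mul_sum]
    have : ∀ c : FormClasses D, 6 * ((2 : ℝ) / (Nat.card {γ : SL2 // formAct γ c.out.1 = c.out.1}))
        = ∑ Q : {Q // Q ∈ S}, if cl Q = c then (wtQ Q.1 : ℝ) else 0 := by
      intro c
      have k := key c
      have hne : (Nat.card {γ : SL2 // formAct γ c.out.1 = c.out.1} : ℝ) ≠ 0 := by
        intro h; rw [h] at k; norm_num at k
      field_simp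
      linarith
    rw [Finset.sum_congr rfl (fun c _ => this c), Finset.sum_comm]
    simp only [Finset.sum_ite_eq, Finset.mem_univ, if_true]
    rw [Finset.sum_coe_sort S (fun Q => (wtQ Q : ℝ))]
    exact Finset.sum_congr rfl fun Q hQ => by rw [if_pos ((hS _).1 hQ).2]


end

section

theorem HF.prod {ι κ : Type*} [DecidableEq κ] {g : ι → κ → ℝ} {s : ι → ℝ} (T : Finset ι)
    (h : ∀ t ∈ T, HF (g t) (s t)) (h0 : ∀ t, t ∉ T → ∀ k, g t k = 0) :
    HF (fun p : ι × κ => g p.1 p.2) (∑ t ∈ T, s t) := by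
  classical
  have hfin : (⋃ t ∈ (T : Set ι), (g t).support).Finite :=
    Set.Finite.biUnion T.finite_toSet (fun t ht => (h t ht).1)
  have hU : ∀ t ∈ T, ∀ k, k ∉ hfin.toFinset → g t k = 0 := by
    intro t ht k hk
    by_contra hh
    apply hk
    simp only [Set.Finite.mem_toFinset, Set.mem_iUnion]
    exact ⟨t, ht, hh⟩
  refine HF.congr (HF.of_finset (T ×ˢ hfin.toFinset) ?_) (fun _ => rfl) ?_
  · rintro ⟨t, k⟩ hk
    by_cases ht : t ∈ T
    · exact hU t ht k (fun hh => hk (Finset.mem_product.2 ⟨ht, hh⟩))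
    · exact h0 t ht k
  · rw [Finset.sum_product]
    refine Finset.sum_congr rfl fun t ht => ?_
    exact (HF.of_finset _ (hU t ht)).unique (h t ht)

theorem H_neg {D : ℤ} (h : D < 0) : hurwitzClassNumber D = 0 := by
  have h1 := partA D h.ne
  have h2 : HF (fun Q : ℤ × ℤ × ℤ => if formDisc Q = -D then (wtQ Q : ℝ) else 0) (∑ i ∈ ∅, 
    (fun Q : ℤ × ℤ × ℤ => if formDisc Q = -D then (wtQ Q : ℝ) else 0) i) := by
    refine HF.of_finset ∅ ?_
    intro Q _
    split_ifs with hh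
    · by_contra h0
      have := (wtQ_posdef (Q := Q) (by exact_mod_cast h0)).2
      omega
    · rfl
  have := h1.unique h2
  simpa using this

theorem wt_zero : HF (fun Q : ℤ × ℤ × ℤ => if formDisc Q = 0 then (wtQ Q : ℝ) else 0) 0 := by
  refine HF.congr (HF.of_finset ∅ ?_) (fun _ => rfl) (by simp)
  intro Q _
  split_ifs with hh
  · by_contra h0
    have := (wtQ_posdef (Q := Q) (by exact_mod_cast h0)).2
    omega
  · rfl

theorem sum_even (g : ℤ → ℝ) (hg : ∀ t, g (-t) = g t) (g0 : g 0 = 0) (N : ℕ) :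
    ∑ t ∈ Finset.Icc (-N : ℤ) N, g t = 2 * ∑ t ∈ Finset.Icc (1 : ℤ) N, g t := by
  have e : Finset.Icc (-N : ℤ) N = (Finset.Icc (-N : ℤ) (-1) ∪ {0}) ∪ Finset.Icc (1 : ℤ) N := by
    ext t; simp only [Finset.mem_Icc, Finset.mem_union, Finset.mem_singleton]; omega
  rw [e, Finset.sum_union, Finset.sum_union, Finset.sum_singleton, g0]
  · have : ∑ t ∈ Finset.Icc (-N : ℤ) (-1), g t = ∑ t ∈ Finset.Icc (1 : ℤ) N, g t := by
      refine Finset.sum_nbij' (fun t => -t) (fun t => -t) ?_ ?_ ?_ ?_ ?_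
      · intro a; simp only [Finset.mem_Icc]; omega
      · intro a; simp only [Finset.mem_Icc]; omega
      · intro a _; simp
      · intro a _; simp
      · intro a _; rw [hg]
    rw [this]; ring
  · rw [Finset.disjoint_left]; intro a; simp only [Finset.mem_Icc, Finset.mem_singleton]; omega
  · rw [Finset.disjoint_left]; intro a; simp only [Finset.mem_union, Finset.mem_Icc, Finset.mem_singleton]; omega

theorem linkA (n : ℕ) (hn : 0 < n) (f : ℤ → ℝ) (hf : ∀ t, f (-t) = f t) (f0 : f 0 = 0) {K : ℝ}
    (hK : HN n (fun x y z w => ind (0 < x + y)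
      ((wt2 (y - x) (2 * w - y + x) (2 * z - y + x) : ℝ) * f (x + y))) K) :
    HF (fun t : ℤ => f t * hurwitzClassNumber (4 * n - t ^ 2))
      (K / 3 - 1 / 6 * ∑ t ∈ Finset.Icc (1 : ℤ) (2 * n : ℕ), if 4 * (n : ℤ) - t ^ 2 = 0 then f t else 0) := by
  have hP : HF (fun p : ℤ × (ℤ × ℤ × ℤ) => (if 0 < p.1 then f p.1 else 0) *
      (if formDisc p.2 = -(4 * n - p.1 ^ 2) then (wtQ p.2 : ℝ) else 0))
      (∑ t ∈ Finset.Icc (1 : ℤ) (2 * n : ℕ), f t * (if 4 * (n : ℤ) - t ^ 2 = 0 then 0 else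
        6 * hurwitzClassNumber (4 * n - t ^ 2))) := by
    refine HF.prod (g := fun t Q => (if 0 < t then f t else 0) *
      (if formDisc Q = -(4 * n - t ^ 2) then (wtQ Q : ℝ) else 0)) _ ?_ ?_
    · intro t ht
      rw [Finset.mem_Icc] at ht
      rw [if_pos (by omega)]
      refine HF.mul _ ?_
      split_ifs with h
      · rw [h, neg_zero]; exact wt_zero
      · exact partA _ h
    · intro t ht Q
      rw [Finset.mem_Icc] at ht
      by_cases h : 0 < t
      · rw [if_pos h]
        have ht : (2 * n : ℤ) < t := by push_cast at ht; omega
        split_ifs with hd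
        · have : wtQ Q = 0 := by
            by_contra h0
            have := (wtQ_posdef h0).2
            nlinarith
          rw [this]; simp
        · simp
      · rw [if_neg h]; simp
  have hi := hP.inj (fun v : ℤ × ℤ × ℤ × ℤ => (v.1 + v.2.1, (v.2.2.2, v.2.1 - v.1, v.2.2.1))) ?_ ?_
  · have hK' : HN n (fun x y z w => ind (0 < x + y)
      ((wt2 (y - x) (2 * w - y + x) (2 * z - y + x) : ℝ) * f (x + y))) (∑ t ∈ Finset.Icc (1 : ℤ) (2 * n : ℕ), f t * (if 4 * (n : ℤ) - t ^ 2 = 0 then 0 else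
        6 * hurwitzClassNumber (4 * n - t ^ 2))) := by
      refine hi.congr ?_ rfl
      rintro ⟨x, y, z, w⟩
      simp only [formDisc, wtQ, ind]
      have e : (y - x) ^ 2 - 4 * w * z = -(4 * (n:ℤ) - (x + y) ^ 2) ↔ x * y + z * w = n := by
        constructor <;> intro h <;> linarith
      simp only [e]
      have e1 : 2 * w - (y - x) = 2 * w - y + x := by ring
      have e2 : 2 * z - (y - x) = 2 * z - y + x := by ring
      rw [e1, e2]
      split_ifs <;> ring
    rw [hK.unique hK']
    refine HF.congr (HF.of_finset (Finset.Icc (-(2 * n : ℕ) : ℤ) (2 * n : ℕ)) ?_) (fun _ => rfl) ?_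
    · intro t ht
      have : 4 * (n : ℤ) - t ^ 2 < 0 := by
        rw [Finset.mem_Icc] at ht
        push_cast at ht
        have : t < -(2 * n) ∨ 2 * n < t := by omega
        rcases this with h | h <;> nlinarith
      rw [H_neg this, mul_zero]
    · rw [sum_even _ (fun t => by rw [hf, neg_sq]) (by rw [f0, zero_mul])]
      rw [Finset.mul_sum, Finset.mul_sum, Finset.sum_div, ← Finset.sum_sub_distrib]
      refine Finset.sum_congr rfl fun t _ => ?_
      split_ifs with h
      · rw [h]; simp only [hurwitzClassNumber, if_true]; ring
      · ring
  · rintro ⟨x, y, z, w⟩ ⟨x', y', z', w'⟩ h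
    simp only [Prod.mk.injEq] at h ⊢
    omega
  · rintro ⟨t, A, B, C⟩ h
    have hd : formDisc (A, B, C) = -(4 * n - t ^ 2) := by
      by_contra hh
      apply h
      dsimp only
      rw [if_neg hh, mul_zero]
    simp only [formDisc] at hd
    have hp : (t - B) % 2 = 0 := by
      have e : (t - B) * (t + B) = 4 * (n - A * C) := by linarith
      by_contra hh
      have o1 : (t - B) % 2 = 1 := by omega
      have o2 : (t + B) % 2 = 1 := by omega
      have := Int.mul_emod (t - B) (t + B) 2
      rw [o1, o2, e] at this
      omega
    refine ⟨((t - B) / 2, (t + B) / 2, C, A), ?_⟩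
    simp only [Prod.mk.injEq, true_and, and_true]
    omega


end

section

/-- prefix sums -/
noncomputable def Fs (f : ℤ → ℝ) (m : ℤ) : ℝ := ∑ d ∈ Finset.Ioc 0 m, f d

/-- local divisor contribution -/
noncomputable def Psi (f : ℤ → ℝ) (u v : ℤ) : ℝ :=
  f (u + v) * (2 * |(u:ℝ) - v| - 2 * min (u:ℝ) v - 1) + 2 * Fs f (u + v) + 2 * Fs f u + 2 * Fs f v
    - f u - f v

theorem Fs_succ (f : ℤ → ℝ) {m : ℤ} (h : 0 < m) : Fs f m = (∑ d ∈ Finset.Ioo 0 m, f d) + f m := by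
  unfold Fs
  rw [← Finset.Ioo_insert_right h, Finset.sum_insert (by simp)]; ring

theorem div_symm (n : ℕ) (g : ℤ → ℤ → ℝ) : ∑ u ∈ n.divisorsAntidiagonal, g u.1 u.2 =
    1 / 2 * ∑ u ∈ n.divisorsAntidiagonal, (g u.1 u.2 + g u.2 u.1) := by
  rw [Finset.sum_add_distrib]
  have := Nat.sum_divisorsAntidiagonal' (n := n) (f := fun a b => g a b)
  have h2 := Nat.sum_divisorsAntidiagonal (n := n) (f := fun a b => g b a)
  have h3 : ∑ u ∈ n.divisorsAntidiagonal, g u.1 u.2 = ∑ u ∈ n.divisorsAntidiagonal, g u.2 u.1 := by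
    rw [this, h2]
  rw [← h3]; ring

theorem sq_term (n : ℕ) (hn : 0 < n) (f : ℤ → ℝ) :
    (∑ t ∈ Finset.Icc (1 : ℤ) (2 * n : ℕ), if 4 * (n : ℤ) - t ^ 2 = 0 then f t else 0) =
    ∑ u ∈ n.divisorsAntidiagonal, if u.1 = u.2 then f ((u.1 : ℤ) + u.2) else 0 := by
  rw [← Finset.sum_filter, ← Finset.sum_filter]
  refine Finset.sum_bij' (fun t _ => (t.toNat / 2, t.toNat / 2)) (fun u _ => (u.1 : ℤ) + u.2) ?_ ?_ ?_ ?_ ?_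
  · intro t ht
    simp only [Finset.mem_filter, Finset.mem_Icc] at ht
    obtain ⟨⟨h1, h2⟩, h3⟩ := ht
    have hev : t % 2 = 0 := by
      rcases Int.emod_two_eq_zero_or_one t with h | h
      · exact h
      · have := Int.mul_emod t t 2
        rw [h] at this
        have : t * t = 4 * n := by nlinarith
        omega
    obtain ⟨k, rfl⟩ : ∃ k : ℕ, t = 2 * k := ⟨(t / 2).toNat, by omega⟩
    have e : (2 * (k:ℤ)).toNat / 2 = k := by omega
    simp only [e, Finset.mem_filter, Nat.mem_divisorsAntidiagonal, and_true]
    refine ⟨?_, hn.ne'⟩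
    have : (k * k : ℤ) = n := by nlinarith
    exact_mod_cast this
  · rintro ⟨u, v⟩ hu
    simp only [Finset.mem_filter, Nat.mem_divisorsAntidiagonal, Finset.mem_Icc] at hu ⊢
    obtain ⟨⟨h1, h2⟩, h3⟩ := hu
    subst h3
    have : 0 < u := Nat.pos_of_ne_zero (by rintro rfl; simp at h1; omega)
    push_cast
    rw [← h1]
    push_cast
    refine ⟨⟨by omega, by nlinarith⟩, by ring⟩
  · intro t ht
    simp only [Finset.mem_filter, Finset.mem_Icc] at ht
    obtain ⟨⟨h1, h2⟩, h3⟩ := ht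
    have hev : t % 2 = 0 := by
      rcases Int.emod_two_eq_zero_or_one t with h | h
      · exact h
      · have := Int.mul_emod t t 2
        rw [h] at this
        have : t * t = 4 * n := by nlinarith
        omega
    dsimp only
    omega
  · rintro ⟨u, v⟩ hu
    simp only [Finset.mem_filter] at hu
    simp only [Prod.mk.injEq]
    omega
  · intro t ht
    simp only [Finset.mem_filter, Finset.mem_Icc] at ht
    obtain ⟨⟨h1, h2⟩, h3⟩ := ht
    have hev : t % 2 = 0 := by
      rcases Int.emod_two_eq_zero_or_one t with h | h
      · exact h
      · have := Int.mul_emod t t 2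
        rw [h] at this
        have : t * t = 4 * n := by nlinarith
        omega
    congr 1
    dsimp only
    omega

theorem partAB (n : ℕ) (hn : 0 < n) (f : ℤ → ℝ) (hf : ∀ t, f (-t) = f t) (f0 : f 0 = 0)
    (A B : ℝ) (hA : HN n (fun x y z w => ind (Pos4 x y z w) (f (x + y - z))) A)
    (hB : HN n (fun x y z w => ind (Pos4 x y z w) (f (x + y + z))) B) :
    HF (fun t : ℤ => f t * hurwitzClassNumber (4 * n - t ^ 2))
      ((A - B) / 3 + 1 / 6 * ∑ u ∈ n.divisorsAntidiagonal, Psi f u.1 u.2) := by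
  refine (linkA n hn f hf f0 (partB n hn f hf f0 A B hA hB)).congr (fun _ => rfl) ?_
  rw [sq_term n hn]
  set T := n.divisorsAntidiagonal
  let g : ℤ → ℤ → ℝ := fun u v =>
    - (min (u:ℝ) v - 1) * f (u + v) + 2 * max ((u:ℝ) - v) 0 * f (u + v) - (if v < u then f (u + v) else 0)
    + (Fs f (u + v) - f (u + v)) + 2 * Fs f v - f v - 1 / 2 * (if u = v then f (u + v) else 0)
  have h1 : ∑ u ∈ T, Psi f u.1 u.2 = 2 * ∑ u ∈ T, g u.1 u.2 := by
    rw [div_symm n g, ← mul_assoc]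
    norm_num
    refine Finset.sum_congr rfl fun u _ => ?_
    simp only [Psi, g]
    rw [add_comm (u.2 : ℤ) u.1]
    push_cast
    rcases lt_trichotomy u.1 u.2 with h | h | h
    · have hr : (u.1 : ℝ) < u.2 := by exact_mod_cast h
      rw [abs_of_neg (by linarith), min_eq_left hr.le, min_eq_right hr.le, max_eq_right (by linarith),
        max_eq_left (by linarith), if_neg (by omega), if_neg (by omega), if_pos (by omega),
        if_neg (by omega)]
      ring
    · rw [h]; simp; ring
    · have hr : (u.2 : ℝ) < u.1 := by exact_mod_cast h
      rw [abs_of_pos (by linarith), min_eq_left hr.le, min_eq_right hr.le, max_eq_left (by linarith),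
        max_eq_right (by linarith), if_pos (by omega), if_neg (by omega), if_neg (by omega),
        if_neg (by omega)]
      ring
  rw [h1]
  have h2 : ∀ X Y Z : ℝ, X = A - B + (Y + 1 / 2 * Z) → X / 3 - 1 / 6 * Z = (A - B) / 3 + 1 / 6 * (2 * Y) := by
    intro X Y Z h; rw [h]; ring
  apply h2
  rw [Finset.mul_sum, ← Finset.sum_add_distrib]
  have h3 : ∀ a1 a2 a3 a4 a5 a6 a7 a8 X : ℝ, -a1 + a2 + a3 - a4 + a5 + a6 + a7 - a8 = X →
      A - B - a1 + a2 + a3 - a4 + a5 + a6 + a7 - a8 = A - B + X := by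
    intros; linarith
  apply h3
  simp only [← Finset.sum_sub_distrib, ← Finset.sum_add_distrib, ← Finset.sum_neg_distrib]
  refine Finset.sum_congr rfl fun u hu => ?_
  have hu' := Nat.mem_divisorsAntidiagonal.1 hu
  have p1 : 0 < u.1 := Nat.pos_of_ne_zero (by intro h; rw [h] at hu'; simp at hu'; omega)
  have p2 : 0 < u.2 := Nat.pos_of_ne_zero (by intro h; rw [h] at hu'; simp at hu'; omega)
  obtain ⟨u, v⟩ := u
  dsimp only at *
  have s5 : ∑ z ∈ Finset.Ioo 0 ((u:ℤ) + v), f (u + v - z) = ∑ z ∈ Finset.Ioo 0 ((u:ℤ) + v), f z := by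
    refine Finset.sum_nbij' (fun t => u + v - t) (fun t => u + v - t) ?_ ?_ ?_ ?_ ?_
    · intro a; simp only [Finset.mem_Ioo]; omega
    · intro a; simp only [Finset.mem_Ioo]; omega
    · intro a _; ring
    · intro a _; ring
    · intro a _; rfl
  have s7 : ∑ z ∈ Finset.Ioc (-(v:ℤ)) 0, f (v + z) = Fs f v := by
    unfold Fs
    refine Finset.sum_nbij' (fun t => v + t) (fun t => t - v) ?_ ?_ ?_ ?_ ?_
    · intro a; simp only [Finset.mem_Ioc]; omega
    · intro a; simp only [Finset.mem_Ioc]; omega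
    · intro a _; ring
    · intro a _; ring
    · intro a _; rfl
  have s4 : (∑ z ∈ (if (v:ℤ) < u then {0} else ∅ : Finset ℤ), f (u + v)) = if (v:ℤ) < u then f (u + v) else 0 := by
    split_ifs <;> simp
  have e5 := Fs_succ f (m := (u:ℤ) + v) (by omega)
  rw [s4, s5, s7]
  simp only [g, Finset.sum_const, Int.card_Ioo, Int.card_Ico, nsmul_eq_mul, Finset.sum_singleton]
  rw [e5]
  have c1 : (((v : ℤ) - max 0 ((v:ℤ) - u) - 1).toNat : ℝ) = min (u:ℝ) v - 1 := by
    have : (((v : ℤ) - max 0 ((v:ℤ) - u) - 1).toNat : ℤ) = min (u:ℤ) v - 1 := by omega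
    exact_mod_cast this
  have c2 : ((0 - ((v:ℤ) - u)).toNat : ℝ) = max ((u:ℝ) - v) 0 := by
    have : ((0 - ((v:ℤ) - u)).toNat : ℤ) = max ((u:ℤ) - v) 0 := by omega
    exact_mod_cast this
  have c3 : (((u:ℤ) - v - 0).toNat : ℝ) = max ((u:ℝ) - v) 0 := by
    have : (((u:ℤ) - v - 0).toNat : ℤ) = max ((u:ℤ) - v) 0 := by omega
    exact_mod_cast this
  rw [c1, c2, c3]
  simp only [Int.cast_natCast, Nat.cast_inj, Fs]
  split_ifs <;> ring


end

section

theorem HN.pos' (n : ℤ) (P : ℤ → ℤ → ℤ → ℤ → Prop) [∀ x y z w, Decidable (P x y z w)]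
    (G : ℤ → ℤ → ℤ → ℤ → ℝ)
    (h : ∀ x y z w, P x y z w → Pos4 x y z w) : ∃ s, HN n (fun x y z w => ind (P x y z w) (G x y z w)) s := by
  refine HN.pos n _ fun x y z w h0 => h x y z w ?_
  by_contra hh
  exact h0 (if_neg hh)

theorem master (n : ℕ) (hn : 0 < n) (F τ G E : ℤ → ℤ → ℤ → ℤ → ℝ)
    (h1 : ∀ x y z w : ℤ, x * y + z * w = n → F x y z w = τ x y z w + E x y z w - E y x z w)
    (h2 : ∀ x y z w : ℤ, x * y + z * w = n → τ x y z w + τ z w x y = G x y z w - G (w + y) z y (x - z)) :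
    HN n (fun x y z w => ind (Pos4 x y z w) (F x y z w))
      (∑ u ∈ n.divisorsAntidiagonal, ∑ w ∈ Finset.Ioo 0 (u.2 : ℤ), τ u.1 (u.2 - w) u.1 w) := by
  have hb := HN.div n hn (fun _ y => Finset.Ioo 0 y) (fun x y w => τ x (y - w) x w)
  set Bd := ∑ u ∈ n.divisorsAntidiagonal, ∑ w ∈ Finset.Ioo 0 (u.2 : ℤ), τ u.1 (u.2 - w) u.1 w
  have hb' : HN n (fun x y z w => ind (Pos4 x y z w ∧ x = z) (τ x y z w)) Bd := by
    refine hb.equiv (fun x y z w => x) (fun x y z w => y + w) (fun x y z w => w) (fun x y z w => z - x)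
      (fun x y z w => x) (fun x y z w => y - z) (fun x y z w => w + x) (fun x y z w => z) ?_ ?_ ?_ ?_
    · intro x y z w; ring
    · intro x y z w; simp
    · intro x y z w; simp
    · intro x y z w _
      simp only [ind, Finset.mem_Ioo]
      have : (Pos4 x y z w ∧ x = z) ↔ (z - x = 0 ∧ 0 < x ∧ 0 < w ∧ w < y + w) := by
        constructor <;> (intro h; refine ⟨?_, ?_⟩ <;> omega)
      rw [if_congr this rfl rfl]
      split_ifs with hh
      · congr 1 <;> omega
      · rfl
  obtain ⟨s1, k1⟩ := HN.pos' n (fun x y z w => Pos4 x y z w ∧ z < x) τ (fun _ _ _ _ h => h.1)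
  obtain ⟨s2, k2⟩ := HN.pos' n (fun x y z w => Pos4 x y z w ∧ z < x) (fun x y z w => τ z w x y) (fun _ _ _ _ h => h.1)
  obtain ⟨s3, k3⟩ := HN.pos' n (fun x y z w => Pos4 x y z w ∧ z < x) G (fun _ _ _ _ h => h.1)
  obtain ⟨s4, k4⟩ := HN.pos' n (fun x y z w => Pos4 x y z w) E (fun _ _ _ _ h => h)
  have k2' : HN n (fun x y z w => ind (Pos4 x y z w ∧ x < z) (τ x y z w)) s2 := by
    refine k2.equiv (fun x y z w => z) (fun x y z w => w) (fun x y z w => x) (fun x y z w => y)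
      (fun x y z w => z) (fun x y z w => w) (fun x y z w => x) (fun x y z w => y) ?_ ?_ ?_ ?_
    · intro x y z w; ring
    · intro x y z w; simp
    · intro x y z w; simp
    · intro x y z w _
      simp only [ind]
      refine if_congr ?_ rfl rfl
      simp only [Pos4]; tauto
  have k3' : HN n (fun x y z w => ind (Pos4 x y z w ∧ z < x) (G (w + y) z y (x - z))) s3 := by
    refine k3.equiv (fun x y z w => w + y) (fun x y z w => z) (fun x y z w => y) (fun x y z w => x - z)
      (fun x y z w => w + y) (fun x y z w => z) (fun x y z w => y) (fun x y z w => x - z) ?_ ?_ ?_ ?_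
    · intro x y z w; ring
    · intro x y z w; simp
    · intro x y z w; simp
    · intro x y z w _
      simp only [ind]
      refine if_congr ?_ rfl rfl
      simp only [Pos4]
      constructor <;> (rintro ⟨⟨a, b, c, d⟩, e⟩; refine ⟨⟨?_, ?_, ?_, ?_⟩, ?_⟩ <;> omega)
  have k4' : HN n (fun x y z w => ind (Pos4 x y z w) (E y x z w)) s4 := by
    refine k4.equiv (fun x y z w => y) (fun x y z w => x) (fun x y z w => z) (fun x y z w => w)
      (fun x y z w => y) (fun x y z w => x) (fun x y z w => z) (fun x y z w => w) ?_ ?_ ?_ ?_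
    · intro x y z w; ring
    · intro x y z w; simp
    · intro x y z w; simp
    · intro x y z w _
      simp only [ind]
      refine if_congr ?_ rfl rfl
      simp only [Pos4]; tauto
  have e12 : s1 + s2 = s3 - s3 := by
    refine (k1.add k2).unique ((k3.sub k3').congr ?_)
    intro x y z w hd
    simp only [ind]
    split_ifs
    · exact h2 x y z w hd
    · simp
  have fin := (((hb'.add k1).add k2').add k4).sub k4'
  have es : Bd + s1 + s2 + s4 - s4 = Bd := by linarith
  rw [es] at fin
  refine fin.congr ?_
  intro x y z w hd
  rw [h1 x y z w hd]
  simp only [ind]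
  split_ifs <;> first | (exfalso; omega) | ring

theorem partC (n : ℕ) (hn : 0 < n) (f : ℤ → ℝ) (hf : ∀ t, f (-t) = f t) (f0 : f 0 = 0) {s : ℝ}
    (hs : HN n (fun x y z w => ind (Pos4 x y z w) (f (x + y - z) - f (x + y + z))) s) :
    HF (fun t : ℤ => f t * hurwitzClassNumber (4 * n - t ^ 2))
      (s / 3 + 1 / 6 * ∑ u ∈ n.divisorsAntidiagonal, Psi f u.1 u.2) := by
  obtain ⟨A, hA⟩ := HN.pos' n (fun x y z w => Pos4 x y z w) (fun x y z w => f (x + y - z)) (fun _ _ _ _ h => h)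
  obtain ⟨B, hB⟩ := HN.pos' n (fun x y z w => Pos4 x y z w) (fun x y z w => f (x + y + z)) (fun _ _ _ _ h => h)
  have e : s = A - B := by
    refine hs.unique ((hA.sub hB).congr ?_)
    intro x y z w _
    simp only [ind]; split_ifs <;> simp
  rw [e]
  exact partAB n hn f hf f0 A B hA hB

theorem div_pos' {n : ℕ} {u : ℕ × ℕ} (hu : u ∈ n.divisorsAntidiagonal) :
    0 < u.1 ∧ 0 < u.2 ∧ u.1 * u.2 = n := by
  have hu' := Nat.mem_divisorsAntidiagonal.1 hu
  refine ⟨Nat.pos_of_ne_zero ?_, Nat.pos_of_ne_zero ?_, hu'.1⟩ <;>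
  · intro h; rw [h] at hu'; simp at hu'; omega


end

section

theorem Fs_sq (m : ℕ) : Fs (fun t => (t:ℝ) ^ 2) m = (m:ℝ) * (m + 1) * (2 * m + 1) / 6 := by
  unfold Fs
  induction m with
  | zero => simp
  | succ k ih =>
    have : Finset.Ioc (0:ℤ) ((k+1 : ℕ):ℤ) = insert ((k:ℤ)+1) (Finset.Ioc (0:ℤ) (k:ℤ)) := by
      ext t; simp only [Finset.mem_Ioc, Finset.mem_insert]; omega
    rw [this, Finset.sum_insert (by simp), ih]
    push_cast; ring

theorem bd_sq (x e : ℝ) (m : ℕ) : ∑ w ∈ Finset.Ioo (0:ℤ) (m + 1 : ℕ),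
    (-4 * x * x - 4 * (e - w) * x + 8 * x * x + 4 * x * w - 8 * (e - w) * (e - w) - 4 * (e - w) * w : ℝ)
    = m * (4 * x ^ 2 - 4 * e * x - 8 * e ^ 2) + (8 * x + 12 * e) * (m * (m + 1) / 2) - 4 * (m * (m + 1) * (2 * m + 1) / 6) := by
  induction m with
  | zero =>
    rw [show Finset.Ioo (0:ℤ) ((0 + 1 : ℕ):ℤ) = ∅ by decide]; simp
  | succ k ih =>
    have : Finset.Ioo (0:ℤ) ((k + 1 + 1 : ℕ):ℤ) = insert ((k:ℤ)+1) (Finset.Ioo (0:ℤ) ((k+1 : ℕ):ℤ)) := by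
      ext t; simp only [Finset.mem_Ioo, Finset.mem_insert]; omega
    rw [this, Finset.sum_insert (by simp), ih]
    push_cast; ring

theorem E2 (n : ℕ) (hn : 0 < n) : HF (fun t : ℤ => (t:ℝ) ^ 2 * hurwitzClassNumber (4 * n - t ^ 2))
    (∑ u ∈ n.divisorsAntidiagonal, ((n:ℝ) * (u.1 + u.2) - n * min (u.1:ℝ) u.2 - min (u.1:ℝ) u.2 ^ 3)) := by
  have hm := master n hn (fun x y z w => ((x + y - z : ℤ) : ℝ) ^ 2 - ((x + y + z : ℤ) : ℝ) ^ 2)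
    (fun x y z w => -4 * x * z - 4 * y * z + 8 * x * x + 4 * x * w - 8 * y * y - 4 * y * w)
    (fun x y z w => 8 * x * x - 8 * x * z - 8 * y * y)
    (fun x y z w => -8 * x * x - 4 * x * w)
    (by intro x y z w _; push_cast; ring) (by intro x y z w _; push_cast; ring)
  have := partC n hn (fun t => (t:ℝ) ^ 2) (by intro t; push_cast; ring) (by simp) hm
  refine this.congr (fun _ => rfl) ?_
  rw [div_symm n (fun u v => ∑ w ∈ Finset.Ioo 0 v, 
    (-4 * (u:ℝ) * u - 4 * ((v - w : ℤ) : ℝ) * u + 8 * u * u + 4 * u * w - 8 * ((v - w : ℤ) : ℝ) * ((v - w : ℤ) : ℝ) - 4 * ((v - w : ℤ) : ℝ) * w))]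
  rw [Finset.mul_sum, Finset.mul_sum, Finset.sum_div, ← Finset.sum_add_distrib]
  refine Finset.sum_congr rfl fun u hu => ?_
  obtain ⟨p1, p2, hd⟩ := div_pos' hu
  have hd' : (n:ℝ) = u.1 * u.2 := by rw [← hd]; push_cast; ring
  rw [hd']
  obtain ⟨u, v⟩ := u
  dsimp only at *
  obtain ⟨a, rfl⟩ : ∃ a, u = a + 1 := ⟨u - 1, by omega⟩
  obtain ⟨b, rfl⟩ : ∃ b, v = b + 1 := ⟨v - 1, by omega⟩
  have b1 := bd_sq ((a + 1 : ℕ) : ℝ) ((b + 1 : ℕ) : ℝ) b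
  have b2 := bd_sq ((b + 1 : ℕ) : ℝ) ((a + 1 : ℕ) : ℝ) a
  simp only [Int.cast_sub, Int.cast_natCast] at *
  rw [b1, b2]
  unfold Psi
  have e : (((a + 1 : ℕ) : ℤ) + ((b + 1 : ℕ) : ℤ)) = ((a + 1 + (b + 1) : ℕ) : ℤ) := by push_cast; ring
  rw [e, Fs_sq, Fs_sq, Fs_sq]
  push_cast
  rcases le_total (a:ℝ) b with h | h
  · rw [abs_of_nonpos (by linarith), min_eq_left (by linarith)]; ring
  · rw [abs_of_nonneg (by linarith), min_eq_right (by linarith)]; ring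


end

section

/-- quadratic form evaluation -/
def qev (c : ℕ → ℤ) (x y z w : ℤ) : ℤ :=
  c 0 * x * x + c 1 * x * y + c 2 * x * z + c 3 * x * w + c 4 * y * y + c 5 * y * z + c 6 * y * w
    + c 7 * z * z + c 8 * z * w + c 9 * w * w

/-- pullback by the swap of pairs -/
def pSW (c : ℕ → ℤ) : ℕ → ℤ := fun m => [c 7, c 8, c 2, c 5, c 9, c 3, c 6, c 0, c 1, c 4].getD m 0
/-- pullback by the swap of the first two coordinates -/
def pXY (c : ℕ → ℤ) : ℕ → ℤ := fun m => [c 4, c 1, c 5, c 6, c 0, c 2, c 3, c 7, c 8, c 9].getD m 0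
/-- pullback by the involution -/
def pTT (c : ℕ → ℤ) : ℕ → ℤ := fun m => [c 9, c 3 + c 8, c 6 - 2 * c 9, c 3, c 0 + c 2 + c 7,
  c 1 - c 3 + c 5 - c 8, 2 * c 0 + c 2, c 4 - c 6 + c 9, c 1 - c 3, c 0].getD m 0

theorem qev_SW (c x y z w) : qev (pSW c) x y z w = qev c z w x y := by
  simp only [qev, pSW, List.getD_cons_zero, List.getD_cons_succ]; ring
theorem qev_XY (c x y z w) : qev (pXY c) x y z w = qev c y x z w := by
  simp only [qev, pXY, List.getD_cons_zero, List.getD_cons_succ]; ring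
theorem qev_TT (c x y z w) : qev (pTT c) x y z w = qev c (w + y) z y (x - z) := by
  simp only [qev, pTT, List.getD_cons_zero, List.getD_cons_succ]; ring
theorem qev_congr {c c' : ℕ → ℤ} (h : ∀ m < 10, c m = c' m) (x y z w) : qev c x y z w = qev c' x y z w := by
  simp only [qev]
  rw [h 0 (by norm_num), h 1 (by norm_num), h 2 (by norm_num), h 3 (by norm_num), h 4 (by norm_num),
    h 5 (by norm_num), h 6 (by norm_num), h 7 (by norm_num), h 8 (by norm_num), h 9 (by norm_num)]

/-- residue code up to sign -/
def rcode (a b c d : ℕ) : ℕ :=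
  min (27 * a + 9 * b + 3 * c + d)
    (27 * ((3 - a) % 3) + 9 * ((3 - b) % 3) + 3 * ((3 - c) % 3) + ((3 - d) % 3))

/-- table lookup -/
def look (t : List (ℕ × ℕ × ℤ)) (r m : ℕ) : ℤ :=
  t.foldr (fun e s => if e.1 = r then (if e.2.1 = m then e.2.2 + s else s) else s) 0

/-- coefficients of the target -/
def ft (a b c : ℕ) : ℕ → ℤ := fun m =>
  (if (a + b + 2 * c) % 3 = 0 then [1, 2, -2, 0, 1, -2, 0, 1, 0, 0].getD m 0 else 0) -
  (if (a + b + c) % 3 = 0 then [1, 2, 2, 0, 1, 2, 0, 1, 0, 0].getD m 0 else 0)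

/-- character mod 3 on residues -/
def ch (a : ℕ) : ℤ := if a % 3 = 1 then 1 else if a % 3 = 2 then -1 else 0

/-- coefficients of the cusp form target -/
def ta (a c d : ℕ) : ℕ → ℤ := fun m =>
  if (c * d) % 3 = 0 then ch a * ch c * [0, 1, 0, 0, 0, 0, 0, 0, -1, 0].getD m 0 else 0

/-- tables -/
def G1t : List (ℕ × ℕ × ℤ) := [(4, 0, 3), (4, 4, -3), (13, 0, 5), (13, 3, 1), (13, 5, -5), (13, 6, -2), (13, 9, -1), (17, 6, -6), (17, 7, 3), (17, 9, -3), (31, 4, -3), (35, 0, 1), (35, 3, -5), (35, 6, -2), (35, 8, -2), (36, 9, -3), (37, 0, -2), (37, 3, -5), (37, 5, 1), (37, 7, 7), (37, 9, -1), (39, 9, -3), (42, 0, 1), (42, 1, -7), (42, 3, -6), (42, 5, -5), (42, 9, -5), (50, 1, -5), (50, 2, -2), (50, 6, 2), (52, 3, 7), (52, 6, -2), (52, 7, 2), (52, 8, -2)]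
/-- tables -/
def E1t : List (ℕ × ℕ × ℤ) := [(4, 4, 3), (13, 0, -4), (13, 3, 6), (13, 7, 3), (13, 9, 1), (17, 2, -2), (17, 4, 2), (17, 7, 2), (31, 0, -3), (31, 1, -7), (31, 2, 2), (31, 3, -2), (31, 5, 4), (31, 8, 7), (35, 1, 2), (35, 2, 2), (35, 3, -6), (35, 4, 4), (38, 4, 3), (39, 6, 6), (42, 0, 1), (42, 2, -4), (42, 6, -2), (50, 1, -1), (50, 4, 1), (52, 4, 5), (52, 5, -6), (52, 6, 6)]
/-- tables -/
def G2t : List (ℕ × ℕ × ℤ) := [(5, 0, 4), (14, 2, 4), (16, 1, -36), (16, 3, -34), (16, 7, 13), (16, 8, 32), (16, 9, -16), (32, 4, -4), (34, 1, 36), (34, 7, 16), (34, 8, -32), (34, 9, 18), (40, 0, -18), (40, 8, 32), (44, 6, -44), (44, 9, -13), (45, 2, -4), (45, 6, -4), (45, 9, -4), (46, 2, 4), (46, 4, 4), (46, 6, 4), (47, 2, -18), (47, 5, 34), (47, 7, 31), (48, 6, 4), (51, 0, 16), (51, 3, -34), (51, 5, -32), (51, 6, -18), (51, 8, 36), (51,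 9, -31)]
/-- tables -/
def E2t : List (ℕ × ℕ × ℤ) := [(5, 0, -4), (5, 6, 4), (14, 3, -4), (14, 5, -2), (14, 6, 2), (14, 7, -1), (16, 7, 17), (16, 8, -32), (16, 9, 18), (32, 0, -4), (32, 1, -36), (32, 4, 13), (32, 5, -20), (34, 5, 24), (40, 2, 20), (40, 3, -16), (40, 4, 15), (44, 0, -14), (44, 2, 14), (44, 6, 22), (46, 2, -30), (46, 6, 2), (46, 9, 1), (47, 4, -2), (47, 7, -14), (47, 8, 34), (48, 3, 18), (48, 5, 2), (48, 6, -8), (48, 8, 38), (51, 7, -1), (51, 9, 12)]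

/-- coefficients of tau -/
def tp (k : ℤ) (Et : List (ℕ × ℕ × ℤ)) (a b c d : ℕ) : ℕ → ℤ := fun m =>
  ft a b c m + k * ta a c d m - look Et (rcode a b c d) m + pXY (look Et (rcode b a c d)) m

set_option maxRecDepth 100000 in
theorem D1 : ∀ a b c d : Fin 3, (a.1 * b.1 + c.1 * d.1) % 3 = 1 → ∀ m : Fin 10,
    tp 9 E1t a.1 b.1 c.1 d.1 m.1 + pSW (tp 9 E1t c.1 d.1 a.1 b.1) m.1 = look G1t (rcode a.1 b.1 c.1 d.1) m.1 -
      pTT (look G1t (rcode ((d.1 + b.1) % 3) c.1 b.1 ((a.1 + 2 * c.1) % 3))) m.1 := by decide +kernel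

set_option maxRecDepth 100000 in
theorem D2 : ∀ a b c d : Fin 3, (a.1 * b.1 + c.1 * d.1) % 3 = 2 → ∀ m : Fin 10,
    tp 0 E2t a.1 b.1 c.1 d.1 m.1 + pSW (tp 0 E2t c.1 d.1 a.1 b.1) m.1 = look G2t (rcode a.1 b.1 c.1 d.1) m.1 -
      pTT (look G2t (rcode ((d.1 + b.1) % 3) c.1 b.1 ((a.1 + 2 * c.1) % 3))) m.1 := by decide +kernel

end

section

/-- residue -/
def rs (x : ℤ) : ℕ := (x % 3).toNat

/-- squares of multiples of three -/
noncomputable def f3 (t : ℤ) : ℝ := if t % 3 = 0 then (t : ℝ) ^ 2 else 0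

/-- cusp target -/
noncomputable def tA (x y z w : ℤ) : ℝ := ((qev (ta (rs x) (rs z) (rs w)) x y z w : ℤ) : ℝ)

/-- tau -/
noncomputable def tau (k : ℤ) (Et : List (ℕ × ℕ × ℤ)) (x y z w : ℤ) : ℝ :=
  ((qev (tp k Et (rs x) (rs y) (rs z) (rs w)) x y z w : ℤ) : ℝ)

theorem qev_ft (x y z w : ℤ) : ((qev (ft (rs x) (rs y) (rs z)) x y z w : ℤ) : ℝ) =
    f3 (x + y - z) - f3 (x + y + z) := by
  have e1 : (rs x + rs y + 2 * rs z) % 3 = 0 ↔ (x + y - z) % 3 = 0 := by unfold rs; omega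
  have e2 : (rs x + rs y + rs z) % 3 = 0 ↔ (x + y + z) % 3 = 0 := by unfold rs; omega
  simp only [qev, ft, f3, e1, e2, List.getD_cons_zero, List.getD_cons_succ]
  split_ifs <;> push_cast <;> ring

theorem mod3_mul (x y z w : ℤ) (n : ℕ) (h : x * y + z * w = n) :
    (rs x * rs y + rs z * rs w) % 3 = n % 3 := by
  have : ((rs x * rs y + rs z * rs w : ℕ) : ℤ) % 3 = (n : ℤ) % 3 := by
    rw [← h]
    have hx : ∀ x : ℤ, (rs x : ℤ) = x % 3 := by intro x; unfold rs; omega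
    push_cast
    simp only [hx]
    rw [Int.add_emod, ← Int.mul_emod, ← Int.mul_emod, ← Int.add_emod]
  omega

theorem cert (k : ℤ) (Et Gt : List (ℕ × ℕ × ℤ)) (n : ℕ) (hn : 0 < n)
    (D : ∀ a b c d : Fin 3, (a.1 * b.1 + c.1 * d.1) % 3 = n % 3 → ∀ m : Fin 10,
    tp k Et a.1 b.1 c.1 d.1 m.1 + pSW (tp k Et c.1 d.1 a.1 b.1) m.1 = look Gt (rcode a.1 b.1 c.1 d.1) m.1 -
      pTT (look Gt (rcode ((d.1 + b.1) % 3) c.1 b.1 ((a.1 + 2 * c.1) % 3))) m.1) :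
    HN n (fun x y z w => ind (Pos4 x y z w) (f3 (x + y - z) - f3 (x + y + z) + k * tA x y z w))
      (∑ u ∈ n.divisorsAntidiagonal, ∑ w ∈ Finset.Ioo 0 (u.2 : ℤ), tau k Et u.1 (u.2 - w) u.1 w) := by
  have hr : ∀ x, rs x < 3 := by intro x; unfold rs; omega
  refine master n hn _ (tau k Et)
    (fun x y z w => ((qev (look Gt (rcode (rs x) (rs y) (rs z) (rs w))) x y z w : ℤ) : ℝ))
    (fun x y z w => ((qev (look Et (rcode (rs x) (rs y) (rs z) (rs w))) x y z w : ℤ) : ℝ)) ?_ ?_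
  · intro x y z w _
    rw [← qev_ft x y z w, tA, tau, ← qev_XY (look Et (rcode (rs y) (rs x) (rs z) (rs w))) x y z w]
    simp only [qev, tp]
    push_cast
    ring
  · intro x y z w h
    have hm := mod3_mul x y z w n h
    have key := D ⟨rs x, hr x⟩ ⟨rs y, hr y⟩ ⟨rs z, hr z⟩ ⟨rs w, hr w⟩ hm
    have e1 : (rs w + rs y) % 3 = rs (w + y) := by unfold rs; omega
    have e2 : (rs x + 2 * rs z) % 3 = rs (x - z) := by unfold rs; omega
    simp only [e1, e2] at key
    simp only [tau]
    rw [← qev_SW (tp k Et (rs z) (rs w) (rs x) (rs y)) x y z w, ← qev_TT (look Gt (rcode (rs (w + y)) (rs z) (rs y) (rs (x - z)))) x y z w]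
    rw [← Int.cast_add, ← Int.cast_sub]
    congr 1
    have := qev_congr (c := fun m => tp k Et (rs x) (rs y) (rs z) (rs w) m + pSW (tp k Et (rs z) (rs w) (rs x) (rs y)) m)
      (c' := fun m => look Gt (rcode (rs x) (rs y) (rs z) (rs w)) m - pTT (look Gt (rcode (rs (w + y)) (rs z) (rs y) (rs (x - z)))) m)
      (fun m hm => key ⟨m, hm⟩) x y z w
    simp only [qev] at this ⊢
    linarith

/-- coefficients in w -/
def cA (c : ℕ → ℤ) (x e : ℝ) : ℝ := (c 0 + c 2 + c 7) * x ^ 2 + (c 1 + c 5) * x * e + c 4 * e ^ 2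
/-- coefficients in w -/
def cB (c : ℕ → ℤ) (x e : ℝ) : ℝ := (c 3 + c 8 - c 1 - c 5) * x + (c 6 - 2 * c 4) * e
/-- coefficients in w -/
def cC (c : ℕ → ℤ) : ℝ := c 4 - c 6 + c 9

theorem qev_w (c : ℕ → ℤ) (x e w : ℤ) : ((qev c x (e - w) x w : ℤ) : ℝ) =
    cA c x e + cB c x e * w + cC c * w ^ 2 := by
  simp only [qev, cA, cB, cC]; push_cast; ring

theorem quad3 (g : ℤ → ℝ) (A1 B1 C1 A2 B2 C2 A3 B3 C3 : ℝ)
    (h1 : ∀ w, w % 3 = 1 → g w = A1 + B1 * w + C1 * w ^ 2)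
    (h2 : ∀ w, w % 3 = 2 → g w = A2 + B2 * w + C2 * w ^ 2)
    (h3 : ∀ w, w % 3 = 0 → g w = A3 + B3 * w + C3 * w ^ 2) (q : ℕ) :
    ∑ w ∈ Finset.Ioo (0:ℤ) (3 * q + 1), g w =
      q * (A1 + B1 + C1 + A2 + 2 * B2 + 4 * C2 + A3 + 3 * B3 + 9 * C3)
      + (3 * (B1 + B2 + B3) + 6 * (C1 + 2 * C2 + 3 * C3)) * (q * (q - 1) / 2)
      + 9 * (C1 + C2 + C3) * ((q - 1) * q * (2 * q - 1) / 6) := by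
  induction q with
  | zero => rw [show Finset.Ioo (0:ℤ) (3 * (0 : ℕ) + 1) = ∅ by decide]; simp
  | succ k ih =>
    have : Finset.Ioo (0:ℤ) (3 * ((k + 1 : ℕ) : ℤ) + 1) = insert (3 * (k:ℤ) + 3) (insert (3 * (k:ℤ) + 2)
      (insert (3 * (k:ℤ) + 1) (Finset.Ioo (0:ℤ) (3 * (k : ℤ) + 1)))) := by
      ext t; simp only [Finset.mem_Ioo, Finset.mem_insert]; omega
    rw [this, Finset.sum_insert (by simp), Finset.sum_insert (by simp), Finset.sum_insert (by simp), ih,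
      h3 _ (by omega), h2 _ (by omega), h1 _ (by omega)]
    push_cast; ring

theorem bsum (k : ℤ) (Et) (x e : ℤ) (q : ℕ) (r s0 s1 s2 : ℕ) (c1 c2 c3 : ℕ → ℤ) (hx : rs x = r)
    (hs0 : rs e = s0) (hs1 : rs (e - 1) = s1) (hs2 : rs (e - 2) = s2)
    (h1 : ∀ m < 10, tp k Et r s1 r 1 m = c1 m) (h2 : ∀ m < 10, tp k Et r s2 r 2 m = c2 m)
    (h3 : ∀ m < 10, tp k Et r s0 r 0 m = c3 m) :
    ∑ w ∈ Finset.Ioo (0:ℤ) (3 * q + 1), tau k Et x (e - w) x w =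
      q * (cA c1 x e + cB c1 x e + cC c1 + cA c2 x e + 2 * cB c2 x e + 4 * cC c2 + cA c3 x e + 3 * cB c3 x e + 9 * cC c3)
      + (3 * (cB c1 x e + cB c2 x e + cB c3 x e) + 6 * (cC c1 + 2 * cC c2 + 3 * cC c3)) * (q * (q - 1) / 2)
      + 9 * (cC c1 + cC c2 + cC c3) * ((q - 1) * q * (2 * q - 1) / 6) ∧
    tau k Et x (e - (3 * q + 1)) x (3 * q + 1) =
      cA c1 x e + cB c1 x e * (3 * q + 1) + cC c1 * (3 * q + 1) ^ 2 := by
  have g1 : ∀ w : ℤ, w % 3 = 1 → tau k Et x (e - w) x w = cA c1 x e + cB c1 x e * w + cC c1 * w ^ 2 := by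
    intro w hw
    have e1 : rs (e - w) = s1 := by unfold rs at *; omega
    have e2 : rs w = 1 := by unfold rs at *; omega
    rw [tau, hx, e1, e2, qev_congr h1, qev_w]
  refine ⟨quad3 _ _ _ _ _ _ _ _ _ _ g1 ?_ ?_ q, ?_⟩
  · intro w hw
    have e1 : rs (e - w) = s2 := by unfold rs at *; omega
    have e2 : rs w = 2 := by unfold rs at *; omega
    rw [tau, hx, e1, e2, qev_congr h2, qev_w]
  · intro w hw
    have e1 : rs (e - w) = s0 := by unfold rs at *; omega
    have e2 : rs w = 0 := by unfold rs at *; omega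
    rw [tau, hx, e1, e2, qev_congr h3, qev_w]
  · rw [g1 _ (by omega)]; push_cast; ring

theorem Fs_f3 (k : ℕ) : Fs f3 (3 * k) = 9 * ((k:ℝ) * (k + 1) * (2 * k + 1) / 6) ∧
    Fs f3 (3 * k + 1) = 9 * ((k:ℝ) * (k + 1) * (2 * k + 1) / 6) ∧
    Fs f3 (3 * k + 2) = 9 * ((k:ℝ) * (k + 1) * (2 * k + 1) / 6) := by
  have st : ∀ m : ℕ, Fs f3 ((m:ℤ) + 1) = Fs f3 m + f3 (m + 1) := by
    intro m
    unfold Fs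
    have : Finset.Ioc (0:ℤ) ((m:ℤ) + 1) = insert ((m:ℤ)+1) (Finset.Ioc (0:ℤ) (m:ℤ)) := by
      ext t; simp only [Finset.mem_Ioc, Finset.mem_insert]; omega
    rw [this, Finset.sum_insert (by simp)]; ring
  have z1 : ∀ k : ℕ, Fs f3 (3 * k + 1) = Fs f3 (3 * k) := by
    intro k
    have := st (3 * k)
    push_cast at this
    rw [this, f3, if_neg (by omega), add_zero]
  have z2 : ∀ k : ℕ, Fs f3 (3 * k + 2) = Fs f3 (3 * k) := by
    intro k
    have := st (3 * k + 1)
    push_cast at this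
    rw [show (3 * (k:ℤ) + 2) = 3 * k + 1 + 1 by ring, this, f3, if_neg (by omega), add_zero, z1]
  have main : ∀ k : ℕ, Fs f3 (3 * k) = 9 * ((k:ℝ) * (k + 1) * (2 * k + 1) / 6) := by
    intro k
    induction k with
    | zero => simp [Fs]
    | succ k ih =>
      have := st (3 * k + 2)
      push_cast at this
      rw [show (3 * ((k + 1 : ℕ):ℤ)) = 3 * k + 2 + 1 by push_cast; ring, this, z2, ih, f3, if_pos (by omega)]
      push_cast; ring
  exact ⟨main k, (z1 k).trans (main k), (z2 k).trans (main k)⟩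


end

section

theorem b1_1 (a q : ℕ) : ∑ w ∈ Finset.Ioo (0:ℤ) ((3 * q + 1 : ℕ) : ℤ), tau 9 E1t ((3 * a + 1 : ℕ) : ℤ) (((3 * q + 1 : ℕ) : ℤ) - w) ((3 * a + 1 : ℕ) : ℤ) w =
    (-3/2) * a ^ 0 * q ^ 1 + (-9/2) * a ^ 0 * q ^ 2 + (-12) * a ^ 0 * q ^ 3 + (9/2) * a ^ 1 * q ^ 1 + (63/2) * a ^ 1 * q ^ 2 + (-9) * a ^ 2 * q ^ 1 := by
  have h := bsum 9 E1t ((3 * a + 1 : ℕ) : ℤ) ((3 * q + 1 : ℕ) : ℤ) q 1 1 0 2 (fun m => ([4, 9, -4, 2, -3, -6, 6, 4, -7, 1] : List ℤ).getD m 0) (fun m => ([5, 1, -6, 6, -1, 0, 0, 0, 0, 0] : List ℤ).getD m 0)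
    (fun m => ([-1, 7, -2, 6, -1, -2, -6, -1, -9, 0] : List ℤ).getD m 0) (by unfold rs; omega) (by unfold rs; omega) (by unfold rs; omega) (by unfold rs; omega)
    (by decide +kernel) (by decide +kernel) (by decide +kernel)
  rw [show ((3 * q + 1 : ℕ) : ℤ) = 3 * (q:ℤ) + 1 by push_cast; ring] at *
  rw [h.1]
  simp only [cA, cB, cC, List.getD_cons_zero, List.getD_cons_succ]
  push_cast
  ring

theorem b1_2 (a q : ℕ) : ∑ w ∈ Finset.Ioo (0:ℤ) ((3 * q + 2 : ℕ) : ℤ), tau 9 E1t ((3 * a + 2 : ℕ) : ℤ) (((3 * q + 2 : ℕ) : ℤ) - w) ((3 * a + 2 : ℕ) : ℤ) w =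
    (9) * a ^ 0 * q ^ 0 + (21) * a ^ 0 * q ^ 1 + (-12) * a ^ 0 * q ^ 3 + (9) * a ^ 1 * q ^ 0 + (81/2) * a ^ 1 * q ^ 1 + (63/2) * a ^ 1 * q ^ 2 + (-9) * a ^ 2 * q ^ 0 + (-9) * a ^ 2 * q ^ 1 := by
  have h := bsum 9 E1t ((3 * a + 2 : ℕ) : ℤ) ((3 * q + 2 : ℕ) : ℤ) q 2 2 1 0 (fun m => ([5, 1, -6, 6, -1, 0, 0, 0, 0, 0] : List ℤ).getD m 0) (fun m => ([4, 9, -4, 2, -3, -6, 6, 4, -7, 1] : List ℤ).getD m 0)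
    (fun m => ([-1, 7, -2, 6, -1, -2, -6, -1, -9, 0] : List ℤ).getD m 0) (by unfold rs; omega) (by unfold rs; omega) (by unfold rs; omega) (by unfold rs; omega)
    (by decide +kernel) (by decide +kernel) (by decide +kernel)
  have e : Finset.Ioo (0:ℤ) ((3 * q + 2 : ℕ) : ℤ) = insert (3 * (q:ℤ) + 1) (Finset.Ioo (0:ℤ) (3 * (q:ℤ) + 1)) := by
    ext t; simp only [Finset.mem_Ioo, Finset.mem_insert]; omega
  rw [e, Finset.sum_insert (by simp), h.1, h.2]
  simp only [cA, cB, cC, List.getD_cons_zero, List.getD_cons_succ]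
  push_cast
  ring

theorem b2_1 (a q : ℕ) : ∑ w ∈ Finset.Ioo (0:ℤ) ((3 * q + 2 : ℕ) : ℤ), tau 0 E2t ((3 * a + 1 : ℕ) : ℤ) (((3 * q + 2 : ℕ) : ℤ) - w) ((3 * a + 1 : ℕ) : ℤ) w =
    (-9) * a ^ 0 * q ^ 0 + (-51) * a ^ 0 * q ^ 1 + (-108) * a ^ 0 * q ^ 2 + (-66) * a ^ 0 * q ^ 3 + (42) * a ^ 1 * q ^ 0 + (186) * a ^ 1 * q ^ 1 + (144) * a ^ 1 * q ^ 2 + (-81) * a ^ 2 * q ^ 0 + (-81) * a ^ 2 * q ^ 1 := by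
  have h := bsum 0 E2t ((3 * a + 1 : ℕ) : ℤ) ((3 * q + 2 : ℕ) : ℤ) q 1 2 1 0 (fun m => ([14, -2, -22, 16, -16, 18, -16, -1, 0, 0] : List ℤ).getD m 0) (fun m => ([5, 38, -4, 2, -12, 18, -4, 0, 0, 0] : List ℤ).getD m 0)
    (fun m => ([0, 0, 0, -18, 0, -2, 8, -1, -38, 12] : List ℤ).getD m 0) (by unfold rs; omega) (by unfold rs; omega) (by unfold rs; omega) (by unfold rs; omega)
    (by decide +kernel) (by decide +kernel) (by decide +kernel)
  have e : Finset.Ioo (0:ℤ) ((3 * q + 2 : ℕ) : ℤ) = insert (3 * (q:ℤ) + 1) (Finset.Ioo (0:ℤ) (3 * (q:ℤ) + 1)) := by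
    ext t; simp only [Finset.mem_Ioo, Finset.mem_insert]; omega
  rw [e, Finset.sum_insert (by simp), h.1, h.2]
  simp only [cA, cB, cC, List.getD_cons_zero, List.getD_cons_succ]
  push_cast
  ring

theorem b2_2 (a q : ℕ) : ∑ w ∈ Finset.Ioo (0:ℤ) ((3 * q + 1 : ℕ) : ℤ), tau 0 E2t ((3 * a + 2 : ℕ) : ℤ) (((3 * q + 1 : ℕ) : ℤ) - w) ((3 * a + 2 : ℕ) : ℤ) w =
    (-12) * a ^ 0 * q ^ 1 + (54) * a ^ 0 * q ^ 2 + (-66) * a ^ 0 * q ^ 3 + (-60) * a ^ 1 * q ^ 1 + (144) * a ^ 1 * q ^ 2 + (-81) * a ^ 2 * q ^ 1 := by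
  have h := bsum 0 E2t ((3 * a + 2 : ℕ) : ℤ) ((3 * q + 1 : ℕ) : ℤ) q 2 1 0 2 (fun m => ([5, 38, -4, 2, -12, 18, -4, 0, 0, 0] : List ℤ).getD m 0) (fun m => ([14, -2, -22, 16, -16, 18, -16, -1, 0, 0] : List ℤ).getD m 0)
    (fun m => ([0, 0, 0, -18, 0, -2, 8, -1, -38, 12] : List ℤ).getD m 0) (by unfold rs; omega) (by unfold rs; omega) (by unfold rs; omega) (by unfold rs; omega)
    (by decide +kernel) (by decide +kernel) (by decide +kernel)
  rw [show ((3 * q + 1 : ℕ) : ℤ) = 3 * (q:ℤ) + 1 by push_cast; ring] at *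
  rw [h.1]
  simp only [cA, cB, cC, List.getD_cons_zero, List.getD_cons_succ]
  push_cast
  ring


/-- the pair (u,v) contribution -/
theorem pair2 (u v : ℕ) (h : (u * v) % 3 = 2) (P : ℕ → ℕ → Prop)
    (h1 : ∀ a b, P (3 * a + 1) (3 * b + 2)) (h2 : ∀ a b, P (3 * a + 2) (3 * b + 1)) : P u v := by
  have : (u % 3) * (v % 3) % 3 = 2 := by rw [← Nat.mul_mod]; exact h
  have a1 : u % 3 < 3 := Nat.mod_lt _ (by norm_num)
  have a2 : v % 3 < 3 := Nat.mod_lt _ (by norm_num)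
  have e1 : u = 3 * (u / 3) + u % 3 := by omega
  have e2 : v = 3 * (v / 3) + v % 3 := by omega
  rw [e1, e2]
  generalize u / 3 = U
  generalize v / 3 = V
  clear e1 e2 h
  generalize u % 3 = s at *
  generalize v % 3 = t at *
  interval_cases s <;> interval_cases t <;> first | exact h1 _ _ | exact h2 _ _ | (exfalso; revert this; norm_num)

theorem pair1 (u v : ℕ) (h : (u * v) % 3 = 1) (P : ℕ → ℕ → Prop)
    (h1 : ∀ a b, P (3 * a + 1) (3 * b + 1)) (h2 : ∀ a b, P (3 * a + 2) (3 * b + 2)) : P u v := by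
  have : (u % 3) * (v % 3) % 3 = 1 := by rw [← Nat.mul_mod]; exact h
  have a1 : u % 3 < 3 := Nat.mod_lt _ (by norm_num)
  have a2 : v % 3 < 3 := Nat.mod_lt _ (by norm_num)
  have e1 : u = 3 * (u / 3) + u % 3 := by omega
  have e2 : v = 3 * (v / 3) + v % 3 := by omega
  rw [e1, e2]
  generalize u / 3 = U
  generalize v / 3 = V
  clear e1 e2 h
  generalize u % 3 = s at *
  generalize v % 3 = t at *
  interval_cases s <;> interval_cases t <;> first | exact h1 _ _ | exact h2 _ _ | (exfalso; revert this; norm_num)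

theorem f3_0 (t : ℤ) (h : t % 3 = 0) : f3 t = (t:ℝ) ^ 2 := if_pos h
theorem f3_1 (t : ℤ) (h : t % 3 ≠ 0) : f3 t = 0 := if_neg h

theorem S2 (n : ℕ) (hn : n % 3 = 2) : HF (fun t : ℤ => f3 t * hurwitzClassNumber (4 * n - t ^ 2))
    (∑ u ∈ n.divisorsAntidiagonal, ((n:ℝ) * (u.1 + u.2) / 2 - n * min (u.1:ℝ) u.2 - min (u.1:ℝ) u.2 ^ 3)) := by
  have hm := cert 0 E2t G2t n (by omega) (by rw [hn]; exact D2)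
  have := partC n (by omega) f3 (by intro t; unfold f3; simp) (by simp [f3]) (hm.congr (by intro x y z w _; simp))
  refine this.congr (fun _ => rfl) ?_
  rw [div_symm n (fun u v => ∑ w ∈ Finset.Ioo 0 v, tau 0 E2t u (v - w) u w)]
  rw [Finset.mul_sum, Finset.mul_sum, Finset.sum_div, ← Finset.sum_add_distrib]
  refine Finset.sum_congr rfl fun u hu => ?_
  obtain ⟨p1, p2, hd⟩ := div_pos' hu
  have hd' : (n:ℝ) = u.1 * u.2 := by rw [← hd]; push_cast; ring
  rw [hd']
  obtain ⟨u, v⟩ := u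
  dsimp only at *
  have hd2 : u * v % 3 = 2 := by rw [← hn]; congr 1
  clear hd hd' p1 p2 hu
  refine pair2 u v hd2 (fun u v => 1 / 2 * (∑ w ∈ Finset.Ioo (0:ℤ) v, tau 0 E2t u (v - w) u w + ∑ w ∈ Finset.Ioo (0:ℤ) u, tau 0 E2t v (u - w) v w) / 3 +
    1 / 6 * Psi f3 u v = (u:ℝ) * v * (u + v) / 2 - u * v * min (u:ℝ) v - min (u:ℝ) v ^ 3) ?_ ?_
  all_goals
    intro a b
    simp only [b2_1, b2_2]
    unfold Psi
    rw [f3_0 (_ + _) (by omega), f3_1 _ (by omega), f3_1 _ (by omega)]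
    have f1 := Fs_f3 a
    have f2 := Fs_f3 b
    have f4 := (Fs_f3 (a + b + 1)).1
    push_cast at *
    first
    | rw [show ((3:ℤ) * a + 1 + (3 * b + 2)) = 3 * (a + b + 1) by ring, f4, f1.2.1, f2.2.2]
      rcases le_total ((3:ℝ) * a + 1) (3 * b + 2) with h | h
      · rw [abs_of_nonpos (by linarith), min_eq_left (by linarith)]; ring
      · rw [abs_of_nonneg (by linarith), min_eq_right (by linarith)]; ring
    | rw [show ((3:ℤ) * a + 2 + (3 * b + 1)) = 3 * (a + b + 1) by ring, f4, f1.2.2, f2.2.1]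
      rcases le_total ((3:ℝ) * a + 2) (3 * b + 1) with h | h
      · rw [abs_of_nonpos (by linarith), min_eq_left (by linarith)]; ring
      · rw [abs_of_nonneg (by linarith), min_eq_right (by linarith)]; ring

theorem S1 (n : ℕ) (hn : n % 3 = 1) : ∃ s, HN n (fun x y z w => ind (Pos4 x y z w) (tA x y z w)) s ∧
    HF (fun t : ℤ => f3 t * hurwitzClassNumber (4 * n - t ^ 2))
    (∑ u ∈ n.divisorsAntidiagonal, ((n:ℝ) * (u.1 + u.2) / 4 - n * ((ch u.1 : ℝ) + ch u.2) / 4) - 3 * s) := by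
  have hm := cert 9 E1t G1t n (by omega) (by rw [hn]; exact D1)
  obtain ⟨s, hs⟩ := HN.pos' n (fun x y z w => Pos4 x y z w) tA (fun _ _ _ _ h => h)
  refine ⟨s, hs, ?_⟩
  have := partC n (by omega) f3 (by intro t; unfold f3; simp) (by simp [f3])
    ((hm.sub (hs.mul 9)).congr (by intro x y z w _; unfold ind; split_ifs <;> push_cast <;> ring))
  refine this.congr (fun _ => rfl) ?_
  rw [div_symm n (fun u v => ∑ w ∈ Finset.Ioo 0 v, tau 9 E1t u (v - w) u w)]
  rw [sub_div, show 9 * s / 3 = 3 * s by ring, sub_add_eq_add_sub]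
  congr 1
  rw [Finset.mul_sum, Finset.mul_sum, Finset.sum_div, ← Finset.sum_add_distrib]
  refine Finset.sum_congr rfl fun u hu => ?_
  obtain ⟨p1, p2, hd⟩ := div_pos' hu
  have hd' : (n:ℝ) = u.1 * u.2 := by rw [← hd]; push_cast; ring
  rw [hd']
  obtain ⟨u, v⟩ := u
  dsimp only at *
  have hd2 : u * v % 3 = 1 := by rw [← hn]; congr 1
  clear hd hd' p1 p2 hu
  refine pair1 u v hd2 (fun u v => 1 / 2 * (∑ w ∈ Finset.Ioo (0:ℤ) v, tau 9 E1t u (v - w) u w + ∑ w ∈ Finset.Ioo (0:ℤ) u, tau 9 E1t v (u - w) v w) / 3 +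
    1 / 6 * Psi f3 u v = (u:ℝ) * v * (u + v) / 4 - u * v * ((ch u : ℝ) + ch v) / 4) ?_ ?_
  all_goals
    intro a b
    simp only [b1_1, b1_2]
    unfold Psi
    rw [f3_1 (_ + _) (by omega), f3_1 _ (by omega), f3_1 _ (by omega)]
    have f1 := Fs_f3 a
    have f2 := Fs_f3 b
    have f4 := (Fs_f3 (a + b)).2.2
    have f5 := (Fs_f3 (a + b + 1)).2.1
    have c1 : ∀ a, ch (3 * a + 1) = 1 := by intro a; unfold ch; rw [if_pos (by omega)]
    have c2 : ∀ a, ch (3 * a + 2) = -1 := by intro a; unfold ch; rw [if_neg (by omega), if_pos (by omega)]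
    push_cast at *
    simp only [c1, c2]
    push_cast
    first
    | rw [show ((3:ℤ) * a + 1 + (3 * b + 1)) = 3 * (a + b) + 2 by ring, f4, f1.2.1, f2.2.1]
      ring
    | rw [show ((3:ℤ) * a + 2 + (3 * b + 2)) = 3 * (a + b + 1) + 1 by ring, f5, f1.2.2, f2.2.2]
      ring


end

section
open PowerSeries

/-- truncated Euler product -/
noncomputable def PP (K : ℕ) : PowerSeries ℤ := ∏ k ∈ Finset.range K, (1 - X ^ (k + 1))

theorem PP_succ (K : ℕ) : PP (K + 1) = PP K * (1 - X ^ (K + 1)) := Finset.prod_range_succ _ _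

theorem PP_cong (K d : ℕ) : (X : PowerSeries ℤ) ^ (K + 1) ∣ PP (K + d) - PP K := by
  induction d with
  | zero => simp
  | succ d ih =>
    rw [← add_assoc, PP_succ]
    have : PP (K + d) * (1 - X ^ (K + d + 1)) - PP K = (PP (K + d) - PP K) - X ^ (K + 1) * (X ^ d * PP (K + d)) := by
      ring
    rw [this]
    exact dvd_sub ih (dvd_mul_right _ _)

theorem PP_unit (K : ℕ) : IsUnit (PP K) := by
  rw [PowerSeries.isUnit_iff_constantCoeff]
  unfold PP
  rw [map_prod]
  simp

/-- coefficients of the finite triple product -/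
noncomputable def gg : ℕ → ℕ → PowerSeries ℤ
  | 0, m => if m = 0 then 1 else 0
  | N + 1, 0 => (1 + X ^ (2 * N + 2)) * gg N 0 - X ^ (N + 1) * (gg N 1 - gg N 0)
  | N + 1, m + 1 => (1 + X ^ (2 * N + 2)) * gg N (m + 1) - X ^ (N + 1) * (gg N m + gg N (m + 2))

theorem gg_zero (N m : ℕ) (h : N < m) : gg N m = 0 := by
  induction N generalizing m with
  | zero => unfold gg; rw [if_neg (by omega)]
  | succ N ih =>
    obtain ⟨m, rfl⟩ : ∃ k, m = k + 1 := ⟨m - 1, by omega⟩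
    rw [gg, ih _ (by omega), ih _ (by omega), ih _ (by omega)]; ring

theorem gg_sum (N K : ℕ) (h : N < K) : ∑ m ∈ Finset.range K, (2 * m + 1 : PowerSeries ℤ) * gg N m = PP N ^ 2 := by
  induction N generalizing K with
  | zero =>
    rw [Finset.sum_eq_single 0]
    · simp [gg, PP]
    · intro b _ hb; rw [gg_zero _ _ (by omega), mul_zero]
    · intro hh; simp at hh; omega
  | succ N ih =>
    have key : ∀ K : ℕ, ∑ m ∈ Finset.range (K + 1), (2 * m + 1 : PowerSeries ℤ) * gg (N + 1) m =
        (1 - X ^ (N + 1)) ^ 2 * ∑ m ∈ Finset.range (K + 1), (2 * m + 1 : PowerSeries ℤ) * gg N m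
        + X ^ (N + 1) * ((2 * (K : PowerSeries ℤ) + 3) * gg N K - (2 * (K : PowerSeries ℤ) + 1) * gg N (K + 1)) := by
      intro K
      induction K with
      | zero => simp [gg]; ring
      | succ K ihK =>
        rw [Finset.sum_range_succ, Finset.sum_range_succ _ (K + 1), ihK, gg]
        push_cast
        ring
    obtain ⟨K, rfl⟩ : ∃ k, K = k + 1 := ⟨K - 1, by omega⟩
    rw [key, ih _ (by omega), gg_zero N K (by omega), gg_zero N (K + 1) (by omega), PP_succ]
    ring

/-- triangular numbers -/
def tri (m : ℕ) : ℕ := ∑ i ∈ Finset.range (m + 1), i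

theorem tri_succ (m : ℕ) : tri (m + 1) = tri m + (m + 1) := Finset.sum_range_succ _ _
theorem two_tri (m : ℕ) : 2 * tri m = m * (m + 1) := by
  induction m with
  | zero => rfl
  | succ m ih => rw [tri_succ, mul_add, ih]; ring

theorem gg_closed (N m d : ℕ) (h : N = m + d) : gg N m * PP d * PP (N + m + 1) = (-1) ^ m * X ^ (tri m) * PP (2 * N + 1) := by
  induction N generalizing m d with
  | zero =>
    obtain ⟨rfl, rfl⟩ : m = 0 ∧ d = 0 := by omega
    simp [gg, PP, tri]
  | succ N ih =>
    have hN : PP (2 * (N + 1) + 1) = PP (2 * N + 1) * (1 - X ^ (2 * N + 2)) * (1 - X ^ (2 * N + 3)) := by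
      rw [show 2 * (N + 1) + 1 = 2 * N + 1 + 1 + 1 by ring, PP_succ, PP_succ]
    rw [hN]
    rcases m with _ | m
    · obtain rfl : d = N + 1 := by omega
      have h0 := ih 0 N (by omega)
      rw [gg]
      rcases N with _ | N
      · rw [gg_zero 0 1 (by omega)]
        simp [gg, PP, tri, Finset.prod_range_succ]; ring
      · have h1 := ih 1 N (by omega)
        simp only [PP_succ N, PP_succ (N + 1), PP_succ (N + 1 + 1), PP_succ (N+1+1+1), add_zero, tri, Finset.sum_range_succ, Finset.sum_range_zero, pow_zero, one_mul, mul_one, add_zero, zero_add, pow_one] at h0 h1 ⊢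
        linear_combination ((1 + X ^ (2 * (N + 1) + 2)) + X ^ (N + 1 + 1)) * (1 - X ^ (N + 1 + 1)) * (1 - X ^ (N + 1 + 1 + 1)) * h0 -
          X ^ (N + 1 + 1) * (1 - X ^ (N + 1)) * (1 - X ^ (N + 1 + 1)) * h1
    · have hm := ih m (d + 0) (by omega)
      rw [gg]
      rcases d with _ | d
      · obtain rfl : N = m := by omega
        rw [gg_zero _ (N + 1) (by omega), gg_zero _ (N + 2) (by omega)]
        simp only [add_zero] at *
        rw [show N + 1 + (N + 1) + 1 = N + N + 1 + 1 + 1 by ring, PP_succ (N + N + 1 + 1), PP_succ (N + N + 1), tri_succ]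
        linear_combination (-X ^ (N + 1)) * (1 - X ^ (2 * N + 2)) * (1 - X ^ (2 * N + 3)) * hm
      · have h0 := ih (m + 1) d (by omega)
        rcases d with _ | d
        · obtain rfl : N = m + 1 := by omega
          rw [gg_zero _ (m + 2) (by omega)]
          rw [show m + 1 + 1 + (m + 1) + 1 = m + 1 + m + 1 + 1 + 1 by ring, PP_succ (m + 1 + m + 1 + 1), PP_succ (m + 1 + m + 1)]
          rw [show m + 1 + (m + 1) + 1 = m + 1 + m + 1 + 1 by ring, PP_succ (m + 1 + m + 1)] at h0
          simp only [tri_succ, zero_add, add_zero, PP_succ 0] at *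
          linear_combination (1 + X ^ (2 * (m + 1) + 2)) * (1 - X ^ 1) * (1 - X ^ (2 * m + 4)) * h0 
            - X ^ (m + 2) * (1 - X ^ (2 * m + 3)) * (1 - X ^ (2 * m + 4)) * hm
        · have h1 := ih (m + 2) d (by omega)
          obtain rfl : N = m + 2 + d := by omega
          rw [show m + 2 + d + 1 + (m + 1) + 1 = m + 2 + d + m + 1 + 1 + 1 by ring, PP_succ (m + 2 + d + m + 1 + 1), PP_succ (m + 2 + d + m + 1)]
          rw [show m + 2 + d + (m + 1) + 1 = m + 2 + d + m + 1 + 1 by ring, PP_succ (m + 2 + d + m + 1)] at h0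
          rw [show m + 2 + d + (m + 2) + 1 = m + 2 + d + m + 1 + 1 + 1 by ring, PP_succ (m + 2 + d + m + 1 + 1), PP_succ (m + 2 + d + m + 1)] at h1
          simp only [tri_succ, add_zero, PP_succ d, PP_succ (d + 1)] at *
          linear_combination (1 + X ^ (2 * (m + 2 + d) + 2)) * (1 - X ^ (d + 2)) * (1 - X ^ (2 * m + d + 5)) * h0 
            - X ^ (m + d + 3) * (1 - X ^ (2 * m + d + 4)) * (1 - X ^ (2 * m + d + 5)) * hm
            - X ^ (m + d + 3) * (1 - X ^ (d + 1)) * (1 - X ^ (d + 2)) * h1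

theorem gg_cong (N m d : ℕ) (h : N = m + d) : (X : PowerSeries ℤ) ^ (N + 1) ∣ PP N * gg N m - (-1) ^ m * X ^ (tri m) := by
  have hc := gg_closed N m d h
  obtain ⟨u, hu⟩ := ((PP_unit d).mul (PP_unit (N + m + 1)))
  set g' : PowerSeries ℤ := (-1) ^ m * PP (2 * N + 1) * (↑u⁻¹ : PowerSeries ℤ) with hg
  have e1 : gg N m = X ^ tri m * g' := by
    have : gg N m * (u : PowerSeries ℤ) * (↑u⁻¹ : PowerSeries ℤ) = (-1) ^ m * X ^ (tri m) * PP (2 * N + 1) * (↑u⁻¹ : PowerSeries ℤ) := by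
      rw [hu, ← mul_assoc, hc]
    rw [Units.mul_inv_cancel_right] at this
    rw [this, hg]; ring
  have e2 : g' * PP d * PP (N + m + 1) = (-1) ^ m * PP (2 * N + 1) := by
    rw [mul_assoc, ← hu, hg, Units.inv_mul_cancel_right]
  have c1 : (X : PowerSeries ℤ) ^ (d + 1) ∣ PP N - PP d := by
    have := PP_cong d m
    rwa [show d + m = N by omega] at this
  have c2 : (X : PowerSeries ℤ) ^ (d + 1) ∣ PP (2 * N + 1) - PP (N + m + 1) := by
    have := PP_cong (N + m + 1) d
    rw [show N + m + 1 + d = 2 * N + 1 by omega] at this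
    exact (pow_dvd_pow _ (by omega)).trans this
  have c3 : (X : PowerSeries ℤ) ^ (d + 1) ∣ (PP N * g' - (-1) ^ m) * PP (N + m + 1) := by
    have : (PP N * g' - (-1) ^ m) * PP (N + m + 1) = (PP N - PP d) * (g' * PP (N + m + 1)) + (-1) ^ m * (PP (2 * N + 1) - PP (N + m + 1)) := by
      linear_combination e2
    rw [this]
    exact dvd_add (c1.mul_right _) (c2.mul_left _)
  have c4 := (PP_unit (N + m + 1)).dvd_mul_right.mp c3
  have : PP N * gg N m - (-1) ^ m * X ^ (tri m) = X ^ tri m * (PP N * g' - (-1) ^ m) := by rw [e1]; ring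
  rw [this]
  have h2 : N + 1 ≤ tri m + (d + 1) := by
    have := two_tri m
    rcases m with _ | m
    · omega
    · nlinarith
  exact (pow_dvd_pow _ h2).trans (by rw [pow_add]; exact mul_dvd_mul_left _ c4)

theorem jacobi (N : ℕ) : (X : PowerSeries ℤ) ^ (N + 1) ∣ PP N ^ 3 - ∑ m ∈ Finset.range (N + 1), (2 * m + 1 : PowerSeries ℤ) * ((-1) ^ m * X ^ (tri m)) := by
  have : PP N ^ 3 = ∑ m ∈ Finset.range (N + 1), (2 * m + 1 : PowerSeries ℤ) * (PP N * gg N m) := by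
    rw [pow_succ, ← gg_sum N (N + 1) (by omega), Finset.sum_mul]
    refine Finset.sum_congr rfl fun m _ => by ring
  rw [this, ← Finset.sum_sub_distrib]
  refine Finset.dvd_sum fun m hm => ?_
  rw [← mul_sub]
  rw [Finset.mem_range] at hm
  exact (gg_cong N m (N - m) (by omega)).mul_left _

theorem penta (N M : ℕ) (h : M ≤ N) : coeff M (PP N) = coeff M (pentagonalSeries ℤ) := by
  obtain ⟨s, hs⟩ := Filter.eventually_atTop.mp (coeff_prod_one_sub_X_pow_eventually_eq ℤ M)
  obtain ⟨K, hK⟩ : ∃ K, s ⊆ Finset.range K := s.exists_nat_subset_range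
  have h1 := hs (Finset.range (N + K)) (hK.trans (Finset.range_subset_range.mpr (by omega)))
  rw [← h1]
  have := PP_cong N K
  rw [X_pow_dvd_iff] at this
  have := this M (by omega)
  rw [map_sub] at this
  exact (sub_eq_zero.mp this).symm


end

section
open PowerSeries

theorem HF.mulprod {ι κ : Type*} {f : ι → ℝ} {g : κ → ℝ} {s t : ℝ} (hf : HF f s) (hg : HF g t) :
    HF (fun p : ι × κ => f p.1 * g p.2) (s * t) := by
  classical
  have e1 : s = ∑ i ∈ hf.1.toFinset, f i := by
    exact hf.2.symm.trans (finsum_eq_sum f hf.1)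
  have e2 : t = ∑ i ∈ hg.1.toFinset, g i := by
    exact hg.2.symm.trans (finsum_eq_sum g hg.1)
  rw [e1, e2, Finset.sum_mul_sum, ← Finset.sum_product']
  refine HF.of_finset (g := fun p : ι × κ => f p.1 * g p.2) _ ?_
  rintro ⟨i, k⟩ h
  dsimp only
  simp only [Finset.mem_product, Set.Finite.mem_toFinset, Function.mem_support, not_and_or, not_not] at h
  rcases h with h | h <;> rw [h] <;> ring

theorem HF.zero {ι : Type*} : HF (fun _ : ι => (0:ℝ)) 0 := ⟨by simp, by simp⟩

theorem HF.sum {ι κ : Type*} (T : Finset κ) {f : κ → ι → ℝ} {s : κ → ℝ} (h : ∀ k ∈ T, HF (f k) (s k)) :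
    HF (fun i => ∑ k ∈ T, f k i) (∑ k ∈ T, s k) := by
  classical
  induction T using Finset.induction_on with
  | empty => simpa using HF.zero
  | insert k T hk ih =>
    rw [Finset.sum_insert hk]
    refine ((h k (by simp)).add (ih fun k hk => h k (by simp [hk]))).congr ?_ rfl
    intro i; rw [Finset.sum_insert hk]

/-- graded generating sequences -/
def Rep {ι : Type*} (K : ℕ) (e : ι → ℤ) (c : ι → ℝ) (F : ℕ → ℝ) : Prop :=
  (∀ i, c i ≠ 0 → 0 ≤ e i) ∧ ∀ M ≤ K, HF (fun i => if e i = M then c i else 0) (F M)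

theorem Rep.conv {ι κ : Type*} {K : ℕ} {e : ι → ℤ} {c : ι → ℝ} {F : ℕ → ℝ} {e' : κ → ℤ} {c' : κ → ℝ} {G : ℕ → ℝ}
    (h : Rep K e c F) (h' : Rep K e' c' G) (w : ℤ → ℤ → ℝ) (M : ℕ) (hM : M ≤ K) :
    HF (fun p : ι × κ => if e p.1 + e' p.2 = M then w (e p.1) (e' p.2) * (c p.1 * c' p.2) else 0)
      (∑ ab ∈ Finset.HasAntidiagonal.antidiagonal M, w ab.1 ab.2 * (F ab.1 * G ab.2)) := by
  have := HF.sum (Finset.HasAntidiagonal.antidiagonal M) (f := fun ab (p : ι × κ) => w ab.1 ab.2 *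
    ((if e p.1 = ab.1 then c p.1 else 0) * (if e' p.2 = ab.2 then c' p.2 else 0)))
    (s := fun ab => w ab.1 ab.2 * (F ab.1 * G ab.2)) (by
      intro ab hab
      rw [Finset.HasAntidiagonal.mem_antidiagonal] at hab
      exact ((h.2 ab.1 (by omega)).mulprod (h'.2 ab.2 (by omega))).mul _)
  refine this.congr ?_ rfl
  rintro ⟨i, k⟩
  dsimp only
  by_cases hc : c i = 0
  · simp [hc]
  by_cases hc' : c' k = 0
  · simp [hc']
  have p1 := h.1 i hc
  have p2 := h'.1 k hc'
  split_ifs with he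
  · rw [Finset.sum_eq_single ((e i).toNat, (e' k).toNat)]
    · dsimp only
      rw [if_pos (by omega), if_pos (by omega), Int.toNat_of_nonneg p1, Int.toNat_of_nonneg p2]
    · rintro ⟨a, b⟩ _ hne
      dsimp only
      by_cases ha : e i = a
      · by_cases hb : e' k = b
        · exfalso; apply hne; ext <;> simp <;> omega
        · rw [if_neg hb]; ring
      · rw [if_neg ha]; ring
    · intro hh
      exfalso; apply hh; rw [Finset.HasAntidiagonal.mem_antidiagonal]; dsimp only; omega
  · symm
    refine Finset.sum_eq_zero ?_
    rintro ⟨a, b⟩ hab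
    rw [Finset.HasAntidiagonal.mem_antidiagonal] at hab
    dsimp only at *
    by_cases ha : e i = a
    · rw [if_neg (show ¬ e' k = b by omega)]; ring
    · rw [if_neg ha]; ring

theorem Rep.mul {ι κ : Type*} {K : ℕ} {e : ι → ℤ} {c : ι → ℝ} {F G : PowerSeries ℤ} {e' : κ → ℤ} {c' : κ → ℝ}
    (h : Rep K e c (fun M => ((coeff M F : ℤ) : ℝ))) (h' : Rep K e' c' (fun M => ((coeff M G : ℤ) : ℝ))) :
    Rep K (fun p : ι × κ => e p.1 + e' p.2) (fun p => c p.1 * c' p.2) (fun M => ((coeff M (F * G) : ℤ) : ℝ)) := by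
  refine ⟨?_, ?_⟩
  · rintro ⟨i, k⟩ hne
    dsimp only at *
    have := h.1 i (left_ne_zero_of_mul hne)
    have := h'.1 k (right_ne_zero_of_mul hne)
    omega
  · intro M hM
    refine (h.conv h' (fun _ _ => 1) M hM).congr ?_ ?_
    · intro p; simp only [one_mul]
    · dsimp only
      rw [coeff_mul]; push_cast
      refine Finset.sum_congr rfl fun ab _ => by rw [one_mul]

/-- parity sign -/
def sg (j : ℤ) : ℝ := if j % 2 = 0 then 1 else -1

theorem sg_nat (m : ℕ) : sg m = (-1) ^ m := by
  unfold sg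
  rcases Nat.even_or_odd m with h | h
  · rw [h.neg_one_pow, if_pos (by obtain ⟨k, rfl⟩ := h; omega)]
  · rw [h.neg_one_pow, if_neg (by obtain ⟨k, rfl⟩ := h; omega)]

theorem two_pent (m : ℤ) : 2 * (m * (3 * m - 1) / 2) = m * (3 * m - 1) := by
  have := two_mul_natCast_pentagonal m
  rw [natCast_pentagonal] at this
  exact this

theorem rep_pent (K : ℕ) : Rep K (fun m : ℤ => m * (3 * m - 1) / 2) sg (fun M => ((coeff M (PP K) : ℤ) : ℝ)) := by
  refine ⟨?_, ?_⟩
  · intro m _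
    dsimp only
    rw [← natCast_pentagonal]; positivity
  · intro M hM
    dsimp only
    rw [penta K M hM]
    simp only [← natCast_pentagonal]
    by_cases h : M ∈ Set.range pentagonal
    · obtain ⟨k, rfl⟩ := h
      rw [coeff_pentagonalSeries_pentagonal]
      have := HF.of_finset (g := fun i : ℤ => if (pentagonal i : ℤ) = (pentagonal k : ℤ) then sg i else 0) {k} (by
        intro i hi
        rw [if_neg]
        intro hh
        exact hi (by simpa using pentagonal_injective (by exact_mod_cast hh)))
      refine this.congr (fun _ => rfl) ?_
      rw [Finset.sum_singleton, if_pos rfl]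
      unfold sg
      rcases Int.even_or_odd k with h | h
      · rw [if_pos (Int.even_iff.mp h), Int.negOnePow_even _ h]; simp
      · rw [if_neg (by have := Int.odd_iff.mp h; omega), Int.negOnePow_odd _ h]; simp
    · rw [coeff_pentagonalSeries_eq_zero ℤ h]
      refine HF.zero.congr ?_ (by simp)
      intro i
      rw [if_neg]
      intro hh
      exact h ⟨i, by exact_mod_cast hh⟩

theorem two_tz (j : ℤ) : 2 * (j * (j + 1) / 2) = j * (j + 1) :=
  Int.two_mul_ediv_two_of_even (Int.even_mul_succ_self j)

theorem tz_nat (m : ℕ) : (m : ℤ) * (m + 1) / 2 = tri m := by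
  have := two_tz m
  have h2 : (2 * tri m : ℤ) = m * (m + 1) := by exact_mod_cast two_tri m
  omega

theorem rep_jac (K : ℕ) : Rep K (fun j : ℤ => j * (j + 1) / 2) (fun j => 1 / 2 * (sg j * (2 * j + 1)))
    (fun M => ((coeff M (PP K ^ 3) : ℤ) : ℝ)) := by
  refine ⟨?_, ?_⟩
  · intro j _
    have := two_tz j
    have : 0 ≤ j * (j + 1) := by
      rcases le_or_gt 0 j with h | h <;> nlinarith
    dsimp only
    omega
  · intro M hM
    have hc : ((coeff M (PP K ^ 3) : ℤ) : ℝ) = ∑ m ∈ Finset.range (K + 1), if (m : ℤ) * (m + 1) / 2 = (M:ℤ) then sg m * (2 * m + 1) else 0 := by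
      have h := jacobi K
      rw [X_pow_dvd_iff] at h
      have h := h M (by omega)
      rw [map_sub, sub_eq_zero] at h
      rw [h, map_sum]
      push_cast
      refine Finset.sum_congr rfl fun m _ => ?_
      rw [tz_nat]
      have : (2 * (m : PowerSeries ℤ) + 1) * ((-1) ^ m * X ^ tri m) = C ((2 * m + 1) * (-1) ^ m : ℤ) * X ^ tri m := by
        simp only [map_mul, map_add, map_pow, map_neg, map_one, map_natCast, map_ofNat]; ring
      rw [this, coeff_C_mul, coeff_X_pow]
      by_cases hh : M = tri m
      · rw [if_pos hh, if_pos (by rw [hh]), sg_nat]; push_cast; ring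
      · rw [if_neg hh, if_neg (by intro h3; exact hh (by exact_mod_cast h3.symm))]; simp
    have h1 := HF.of_finset (g := fun j : ℤ => if 0 ≤ j then (if j * (j + 1) / 2 = (M:ℤ) then sg j * (2 * j + 1) else 0) else 0)
      ((Finset.range (K + 1)).map Nat.castEmbedding) (by
        intro j hj
        split_ifs with h1 h2
        · exfalso
          apply hj
          rw [Finset.mem_map]
          refine ⟨j.toNat, ?_, by simp [h1]⟩
          rw [Finset.mem_range]
          have := two_tz j
          have : j ≤ M := by
            rcases eq_or_lt_of_le h1 with h | h
            · omega
            · nlinarith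
          omega
        · rfl
        · rfl)
    rw [Finset.sum_map] at h1
    have h1 := h1.congr (fun _ => rfl) (t := ((coeff M (PP K ^ 3) : ℤ) : ℝ)) (by
      rw [hc]
      refine Finset.sum_congr rfl fun m _ => ?_
      rw [if_pos (by simp)]
      simp)
    have h2 := h1.equiv (⟨fun j => -1 - j, fun j => -1 - j, fun j => by ring, fun j => by ring⟩ : ℤ ≃ ℤ)
    refine ((h1.add h2).mul (1 / 2)).congr ?_ (by ring)
    intro j
    simp only [Equiv.coe_fn_mk]
    have he : (-1 - j) * (-1 - j + 1) = j * (j + 1) := by ring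
    have hs : sg (-1 - j) = - sg j := by
      unfold sg
      by_cases h : j % 2 = 0
      · rw [if_pos h, if_neg (by omega)]
      · rw [if_neg h, if_pos (by omega)]; ring
    simp only [he, hs]
    split_ifs with h1 h2 h3 h4
    all_goals first | omega | (push_cast; ring)


end

section
open PowerSeries

theorem HF.ex_of {ι : Type*} {g g' : ι → ℝ} {s : ℝ} (h : HF g s) (e : ∀ i, g' i ≠ 0 → g i ≠ 0) :
    ∃ t, HF g' t := ⟨_, h.1.subset fun i hi => e i hi, rfl⟩

theorem ite_eq2 {P Q : Prop} [Decidable P] [Decidable Q] {a b : ℝ} (h : P ↔ Q) (e : Q → a = b) :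
    (if P then a else 0) = if Q then b else 0 := by
  by_cases hq : Q
  · rw [if_pos hq, if_pos (h.2 hq), e hq]
  · rw [if_neg hq, if_neg (fun hp => hq (h.1 hp))]

theorem sg_add (j k : ℤ) : sg j * sg k = sg (j + k) := by
  unfold sg
  split_ifs <;> first | omega | norm_num

theorem phi4 (K : ℕ) : Rep K (fun v : ℤ × ℤ => 2 * v.1 ^ 2 + 2 * v.1 * v.2 + 2 * v.2 ^ 2 + v.1)
    (fun v => 3 * v.1 + 1) (fun M => ((coeff M (PP K ^ 4) : ℤ) : ℝ)) := by
  have hr := (rep_jac K).mul (rep_pent K)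
  refine ⟨?_, ?_⟩
  · rintro ⟨s, m⟩ _
    dsimp only
    have h1 : 0 ≤ 3 * s ^ 2 + 2 * s := by
      rcases le_or_gt 0 s with h | h <;> nlinarith
    nlinarith [sq_nonneg (s + 2 * m)]
  · intro M hM
    have h := hr.2 M hM
    have h0 := h
    dsimp only at h
    set f : ℤ × ℤ → ℝ := fun p => if p.1 * (p.1 + 1) / 2 + p.2 * (3 * p.2 - 1) / 2 = M then
      1 / 2 * (sg p.1 * (2 * p.1 + 1)) * sg p.2 else 0 with hf
    obtain ⟨a, ha⟩ := h.ex_of (g' := fun p : ℤ × ℤ => if (p.1 + p.2) % 2 = 0 then f p else 0) (by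
      intro i hi hz; rw [hz] at hi; simp at hi)
    have hb := h.sub ha
    have ha' := ha.inj (fun p : ℤ × ℤ => (2 * p.1 + p.2, p.2)) (by
      rintro ⟨x, y⟩ ⟨x', y'⟩ hh; simp only [Prod.mk.injEq] at hh ⊢; omega) (by
      rintro ⟨j, m⟩ hh
      by_cases he : (j + m) % 2 = 0
      · exact ⟨((j - m) / 2, m), by simp only [Prod.mk.injEq, and_true]; omega⟩
      · simp [he] at hh)
    have hb' := hb.inj (fun p : ℤ × ℤ => (-2 * p.1 - p.2 - 1, p.2)) (by
      rintro ⟨x, y⟩ ⟨x', y'⟩ hh; simp only [Prod.mk.injEq] at hh ⊢; omega) (by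
      rintro ⟨j, m⟩ hh
      by_cases he : (j + m) % 2 = 0
      · simp [he] at hh
      · exact ⟨((-1 - j - m) / 2, m), by simp only [Prod.mk.injEq, and_true]; omega⟩)
    set F : ℤ × ℤ → ℝ := fun v => if 2 * v.1 ^ 2 + 2 * v.1 * v.2 + 2 * v.2 ^ 2 + v.1 = M then
      1 / 2 * (4 * v.1 + 2 * v.2 + 1) else 0 with hF
    have hA : HF F a := by
      refine ha'.congr ?_ rfl
      rintro ⟨s, m⟩
      simp only [hF, hf]
      rw [if_pos (show (2 * s + m + m) % 2 = 0 by omega)]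
      have h1 := two_tz (2 * s + m)
      have h2 := two_pent m
      have h3 : (2 * s + m) * (2 * s + m + 1) + m * (3 * m - 1) = 2 * (2 * s ^ 2 + 2 * s * m + 2 * m ^ 2 + s) := by ring
      refine ite_eq2 (by omega) fun _ => ?_
      have h4 := sg_add (2 * s + m) m
      rw [show sg (2 * s + m + m) = 1 by unfold sg; rw [if_pos (by omega)]] at h4
      push_cast
      linear_combination (-1 / 2 * (4 * (s:ℝ) + 2 * m + 1)) * h4
    have hB : HF F (((coeff M (PP K ^ 3 * PP K) : ℤ) : ℝ) - a) := by
      refine hb'.congr ?_ rfl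
      rintro ⟨s, m⟩
      simp only [hF, hf]
      rw [if_neg (show ¬ ((-2 * s - m - 1 + m) % 2 = 0) by omega), sub_zero]
      have h1 := two_tz (-2 * s - m - 1)
      have h2 := two_pent m
      have h3 : (-2 * s - m - 1) * (-2 * s - m - 1 + 1) + m * (3 * m - 1) = 2 * (2 * s ^ 2 + 2 * s * m + 2 * m ^ 2 + s) := by ring
      refine ite_eq2 (by omega) fun _ => ?_
      have h4 := sg_add (-2 * s - m - 1) m
      rw [show sg (-2 * s - m - 1 + m) = -1 by unfold sg; rw [if_neg (by omega)]] at h4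
      push_cast
      linear_combination (1 / 2 * (4 * (s:ℝ) + 2 * m + 1)) * h4
    have hC := hA.add hB
    have hD := hC.equiv (⟨fun p => (p.1, -p.1 - p.2), fun p => (p.1, -p.1 - p.2),
      fun p => by ext <;> simp, fun p => by ext <;> simp⟩ : ℤ × ℤ ≃ ℤ × ℤ)
    refine ((hC.add hD).mul (1 / 2)).congr ?_ (by dsimp only; rw [← pow_succ]; ring)
    rintro ⟨s, m⟩
    simp only [hF, Equiv.coe_fn_mk]
    have h5 : 2 * s ^ 2 + 2 * s * (-s - m) + 2 * (-s - m) ^ 2 + s = 2 * s ^ 2 + 2 * s * m + 2 * m ^ 2 + s := by ring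
    simp only [h5]
    split_ifs
    · push_cast; ring
    · ring

/-- index type -/
abbrev Z4 := (ℤ × ℤ) × (ℤ × ℤ)

/-- quaternary form -/
def QQ (v : Z4) : ℤ := v.1.1 ^ 2 + v.1.1 * v.1.2 + v.1.2 ^ 2 + v.1.1 + (v.2.1 ^ 2 + v.2.1 * v.2.2 + v.2.2 ^ 2)
/-- its weight -/
def ww (v : Z4) : ℤ := 3 * v.1.1 ^ 2 + 3 * v.1.1 * v.1.2 + 3 * v.1.2 ^ 2 + 3 * v.1.1 + 1 - 3 * (v.2.1 ^ 2 + v.2.1 * v.2.2 + v.2.2 ^ 2)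

theorem HF.bdd4 {g : Z4 → ℝ} (B : ℤ) (h : ∀ v, g v ≠ 0 → |v.1.1| ≤ B ∧ |v.1.2| ≤ B ∧ |v.2.1| ≤ B ∧ |v.2.2| ≤ B) :
    ∃ s, HF g s := by
  refine ⟨_, HF.of_finset (((Finset.Icc (-B) B) ×ˢ (Finset.Icc (-B) B)) ×ˢ ((Finset.Icc (-B) B) ×ˢ (Finset.Icc (-B) B))) ?_⟩
  rintro ⟨⟨a, b⟩, c, d⟩ hv
  by_contra hh
  apply hv
  have := h _ hh
  simp only [abs_le] at this
  simp only [Finset.mem_product, Finset.mem_Icc]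
  tauto

theorem Nbd (x y k : ℤ) (h : x ^ 2 + x * y + y ^ 2 ≤ k) : |x| ≤ k + 1 ∧ |y| ≤ k + 1 := by
  have h1 : 3 * x ^ 2 ≤ 4 * k := by nlinarith [sq_nonneg (x + 2 * y)]
  have h2 : 3 * y ^ 2 ≤ 4 * k := by nlinarith [sq_nonneg (2 * x + y)]
  constructor <;> rw [abs_le] <;> constructor <;> nlinarith

theorem Nnn (x y : ℤ) : 0 ≤ x ^ 2 + x * y + y ^ 2 := by nlinarith [sq_nonneg (x + 2 * y), sq_nonneg x]

theorem QQ_bd (N : ℕ) (v : Z4) (h : QQ v = N) :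
    |v.1.1| ≤ 3 * N + 4 ∧ |v.1.2| ≤ 3 * N + 4 ∧ |v.2.1| ≤ 3 * N + 4 ∧ |v.2.2| ≤ 3 * N + 4 := by
  obtain ⟨⟨S, M⟩, D, E⟩ := v
  simp only [QQ] at *
  have h1 := Nnn D E
  have h2 := Nnn (S + 1 - M) (S + 2 * M)
  have h3 : (S + 1 - M) ^ 2 + (S + 1 - M) * (S + 2 * M) + (S + 2 * M) ^ 2 = 3 * (S ^ 2 + S * M + M ^ 2 + S) + 1 := by ring
  have h4 := Nbd D E (3 * N + 3) (by omega)
  have h5 := Nbd S M (3 * N + 3) (by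
    have : 0 ≤ S ^ 2 + 2 * S + S * M + M ^ 2 + 1 := by nlinarith [sq_nonneg (2 * M + S), sq_nonneg (3 * S + 4)]
    nlinarith)
  simp only [abs_le] at *
  omega

theorem QQ_ex (N : ℕ) (P : Z4 → Prop) [DecidablePred P] : ∃ s, HF (fun v : Z4 => if P v ∧ QQ v = N then (ww v : ℝ) else 0) s := by
  refine HF.bdd4 (3 * N + 4) fun v hv => QQ_bd N v ?_
  by_contra hh
  exact hv (by rw [if_neg (by tauto)])

theorem phi8 (N : ℕ) : HF (fun v : Z4 => if ((v.1.1 + v.2.1) % 2 = 0 ∧ (v.1.2 + v.2.2) % 2 = 0) ∧ QQ v = N then (ww v : ℝ) else 0)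
    ((coeff N (PP N ^ 8) : ℤ) : ℝ) := by
  have h := ((phi4 N).mul (phi4 N)).2 N le_rfl
  dsimp only at h
  obtain ⟨t, ht⟩ := h.ex_of (g' := fun v : Z4 => if (2 * v.1.1 ^ 2 + 2 * v.1.1 * v.1.2 + 2 * v.1.2 ^ 2 + v.1.1) +
    (2 * v.2.1 ^ 2 + 2 * v.2.1 * v.2.2 + 2 * v.2.2 ^ 2 + v.2.1) = (N:ℤ) then
      3 * ((v.1.1 : ℝ) + 2 * v.1.2) * (v.2.1 + 2 * v.2.2) else 0) (by
    rintro ⟨⟨s, m⟩, s', m'⟩ hi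
    dsimp only at hi ⊢
    split_ifs at hi ⊢ with hh
    · have : ∀ s : ℤ, (3 * s + 1 : ℝ) ≠ 0 := fun s hs => by
        have : (3 * s + 1 : ℤ) = 0 := by exact_mod_cast hs
        omega
      exact mul_ne_zero (this s) (this s')
    · exact hi)
  have ht2 := ht.equiv (⟨fun v => (v.1, v.2.1, -v.2.1 - v.2.2), fun v => (v.1, v.2.1, -v.2.1 - v.2.2),
      fun p => by ext <;> simp, fun p => by ext <;> simp⟩ : Z4 ≃ Z4)
  have h0 : t = -1 * t := by
    refine ht.unique ((ht2.mul (-1)).congr ?_ rfl)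
    rintro ⟨⟨s, m⟩, s', m'⟩
    simp only [Equiv.coe_fn_mk]
    have h5 : ∀ X, X + (2 * s' ^ 2 + 2 * s' * (-s' - m') + 2 * (-s' - m') ^ 2 + s') = X + (2 * s' ^ 2 + 2 * s' * m' + 2 * m' ^ 2 + s') := by intro X; ring
    simp only [h5]
    split_ifs
    · push_cast; ring
    · ring
  have ht0 : t = 0 := by linarith
  have h1 := h.add ht
  obtain ⟨a, ha⟩ := QQ_ex N (fun v : Z4 => ((v.1.1 + v.2.1) % 2 = 0 ∧ (v.1.2 + v.2.2) % 2 = 0))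
  have ha' := ha.inj (fun v : Z4 => ((v.1.1 + v.2.1, v.1.2 + v.2.2), (v.1.1 - v.2.1, v.1.2 - v.2.2))) (by
    rintro ⟨⟨s, m⟩, s', m'⟩ ⟨⟨s1, m1⟩, s2, m2⟩ hh
    simp only [Prod.mk.injEq] at hh ⊢; omega) (by
    rintro ⟨⟨S, M⟩, D, E⟩ hh
    by_cases he : (S + D) % 2 = 0 ∧ (M + E) % 2 = 0
    · exact ⟨(((S + D) / 2, (M + E) / 2), ((S - D) / 2, (M - E) / 2)), by simp only [Prod.mk.injEq]; omega⟩
    · exact absurd (by dsimp only; rw [if_neg (by tauto)]) hh)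
  have key : a = ((coeff N (PP N ^ 4 * PP N ^ 4) : ℤ) : ℝ) + t := by
    refine ha'.unique (h1.congr ?_ rfl)
    rintro ⟨⟨s, m⟩, s', m'⟩
    simp only [QQ, ww]
    have h6 : (s + s') ^ 2 + (s + s') * (m + m') + (m + m') ^ 2 + (s + s') + ((s - s') ^ 2 + (s - s') * (m - m') + (m - m') ^ 2)
      = 2 * s ^ 2 + 2 * s * m + 2 * m ^ 2 + s + (2 * s' ^ 2 + 2 * s' * m' + 2 * m' ^ 2 + s') := by ring
    have h7 : ((s + s' + (s - s')) % 2 = 0 ∧ (m + m' + (m - m')) % 2 = 0) := by omega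
    simp only [h6]
    by_cases hc : 2 * s ^ 2 + 2 * s * m + 2 * m ^ 2 + s + (2 * s' ^ 2 + 2 * s' * m' + 2 * m' ^ 2 + s') = (N:ℤ)
    · rw [if_pos ⟨h7, hc⟩, if_pos hc, if_pos hc]; push_cast; ring
    · rw [if_neg (fun h => hc h.2), if_neg hc, if_neg hc]; ring
  refine ha.congr (fun _ => rfl) ?_
  rw [key, ht0, ← pow_add, add_zero]


end

section
open PowerSeries

/-- rotation -/
def om : Z4 ≃ Z4 := ⟨fun v => ((-v.1.1 - v.1.2 - 1, v.1.1 + 1), (-v.2.1 - v.2.2, v.2.1)),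
  fun v => ((v.1.2 - 1, -v.1.1 - v.1.2), (v.2.2, -v.2.1 - v.2.2)),
  fun v => by ext <;> simp <;> ring, fun v => by ext <;> simp <;> ring⟩

theorem QQ_om (v : Z4) : QQ (om v) = QQ v := by simp only [QQ, om, Equiv.coe_fn_mk]; ring
theorem ww_om (v : Z4) : ww (om v) = ww v := by simp only [ww, om, Equiv.coe_fn_mk]; ring

theorem om_class (N : ℕ) (P P' : Z4 → Prop) [DecidablePred P] [DecidablePred P'] (hP : ∀ v, P' v ↔ P (om v)) {s : ℝ}
    (h : HF (fun v : Z4 => if P v ∧ QQ v = N then (ww v : ℝ) else 0) s) :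
    HF (fun v : Z4 => if P' v ∧ QQ v = N then (ww v : ℝ) else 0) s := by
  refine (h.equiv om).congr ?_ rfl
  intro v
  simp only [QQ_om, ww_om]
  refine ite_eq2 (by rw [hP]) fun _ => rfl

/-- rotation of the first pair -/
def rh : Z4 ≃ Z4 := ⟨fun v => ((-v.1.1 - v.1.2 - 1, v.1.1), v.2), fun v => ((v.1.2, -v.1.1 - v.1.2 - 1), v.2),
  fun v => by ext <;> simp <;> ring, fun v => by ext <;> simp <;> ring⟩

theorem class01 (N : ℕ) : HF (fun v : Z4 => if ((v.1.1 + v.2.1) % 2 = 0 ∧ (v.1.2 + v.2.2) % 2 = 1) ∧ QQ v = N then (ww v : ℝ) else 0) 0 := by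
  obtain ⟨t, ht⟩ := QQ_ex N (fun v : Z4 => (v.1.1 + v.2.1) % 2 = 0 ∧ (v.1.2 + v.2.2) % 2 = 1)
  have h := ht.inj (fun v : Z4 => ((v.1.1 + v.2.1, v.1.2 + v.2.2 + 1), (v.1.1 - v.2.1, v.1.2 - v.2.2))) (by
    rintro ⟨⟨s, m⟩, s', m'⟩ ⟨⟨s1, m1⟩, s2, m2⟩ hh
    simp only [Prod.mk.injEq] at hh ⊢; omega) (by
    rintro ⟨⟨S, M⟩, D, E⟩ hh
    by_cases he : (S + D) % 2 = 0 ∧ (M + E) % 2 = 1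
    · exact ⟨(((S + D) / 2, (M + E) / 2), ((S - D) / 2, (M - E) / 2)), by simp only [Prod.mk.injEq]; omega⟩
    · exact absurd (by dsimp only; rw [if_neg (by tauto)]) hh)
  have h' : HF (fun v : Z4 => if 2 * (v.1.1 ^ 2 + v.1.1 * v.1.2 + v.1.2 ^ 2 + v.1.1 + v.1.2) +
      2 * (v.2.1 ^ 2 + v.2.1 * v.2.2 + v.2.2 ^ 2 + v.2.1 + v.2.2) + 1 = (N:ℤ) then
      ((ww ((v.1.1 + v.2.1, v.1.2 + v.2.2 + 1), (v.1.1 - v.2.1, v.1.2 - v.2.2)) : ℤ) : ℝ) else 0) t := by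
    refine h.congr ?_ rfl
    rintro ⟨⟨P, Q⟩, P', Q'⟩
    refine ite_eq2 ?_ (fun _ => rfl)
    simp only [QQ]
    constructor
    · intro h; refine ⟨by omega, ?_⟩; linarith
    · rintro ⟨_, h⟩; linarith
  have h1 := h'.equiv rh
  have h2 := h1.equiv rh
  have h3 := ((h'.add h1).add h2)
  have h4 : 0 = t + t + t := by
    refine HF.zero.unique (h3.congr ?_ rfl)
    rintro ⟨⟨P, Q⟩, P', Q'⟩
    simp only [rh, Equiv.coe_fn_mk]
    have e1 : (-P - Q - 1) ^ 2 + (-P - Q - 1) * P + P ^ 2 + (-P - Q - 1) + P = P ^ 2 + P * Q + Q ^ 2 + P + Q := by ring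
    have e2 : (-(-P - Q - 1) - P - 1) ^ 2 + (-(-P - Q - 1) - P - 1) * (-P - Q - 1) + (-P - Q - 1) ^ 2 +
      (-(-P - Q - 1) - P - 1) + (-P - Q - 1) = P ^ 2 + P * Q + Q ^ 2 + P + Q := by ring
    simp only [e1, e2]
    split_ifs
    · simp only [ww]; push_cast; ring
    · ring
  have : t = 0 := by linarith
  rw [this] at ht
  exact ht

theorem U3 (N : ℕ) : HF (fun v : Z4 => if QQ v = N then (ww v : ℝ) else 0) (3 * ((coeff N (PP N ^ 8) : ℤ) : ℝ)) := by
  have h0 := phi8 N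
  have h1 := om_class N _ (fun v : Z4 => (v.1.1 + v.2.1) % 2 = 1 ∧ (v.1.2 + v.2.2) % 2 = 0) (by
    rintro ⟨⟨S, M⟩, D, E⟩; simp only [om, Equiv.coe_fn_mk]; omega) h0
  have h2 := om_class N _ (fun v : Z4 => (v.1.1 + v.2.1) % 2 = 1 ∧ (v.1.2 + v.2.2) % 2 = 1) (by
    rintro ⟨⟨S, M⟩, D, E⟩; simp only [om, Equiv.coe_fn_mk]; omega) h1
  refine (((h0.add h1).add h2).add (class01 N)).congr ?_ (by ring)
  rintro ⟨⟨S, M⟩, D, E⟩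
  dsimp only
  by_cases hq : QQ ((S, M), D, E) = N
  · rw [if_pos hq]
    simp only [hq, and_true]
    rcases Int.emod_two_eq_zero_or_one (S + D) with e1 | e1 <;> rcases Int.emod_two_eq_zero_or_one (M + E) with e2 | e2 <;>
      simp [e1, e2]
  · simp only [hq, and_false, if_false]; ring

/-- norm form -/
def nm (v : ℤ × ℤ) : ℤ := v.1 ^ 2 + v.1 * v.2 + v.2 ^ 2

theorem T6 (N : ℕ) : HF (fun v : Z4 => if nm v.1 + 3 * nm v.2 = 3 * N + 1 then ((nm v.1 - 3 * nm v.2 : ℤ) : ℝ) else 0)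
    (6 * ((coeff N (PP N ^ 8) : ℤ) : ℝ)) := by
  obtain ⟨t, ht⟩ := HF.bdd4 (g := fun v : Z4 => if (v.1.1 - v.1.2) % 3 = 1 then (if nm v.1 + 3 * nm v.2 = 3 * N + 1 then ((nm v.1 - 3 * nm v.2 : ℤ) : ℝ) else 0) else 0)
    (3 * N + 2) (by
    rintro ⟨⟨x, y⟩, a, b⟩ hv
    have hq : nm (x, y) + 3 * nm (a, b) = 3 * N + 1 := by
      by_contra hh
      apply hv
      dsimp only; rw [if_neg hh]; simp
    simp only [nm] at hq
    have h1 := Nnn x y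
    have h2 := Nnn a b
    have h3 := Nbd x y (3 * N + 1) (by omega)
    have h4 := Nbd a b (3 * N + 1) (by omega)
    simp only [abs_le] at *
    omega)
  have h := ht.inj (fun v : Z4 => ((v.1.1 + 1 - v.1.2, v.1.1 + 2 * v.1.2), v.2)) (by
    rintro ⟨⟨s, m⟩, s', m'⟩ ⟨⟨s1, m1⟩, s2, m2⟩ hh
    simp only [Prod.mk.injEq] at hh ⊢; omega) (by
    rintro ⟨⟨x, y⟩, D⟩ hh
    by_cases he : (x - y) % 3 = 1
    · exact ⟨((x - 1 + (1 - x + y) / 3, (1 - x + y) / 3), D), by simp only [Prod.mk.injEq, and_true]; omega⟩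
    · exact absurd (by dsimp only; rw [if_neg he]) hh)
  have e0 : t = 3 * ((coeff N (PP N ^ 8) : ℤ) : ℝ) := by
    refine h.unique ((U3 N).congr ?_ rfl)
    rintro ⟨⟨S, M⟩, D, E⟩
    dsimp only
    rw [if_pos (by omega)]
    refine ite_eq2 ?_ ?_
    · simp only [QQ, nm]; constructor <;> intro h <;> linarith
    · intro _; congr 1; simp only [ww, nm]; ring
  have hn := ht.equiv (⟨fun v => ((-v.1.1, -v.1.2), v.2), fun v => ((-v.1.1, -v.1.2), v.2),
      fun p => by ext <;> simp, fun p => by ext <;> simp⟩ : Z4 ≃ Z4)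
  refine (ht.add hn).congr ?_ (by rw [e0]; ring)
  rintro ⟨⟨x, y⟩, D⟩
  simp only [Equiv.coe_fn_mk]
  have e1 : nm (-x, -y) = nm (x, y) := by simp only [nm]; ring
  simp only [e1]
  by_cases hq : nm (x, y) + 3 * nm D = 3 * N + 1
  · simp only [hq, if_true]
    have : (x - y) % 3 ≠ 0 := by
      intro h0
      have h2 : nm (x, y) = (x - y) * (x - y) + 3 * (x * y) := by simp only [nm]; ring
      have h3 : (x - y) * (x - y) % 3 = 0 := by rw [Int.mul_emod, h0]; simp
      omega
    by_cases h1 : (x - y) % 3 = 1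
    · rw [if_pos h1, if_neg (by omega)]; ring
    · rw [if_neg h1, if_pos (by omega)]; ring
  · simp only [hq, if_false, ite_self]; ring


end

section

/-- divisor sum of the cubic-residue character -/
def rho (k : ℕ) : ℤ := ∑ d ∈ k.divisors, ch d

theorem ch_mul (a b : ℕ) : ch (a * b) = ch a * ch b := by
  unfold ch
  rw [Nat.mul_mod]
  have h1 : a % 3 < 3 := Nat.mod_lt _ (by norm_num)
  have h2 : b % 3 < 3 := Nat.mod_lt _ (by norm_num)
  interval_cases a % 3 <;> interval_cases b % 3 <;> rfl

theorem rho_rec (p k : ℕ) (hp : p.Prime) (hk : 0 < k) :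
    rho (p * k) = (1 + ch p) * rho k - ch p * (if p ∣ k then rho (k / p) else 0) := by
  have e1 : (p * k).divisors = k.divisors ∪ k.divisors.image (p * ·) := by
    ext d
    simp only [Nat.mem_divisors, Finset.mem_union, Finset.mem_image]
    constructor
    · rintro ⟨h, _⟩
      by_cases hd : p ∣ d
      · obtain ⟨d', rfl⟩ := hd
        exact Or.inr ⟨d', ⟨Nat.dvd_of_mul_dvd_mul_left hp.pos h, by omega⟩, rfl⟩
      · exact Or.inl ⟨(Nat.Coprime.symm ((Nat.Prime.coprime_iff_not_dvd hp).2 hd)).dvd_of_dvd_mul_left h, by omega⟩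
    · have : p * k ≠ 0 := (Nat.mul_pos hp.pos hk).ne'
      rintro (⟨h, _⟩ | ⟨d', ⟨h, _⟩, rfl⟩)
      · exact ⟨Dvd.dvd.mul_left h p, this⟩
      · exact ⟨Nat.mul_dvd_mul_left p h, this⟩
  have hin : ∀ s : Finset ℕ, ∑ d ∈ s.image (p * ·), ch d = ch p * ∑ d ∈ s, ch d := by
    intro s
    rw [Finset.sum_image (fun a _ b _ h => Nat.eq_of_mul_eq_mul_left hp.pos h), Finset.mul_sum]
    exact Finset.sum_congr rfl fun d _ => ch_mul p d
  have e2 : ∑ d ∈ k.divisors ∩ k.divisors.image (p * ·), ch d = ch p * (if p ∣ k then rho (k / p) else 0) := by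
    split_ifs with h
    · obtain ⟨k', rfl⟩ := h
      rw [Nat.mul_div_cancel_left _ hp.pos]
      unfold rho
      rw [← hin]
      congr 1
      ext d
      have hk' : 0 < k' := Nat.pos_of_mul_pos_left hk
      simp only [Nat.mem_divisors, Finset.mem_inter, Finset.mem_image]
      constructor
      · rintro ⟨⟨h, _⟩, d', _, rfl⟩
        exact ⟨d', ⟨Nat.dvd_of_mul_dvd_mul_left hp.pos h, by omega⟩, rfl⟩
      · rintro ⟨d', ⟨h, _⟩, rfl⟩
        exact ⟨⟨Nat.mul_dvd_mul_left p h, hk.ne'⟩, d', ⟨Dvd.dvd.mul_left h p, hk.ne'⟩, rfl⟩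
    · rw [mul_zero]
      refine Finset.sum_eq_zero fun d hd => ?_
      simp only [Nat.mem_divisors, Finset.mem_inter, Finset.mem_image] at hd
      obtain ⟨⟨h1, _⟩, d', _, rfl⟩ := hd
      exact absurd (dvd_of_mul_right_dvd h1) h
  have := Finset.sum_union_inter (s₁ := k.divisors) (s₂ := k.divisors.image (p * ·)) (f := ch)
  rw [← e1, e2, hin] at this
  unfold rho at *
  linarith

theorem rho_three (k : ℕ) (hk : 0 < k) : rho (3 * k) = rho k := by
  rw [rho_rec 3 k Nat.prime_three hk]; simp [ch]

/-- vectors of norm k -/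
noncomputable def Rf (k : ℕ) : Finset (ℤ × ℤ) :=
  ((Finset.Icc (-(k:ℤ) - 1) (k + 1)) ×ˢ (Finset.Icc (-(k:ℤ) - 1) (k + 1))).filter fun v => nm v = k

theorem mem_Rf (k : ℕ) (v : ℤ × ℤ) : v ∈ Rf k ↔ nm v = k := by
  simp only [Rf, Finset.mem_filter, Finset.mem_product, Finset.mem_Icc]
  refine ⟨fun h => h.2, fun h => ⟨?_, h⟩⟩
  have := Nbd v.1 v.2 k (le_of_eq h)
  simp only [abs_le] at this
  omega

/-- Eisenstein product -/
def mu (u v : ℤ × ℤ) : ℤ × ℤ := (u.1 * v.1 - u.2 * v.2, u.1 * v.2 + u.2 * v.1 + u.2 * v.2)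
/-- conjugate -/
def cj (u : ℤ × ℤ) : ℤ × ℤ := (u.1 + u.2, -u.2)

theorem nm_mu (u v) : nm (mu u v) = nm u * nm v := by simp only [nm, mu]; ring
theorem nm_cj (u) : nm (cj u) = nm u := by simp only [nm, cj]; ring
theorem mu_cj (u v) : mu (cj u) (mu u v) = (nm u * v.1, nm u * v.2) := by
  simp only [nm, cj, mu, Prod.mk.injEq]; constructor <;> ring
theorem mu_cj' (u v) : mu u (mu (cj u) v) = (nm u * v.1, nm u * v.2) := by
  simp only [nm, cj, mu, Prod.mk.injEq]; constructor <;> ring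

theorem mu_inj (u) (h : nm u ≠ 0) : Function.Injective (mu u) := by
  intro v w hh
  have := congrArg (mu (cj u)) hh
  rw [mu_cj, mu_cj, Prod.mk.injEq] at this
  exact Prod.ext (mul_left_cancel₀ h this.1) (mul_left_cancel₀ h this.2)

theorem mu_div (p : ℕ) (hp : p.Prime) (u v : ℤ × ℤ) (hu : nm u = p) (hv : (p:ℤ) ∣ nm v)
    (h : (p:ℤ) ∣ u.2 * v.1 - u.1 * v.2) : ∃ w, v = mu u w := by
  have hpi : Prime (p:ℤ) := Nat.prime_iff_prime_int.mp hp
  have e2 : (mu (cj u) v).2 = -(u.2 * v.1 - u.1 * v.2) := by simp only [mu, cj]; ring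
  have d2 : (p:ℤ) ∣ (mu (cj u) v).2 := by rw [e2]; exact (dvd_neg.2 h)
  have d1 : (p:ℤ) ∣ (mu (cj u) v).1 := by
    have h3 : (p:ℤ) ∣ nm (mu (cj u) v) := by rw [nm_mu]; exact Dvd.dvd.mul_left hv _
    have h4 : (mu (cj u) v).1 ^ 2 = nm (mu (cj u) v) - (mu (cj u) v).2 * ((mu (cj u) v).1 + (mu (cj u) v).2) := by
      unfold nm; ring
    apply hpi.dvd_of_dvd_pow (n := 2)
    rw [h4]
    exact dvd_sub h3 (Dvd.dvd.mul_right d2 _)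
  obtain ⟨a, ha⟩ := d1
  obtain ⟨b, hb⟩ := d2
  refine ⟨(a, b), ?_⟩
  have h5 := mu_cj' u v
  have h6 : mu (cj u) v = ((p:ℤ) * a, (p:ℤ) * b) := Prod.ext ha hb
  rw [h6, hu] at h5
  have hp0 : (p:ℤ) ≠ 0 := by exact_mod_cast hp.ne_zero
  simp only [mu, Prod.mk.injEq] at h5 ⊢
  refine Prod.ext (mul_left_cancel₀ hp0 ?_) (mul_left_cancel₀ hp0 ?_)
  · dsimp only; linarith [h5.1]
  · dsimp only; linarith [h5.2]

theorem mu_dvd (u w : ℤ × ℤ) : nm u ∣ u.2 * (mu u w).1 - u.1 * (mu u w).2 := by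
  refine ⟨-w.2, ?_⟩; simp only [mu, nm]; ring


end

section

theorem inert (p : ℕ) (hp : p.Prime) (h : p % 3 = 2) (x y : ℤ) (hd : (p:ℤ) ∣ nm (x, y)) : (p:ℤ) ∣ y := by
  have : Fact p.Prime := ⟨hp⟩
  by_contra hy
  have hy' : (y : ZMod p) ≠ 0 := by rwa [Ne, ZMod.intCast_zmod_eq_zero_iff_dvd]
  have h0 : (x : ZMod p) ^ 2 + x * y + y ^ 2 = 0 := by
    have := (ZMod.intCast_zmod_eq_zero_iff_dvd (nm (x, y)) p).2 hd
    simp only [nm] at this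
    push_cast at this
    exact this
  set t : ZMod p := x / y with ht
  have hx : (x : ZMod p) = t * y := by rw [ht]; field_simp
  have h1 : t ^ 2 + t + 1 = 0 := by
    have h2 : (t ^ 2 + t + 1) * (y : ZMod p) ^ 2 = 0 := by rw [hx] at h0; linear_combination h0
    rcases mul_eq_zero.1 h2 with h | h
    · exact h
    · exact absurd (pow_eq_zero_iff (two_ne_zero)|>.1 h) hy'
  have h3 : t ^ 3 = 1 := by linear_combination (t - 1) * h1
  have h4 : t ≠ 1 := by
    intro h
    rw [h] at h1
    have : ((3:ℕ) : ZMod p) = 0 := by push_cast; linear_combination h1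
    rw [ZMod.natCast_eq_zero_iff] at this
    have := (Nat.prime_dvd_prime_iff_eq hp Nat.prime_three).1 this
    omega
  have ht0 : t ≠ 0 := by rintro h; rw [h] at h3; norm_num at h3
  have h5 : orderOf t = 3 := orderOf_eq_prime h3 h4
  have h6 : t ^ (p - 1) = 1 := ZMod.pow_card_sub_one_eq_one ht0
  have := orderOf_dvd_of_pow_eq_one h6
  rw [h5] at this
  have := hp.two_le
  omega

theorem split_exists (p : ℕ) (hp : p.Prime) (h : p % 3 = 1) : ∃ u : ℤ × ℤ, nm u = p := by
  have : Fact p.Prime := ⟨hp⟩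
  obtain ⟨g, hg⟩ := exists_prime_orderOf_dvd_card (G := (ZMod p)ˣ) 3 (by
    rw [ZMod.card_units]; have := hp.two_le; omega)
  set t : ZMod p := (g : ZMod p) with ht
  have h3 : t ^ 3 = 1 := by
    have := pow_orderOf_eq_one g
    rw [hg] at this
    rw [ht, ← Units.val_pow_eq_pow_val, this, Units.val_one]
  have h4 : t - 1 ≠ 0 := by
    intro hh
    have : g = 1 := by ext; rw [Units.val_one]; linear_combination hh
    rw [this, orderOf_one] at hg
    omega
  have h5 : t ^ 2 + t + 1 = 0 := by
    have : (t - 1) * (t ^ 2 + t + 1) = 0 := by linear_combination h3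
    exact (mul_eq_zero.1 this).resolve_left h4
  set s := Nat.sqrt p with hs
  have hs1 : s * s ≤ p := Nat.sqrt_le p
  have hs2 : p < (s + 1) * (s + 1) := Nat.sqrt_lt.1 (Nat.lt_succ_self _)
  have hs3 : s * s ≠ p := by
    intro hh
    rcases (Nat.Prime.eq_one_or_self_of_dvd hp s ⟨s, hh.symm⟩) with h | h
    · have := hp.two_le; rw [h] at hh; omega
    · have := hp.two_le; rw [h] at hh; nlinarith
  obtain ⟨v, hv, w, hw, hne, he⟩ := Finset.exists_ne_map_eq_of_card_lt_of_maps_to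
    (s := Finset.range (s + 1) ×ˢ Finset.range (s + 1)) (t := (Finset.univ : Finset (ZMod p)))
    (by rw [Finset.card_product, Finset.card_range, Finset.card_univ, ZMod.card]; exact hs2)
    (f := fun v => (v.1 : ZMod p) - t * v.2) (fun _ _ => Finset.mem_coe.2 (Finset.mem_univ _))
  simp only [Finset.mem_product, Finset.mem_range] at hv hw
  set x : ℤ := v.1 - w.1 with hx
  set y : ℤ := v.2 - w.2 with hy
  have hxy : (p:ℤ) ∣ nm (x, y) := by
    rw [← ZMod.intCast_zmod_eq_zero_iff_dvd]
    simp only [nm, hx, hy]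
    push_cast
    have e : (v.1 : ZMod p) - w.1 = t * (v.2 - w.2) := by linear_combination he
    rw [e]
    linear_combination ((v.2 : ZMod p) - w.2) ^ 2 * h5
  have hpos : nm (x, y) ≠ 0 := by
    intro h0
    simp only [nm] at h0
    have hy0 : y = 0 := by
      have : y ^ 2 ≤ 0 := by nlinarith [sq_nonneg (2 * x + y)]
      exact pow_eq_zero_iff (two_ne_zero) |>.1 (le_antisymm this (sq_nonneg y))
    have hx0 : x = 0 := by
      rw [hy0] at h0
      exact pow_eq_zero_iff (two_ne_zero) |>.1 (by linarith)
    exact hne (Prod.ext (by omega) (by omega))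
  have hb : nm (x, y) < 3 * p := by
    have hxs : x * x ≤ s * s := by nlinarith [mul_nonneg (show 0 ≤ s - x by omega) (show 0 ≤ s + x by omega)]
    have hys : y * y ≤ s * s := by nlinarith [mul_nonneg (show 0 ≤ s - y by omega) (show 0 ≤ s + y by omega)]
    have hsp : (s * s : ℤ) < p := by exact_mod_cast lt_of_le_of_ne hs1 hs3
    simp only [nm]
    nlinarith [sq_nonneg (x - y)]
  obtain ⟨c, hc⟩ := hxy
  have hn := Nnn x y
  have hp0 : (0:ℤ) < p := by exact_mod_cast hp.pos
  have c1 : c < 3 := by simp only [nm] at *; nlinarith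
  have c2 : 0 < c := by simp only [nm] at *; rcases lt_trichotomy c 0 with h | h | h; (nlinarith); (rw [h] at hc; omega); exact h
  obtain rfl | rfl : c = 1 ∨ c = 2 := by omega
  · exact ⟨(x, y), by rw [hc]; ring⟩
  · exfalso
    simp only [nm] at hc
    have hp2 : (p:ℤ) % 2 = 1 := by
      rcases hp.eq_two_or_odd with h | h
      · omega
      · omega
    rcases Int.even_or_odd' x with ⟨a, ha | ha⟩ <;> rcases Int.even_or_odd' y with ⟨b, hb | hb⟩ <;> rw [ha, hb] at hc <;> ring_nf at hc <;> omega


end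

section

theorem nm_swap (x y : ℤ) : nm (y, x) = nm (x, y) := by simp only [nm]; ring

theorem nm_smul (p x y : ℤ) : nm (p * x, p * y) = p ^ 2 * nm (x, y) := by simp only [nm]; ring

/-- scaling -/
def scl (p : ℕ) (v : ℤ × ℤ) : ℤ × ℤ := ((p:ℤ) * v.1, (p:ℤ) * v.2)

theorem scl_inj (p : ℕ) (hp : p.Prime) : Function.Injective (scl p) := by
  intro v w h
  have hp0 : (p:ℤ) ≠ 0 := by exact_mod_cast hp.ne_zero
  simp only [scl, Prod.mk.injEq] at h
  exact Prod.ext (mul_left_cancel₀ hp0 h.1) (mul_left_cancel₀ hp0 h.2)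

/-- vectors of norm `p*k` divisible by `p` -/
theorem scl_card (p k : ℕ) (hp : p.Prime) (hk : 0 < k) (T : Finset (ℤ × ℤ))
    (hT : ∀ v, v ∈ T ↔ nm v = (p * k : ℕ) ∧ ∃ w, v = scl p w) :
    (T.card : ℤ) = if p ∣ k then ((Rf (k / p)).card : ℤ) else 0 := by
  have hp0 : (p:ℤ) ≠ 0 := by exact_mod_cast hp.ne_zero
  split_ifs with h
  · obtain ⟨k', rfl⟩ := h
    rw [Nat.mul_div_cancel_left _ hp.pos, ← Finset.card_image_of_injective (Rf k') (scl_inj p hp)]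
    congr 2
    ext v
    rw [hT, Finset.mem_image]
    constructor
    · rintro ⟨h1, w, rfl⟩
      refine ⟨w, ?_, rfl⟩
      rw [mem_Rf]
      rw [scl, nm_smul] at h1
      push_cast at h1
      exact mul_left_cancel₀ (pow_ne_zero 2 hp0) (by linarith)
    · rintro ⟨w, hw, rfl⟩
      rw [mem_Rf] at hw
      refine ⟨?_, w, rfl⟩
      rw [scl, nm_smul, hw]; push_cast; ring
  · rw [Finset.card_eq_zero.2]; · rfl
    rw [Finset.eq_empty_iff_forall_notMem]
    intro v hv
    rw [hT] at hv
    obtain ⟨h1, w, rfl⟩ := hv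
    rw [scl, nm_smul] at h1
    push_cast at h1
    apply h
    have : (p:ℤ) ∣ k := ⟨nm (w.1, w.2), mul_left_cancel₀ hp0 (by linarith)⟩
    exact_mod_cast this

theorem r_rec (p k : ℕ) (hp : p.Prime) (hk : 0 < k) :
    ((Rf (p * k)).card : ℤ) = (1 + ch p) * (Rf k).card - ch p * (if p ∣ k then ((Rf (k / p)).card : ℤ) else 0) := by
  have hp0 : (p:ℤ) ≠ 0 := by exact_mod_cast hp.ne_zero
  have hpi : Prime (p:ℤ) := Nat.prime_iff_prime_int.mp hp
  have h3 : p % 3 = 0 ∨ p % 3 = 1 ∨ p % 3 = 2 := by omega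
  rcases h3 with h3 | h3 | h3
  · have hp3 : p = 3 := ((Nat.prime_dvd_prime_iff_eq Nat.prime_three hp).1 (Nat.dvd_of_mod_eq_zero h3)).symm
    subst hp3
    have hc : ch 3 = 0 := by simp [ch]
    rw [hc, add_zero, one_mul, zero_mul, sub_zero]
    have hu : nm (-1, 2) = 3 := by simp [nm]
    rw [← Finset.card_image_of_injective (Rf k) (mu_inj (-1, 2) (by rw [hu]; norm_num))]
    congr 2
    ext v
    rw [mem_Rf, Finset.mem_image]
    constructor
    · intro h
      push_cast at h
      obtain ⟨w, rfl⟩ := mu_div 3 hp (-1, 2) v (by rw [hu]; norm_num) ⟨k, by rw [h]; norm_num⟩ (by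
        have e : nm v = (v.1 - v.2) * (v.1 - v.2) + 3 * (v.1 * v.2) := by simp only [nm]; ring
        have : (3:ℤ) ∣ (v.1 - v.2) * (v.1 - v.2) := ⟨k - v.1 * v.2, by linarith⟩
        have := hpi.dvd_or_dvd (by exact_mod_cast this)
        push_cast at *
        omega)
      refine ⟨w, ?_, rfl⟩
      rw [nm_mu, hu] at h
      rw [mem_Rf]; linarith
    · rintro ⟨w, hw, rfl⟩
      rw [mem_Rf] at hw
      rw [nm_mu, hw, hu]; push_cast; ring
  · have hc : ch p = 1 := by simp [ch, h3]
    rw [hc, one_mul]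
    obtain ⟨u, hu⟩ := split_exists p hp h3
    have hu' : nm (cj u) = p := by rw [nm_cj, hu]
    have hub : ¬ (p:ℤ) ∣ u.2 := by
      intro hd
      have : (p:ℤ) ∣ u.1 := by
        apply hpi.dvd_of_dvd_pow (n := 2)
        have : u.1 ^ 2 = p - u.2 * (u.1 + u.2) := by rw [← hu]; simp only [nm]; ring
        rw [this]; exact dvd_sub (dvd_refl _) (Dvd.dvd.mul_right hd _)
      obtain ⟨a, ha⟩ := this
      obtain ⟨b, hb⟩ := hd
      have h1 : nm u = p ^ 2 * nm (a, b) := by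
        rw [← nm_smul, ← ha, ← hb]
      rw [hu] at h1
      have h2 : (1:ℤ) = p * nm (a, b) := mul_left_cancel₀ hp0 (by linarith)
      exact hpi.not_isUnit (isUnit_of_dvd_one ⟨_, h2⟩)
    have hu3 : ¬ (p:ℤ) ∣ 2 * u.1 + u.2 := by
      intro hd
      have h1 : (p:ℤ) ∣ 3 * u.2 ^ 2 := by
        have : 3 * u.2 ^ 2 = p * 4 - (2 * u.1 + u.2) * (2 * u.1 + u.2) := by rw [← hu]; simp only [nm]; ring
        rw [this]; exact dvd_sub (Dvd.intro _ rfl) (Dvd.dvd.mul_right hd _)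
      rcases hpi.dvd_or_dvd h1 with h | h
      · have : p ∣ 3 := by exact_mod_cast h
        have := (Nat.prime_dvd_prime_iff_eq hp Nat.prime_three).1 this
        omega
      · exact hub (hpi.dvd_of_dvd_pow h)
    set A := (Rf k).image (mu u) with hA
    set B := (Rf k).image (mu (cj u)) with hB
    have mA : ∀ v, v ∈ A ↔ nm v = (p * k : ℕ) ∧ ∃ w, v = mu u w := by
      intro v
      rw [hA, Finset.mem_image]
      constructor
      · rintro ⟨w, hw, rfl⟩
        rw [mem_Rf] at hw
        exact ⟨by rw [nm_mu, hw, hu]; push_cast; ring, w, rfl⟩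
      · rintro ⟨h, w, rfl⟩
        refine ⟨w, ?_, rfl⟩
        rw [nm_mu, hu] at h; push_cast at h
        rw [mem_Rf]; exact mul_left_cancel₀ hp0 h
    have mB : ∀ v, v ∈ B ↔ nm v = (p * k : ℕ) ∧ ∃ w, v = mu (cj u) w := by
      intro v
      rw [hB, Finset.mem_image]
      constructor
      · rintro ⟨w, hw, rfl⟩
        rw [mem_Rf] at hw
        exact ⟨by rw [nm_mu, hw, hu']; push_cast; ring, w, rfl⟩
      · rintro ⟨h, w, rfl⟩
        refine ⟨w, ?_, rfl⟩
        rw [nm_mu, hu'] at h; push_cast at h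
        rw [mem_Rf]; exact mul_left_cancel₀ hp0 h
    have hU : Rf (p * k) = A ∪ B := by
      ext v
      rw [mem_Rf, Finset.mem_union, mA, mB]
      constructor
      · intro h
        have hd : (p:ℤ) ∣ nm v := ⟨k, by rw [h]; push_cast; ring⟩
        have h1 : (p:ℤ) ∣ (u.2 * v.1 - u.1 * v.2) * (u.2 * v.1 + (u.1 + u.2) * v.2) := by
          have e : (u.2 * v.1 - u.1 * v.2) * (u.2 * v.1 + (u.1 + u.2) * v.2) = nm v * u.2 ^ 2 - p * v.2 ^ 2 := by
            rw [← hu]; simp only [nm]; ring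
          rw [e]; exact dvd_sub (Dvd.dvd.mul_right hd _) (Dvd.intro _ rfl)
        rcases hpi.dvd_or_dvd h1 with h2 | h2
        · exact Or.inl ⟨h, mu_div p hp u v hu hd h2⟩
        · refine Or.inr ⟨h, mu_div p hp (cj u) v hu' hd ?_⟩
          have e : (cj u).2 * v.1 - (cj u).1 * v.2 = -(u.2 * v.1 + (u.1 + u.2) * v.2) := by simp only [cj]; ring
          rw [e]; exact dvd_neg.2 h2
      · rintro (h | h) <;> exact h.1
    have hI := scl_card p k hp hk (A ∩ B) (by
      intro v
      rw [Finset.mem_inter, mA, mB]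
      constructor
      · rintro ⟨⟨h, w, hw⟩, _, w', hw'⟩
        refine ⟨h, ?_⟩
        have d1 : (p:ℤ) ∣ u.2 * v.1 - u.1 * v.2 := by rw [← hu, hw]; exact mu_dvd u w
        have d2 : (p:ℤ) ∣ (cj u).2 * v.1 - (cj u).1 * v.2 := by rw [← hu', hw']; exact mu_dvd (cj u) w'
        have d3 : (p:ℤ) ∣ (2 * u.1 + u.2) * v.2 := by
          have := dvd_add d1 d2
          have e : (2 * u.1 + u.2) * v.2 = -(u.2 * v.1 - u.1 * v.2 + ((cj u).2 * v.1 - (cj u).1 * v.2)) := by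
            simp only [cj]; ring
          rw [e]; exact dvd_neg.2 this
        have d4 : (p:ℤ) ∣ v.2 := (hpi.dvd_or_dvd d3).resolve_left hu3
        have d5 : (p:ℤ) ∣ v.1 := by
          have : (p:ℤ) ∣ u.2 * v.1 := by
            have := dvd_add d1 (Dvd.dvd.mul_left d4 u.1)
            rwa [sub_add_cancel] at this
          exact (hpi.dvd_or_dvd this).resolve_left hub
        obtain ⟨a, ha⟩ := d5
        obtain ⟨b, hb⟩ := d4
        exact ⟨(a, b), Prod.ext ha hb⟩
      · rintro ⟨h, w, rfl⟩
        refine ⟨⟨h, mu (cj u) w, ?_⟩, h, mu u w, ?_⟩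
        · rw [mu_cj', hu]; rfl
        · rw [mu_cj, hu]; rfl)
    have hcard := Finset.card_union_add_card_inter A B
    rw [← hU, hA, Finset.card_image_of_injective _ (mu_inj u (by rw [hu]; exact hp0)), hB,
      Finset.card_image_of_injective _ (mu_inj (cj u) (by rw [hu']; exact hp0)), ← hA, ← hB] at hcard
    have hcard : ((Rf (p * k)).card : ℤ) + (A ∩ B).card = (Rf k).card + (Rf k).card := by exact_mod_cast hcard
    rw [hI] at hcard
    linarith
  · have hc : ch p = -1 := by simp [ch, h3]
    rw [hc]
    have := scl_card p k hp hk (Rf (p * k)) (by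
      intro v
      rw [mem_Rf]
      refine ⟨fun h => ⟨h, ?_⟩, fun h => h.1⟩
      have hd : (p:ℤ) ∣ nm v := ⟨k, by rw [h]; push_cast; ring⟩
      obtain ⟨b, hb⟩ := inert p hp h3 v.1 v.2 hd
      obtain ⟨a, ha⟩ := inert p hp h3 v.2 v.1 (by rw [nm_swap]; exact hd)
      exact ⟨(a, b), Prod.ext ha hb⟩)
    rw [this]; ring

theorem r_one : (Rf 1).card = 6 := by
  have : Rf 1 = {(1, 0), (-1, 0), (0, 1), (0, -1), (1, -1), (-1, 1)} := by
    ext ⟨x, y⟩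
    rw [mem_Rf]
    constructor
    · intro h
      have hb := Nbd x y 1 (by simp only [nm] at h; push_cast at h; omega)
      simp only [abs_le] at hb
      have h1 : -1 ≤ x ∧ x ≤ 1 := by simp only [nm] at h; push_cast at h; constructor <;> nlinarith [sq_nonneg (x + 2 * y)]
      have h2 : -1 ≤ y ∧ y ≤ 1 := by simp only [nm] at h; push_cast at h; constructor <;> nlinarith [sq_nonneg (2 * x + y)]
      obtain ⟨h1, h1'⟩ := h1
      obtain ⟨h2, h2'⟩ := h2
      interval_cases x <;> interval_cases y <;> simp_all [nm]
    · intro h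
      simp only [Finset.mem_insert, Finset.mem_singleton, Prod.mk.injEq] at h
      rcases h with ⟨rfl, rfl⟩ | ⟨rfl, rfl⟩ | ⟨rfl, rfl⟩ | ⟨rfl, rfl⟩ | ⟨rfl, rfl⟩ | ⟨rfl, rfl⟩ <;> simp [nm]
  rw [this]; rfl

theorem r_zero : (Rf 0).card = 1 := by
  have : Rf 0 = {(0, 0)} := by
    ext ⟨x, y⟩
    rw [mem_Rf, Finset.mem_singleton, Prod.mk.injEq]
    constructor
    · intro h
      simp only [nm] at h; push_cast at h
      have h1 : x ^ 2 ≤ 0 := by nlinarith [sq_nonneg (x + 2 * y)]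
      have h2 : y ^ 2 ≤ 0 := by nlinarith [sq_nonneg (2 * x + y)]
      exact ⟨pow_eq_zero_iff (two_ne_zero) |>.1 (le_antisymm h1 (sq_nonneg x)), pow_eq_zero_iff (two_ne_zero) |>.1 (le_antisymm h2 (sq_nonneg y))⟩
    · rintro ⟨rfl, rfl⟩; simp [nm]
  rw [this]; rfl

theorem r_six (k : ℕ) (hk : 0 < k) : ((Rf k).card : ℤ) = 6 * rho k := by
  induction k using Nat.strong_induction_on with
  | _ k ih =>
  rcases eq_or_ne k 1 with rfl | h1
  · rw [r_one]; simp [rho, ch]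
  · have hp := Nat.minFac_prime h1
    obtain ⟨k', hk'⟩ := Nat.minFac_dvd k
    set p := k.minFac with hpd
    have hk0 : 0 < k' := by
      rcases Nat.eq_zero_or_pos k' with h | h
      · rw [h] at hk'; omega
      · exact h
    have hlt : k' < k := by
      have := hp.two_le
      rw [hk']; nlinarith
    rw [hk', r_rec p k' hp hk0, rho_rec p k' hp hk0, ih k' hlt hk0]
    split_ifs with hd
    · rw [ih (k' / p) (lt_of_le_of_lt (Nat.div_le_self _ _) hlt) (Nat.div_pos (Nat.le_of_dvd hk0 hd) hp.pos)]
      ring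
    · ring


end

section

theorem HF.finset_one {ι : Type*} (T : Finset ι) (P : ι → Prop) [DecidablePred P] (h : ∀ i, i ∈ T ↔ P i) :
    HF (fun i => if P i then (1:ℝ) else 0) T.card := by
  refine (HF.of_finset (g := fun i => if P i then (1:ℝ) else 0) T (fun i hi => by rw [if_neg (fun hh => hi ((h i).2 hh))])).congr
    (fun _ => rfl) ?_
  rw [Finset.sum_congr rfl (fun i hi => if_pos ((h i).1 hi))]
  simp

theorem rep_nm (K : ℕ) : Rep K nm (fun _ => 1) (fun M => ((Rf M).card : ℝ)) :=
  ⟨fun v _ => Nnn v.1 v.2, fun M _ => HF.finset_one _ _ (mem_Rf M)⟩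

theorem rep_nm3 (K : ℕ) : Rep K (fun v => 3 * nm v) (fun _ => 1) (fun M => if 3 ∣ M then ((Rf (M / 3)).card : ℝ) else 0) := by
  refine ⟨fun v _ => mul_nonneg (by norm_num) (Nnn v.1 v.2), fun M _ => ?_⟩
  dsimp only
  split_ifs with h
  · refine HF.finset_one _ _ fun v => ?_
    rw [mem_Rf]; omega
  · refine HF.zero.congr (fun v => ?_) rfl
    rw [if_neg (by omega)]

/-- cast of pairs -/
def cpr : ℕ × ℕ ↪ ℤ × ℤ := ⟨fun u => ((u.1:ℤ), (u.2:ℤ)), fun u v h => by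
  simp only [Prod.mk.injEq] at h; exact Prod.ext (by exact_mod_cast h.1) (by exact_mod_cast h.2)⟩
theorem cpr_ap (a b : ℕ) : cpr (a, b) = ((a:ℤ), (b:ℤ)) := rfl

theorem rep_rho (K : ℕ) : Rep K (fun v : ℤ × ℤ => v.1 * v.2) (fun v => if 0 < v.1 ∧ 0 < v.2 then ((ch (rs v.1) : ℤ) : ℝ) else 0)
    (fun M => ((rho M : ℤ) : ℝ)) := by
  refine ⟨?_, ?_⟩
  · rintro ⟨x, y⟩ h
    dsimp only at *
    split_ifs at h with h1
    · exact (mul_pos h1.1 h1.2).le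
    · exact absurd rfl h
  · intro M _
    dsimp only
    have := HF.of_finset (g := fun v : ℤ × ℤ => if v.1 * v.2 = M then (if 0 < v.1 ∧ 0 < v.2 then ((ch (rs v.1) : ℤ) : ℝ) else 0) else 0)
      (M.divisorsAntidiagonal.map cpr) (by
        rintro ⟨x, y⟩ hi
        dsimp only
        split_ifs with h1 h2
        · exfalso
          apply hi
          rw [Finset.mem_map]
          refine ⟨(x.toNat, y.toNat), ?_, ?_⟩
          · rw [Nat.mem_divisorsAntidiagonal]
            have : ((x.toNat * y.toNat : ℕ) : ℤ) = M := by
              push_cast; rw [Int.toNat_of_nonneg h2.1.le, Int.toNat_of_nonneg h2.2.le, h1]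
            refine ⟨by exact_mod_cast this, ?_⟩
            have := mul_pos h2.1 h2.2
            omega
          · rw [cpr_ap, Prod.mk.injEq]; omega
        · rfl
        · rfl)
    refine this.congr (fun _ => rfl) ?_
    rw [Finset.sum_map]
    unfold rho
    rw [← Nat.sum_divisorsAntidiagonal (fun a _ => ch a)]
    push_cast
    refine Finset.sum_congr rfl ?_
    rintro ⟨d, c⟩ hu
    obtain ⟨hd0, hc0, hm⟩ := div_pos' hu
    dsimp only at hd0 hc0 hm
    change (if (d:ℤ) * c = M then (if 0 < (d:ℤ) ∧ 0 < (c:ℤ) then ((ch (rs d) : ℤ) : ℝ) else 0) else 0) = ((ch d : ℤ) : ℝ)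
    rw [if_pos (by exact_mod_cast hm), if_pos (by constructor <;> exact_mod_cast (by assumption))]
    congr 1
    have : rs (d:ℤ) = d % 3 := by unfold rs; omega
    rw [this]
    simp [ch]

theorem rep_rho3 (K : ℕ) : Rep K (fun v : ℤ × ℤ => v.1 * v.2) (fun v => if (v.1 * v.2) % 3 = 0 then (if 0 < v.1 ∧ 0 < v.2 then ((ch (rs v.1) : ℤ) : ℝ) else 0) else 0)
    (fun M => if 3 ∣ M then ((rho M : ℤ) : ℝ) else 0) := by
  have h0 := rep_rho K
  refine ⟨?_, ?_⟩
  · intro v hv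
    refine h0.1 v ?_
    intro hh
    apply hv
    dsimp only at hh ⊢
    rw [hh, ite_self]
  · intro M hM
    have h1 := h0.2 M hM
    dsimp only at h1 ⊢
    split_ifs with h
    · refine h1.congr (fun v => ?_) rfl
      by_cases hv : v.1 * v.2 = M
      · rw [if_pos hv, if_pos hv, if_pos (by omega)]
      · rw [if_neg hv, if_neg hv]
    · refine HF.zero.congr (fun v => ?_) rfl
      by_cases hv : v.1 * v.2 = M
      · rw [if_pos hv, if_neg (by omega)]
      · rw [if_neg hv]

theorem tA_eq (x y z w : ℤ) : tA x y z w = if (z * w) % 3 = 0 then ((ch (rs x) : ℤ) : ℝ) * ((ch (rs z) : ℤ) : ℝ) * ((x * y - z * w : ℤ) : ℝ) else 0 := by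
  have hz : (rs z * rs w) % 3 = 0 ↔ (z * w) % 3 = 0 := by
    unfold rs
    rw [Int.mul_emod]
    have h1 : 0 ≤ z % 3 := Int.emod_nonneg _ (by norm_num)
    have h2 : z % 3 < 3 := Int.emod_lt_of_pos _ (by norm_num)
    have h3 : 0 ≤ w % 3 := Int.emod_nonneg _ (by norm_num)
    have h4 : w % 3 < 3 := Int.emod_lt_of_pos _ (by norm_num)
    interval_cases z % 3 <;> interval_cases w % 3 <;> decide
  unfold tA qev ta
  by_cases h : (z * w) % 3 = 0
  · simp only [if_pos h, if_pos (hz.2 h), List.getD_cons_zero, List.getD_cons_succ]; push_cast; ring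
  · simp only [if_neg h, if_neg (fun hh => h (hz.1 hh))]; push_cast; ring

theorem s_val (n : ℕ) : HN n (fun x y z w => ind (Pos4 x y z w) (tA x y z w))
    (∑ ab ∈ Finset.HasAntidiagonal.antidiagonal n, ((ab.1:ℝ) - ab.2) * (((rho ab.1 : ℤ) : ℝ) * (if 3 ∣ ab.2 then ((rho ab.2 : ℤ) : ℝ) else 0))) := by
  have h := (rep_rho n).conv (rep_rho3 n) (fun a b => (a:ℝ) - b) n le_rfl
  have h2 := h.equiv (Equiv.prodAssoc ℤ ℤ (ℤ × ℤ)).symm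
  refine HF.congr h2 ?_ (by push_cast; rfl)
  rintro ⟨x, y, z, w⟩
  simp only [Equiv.prodAssoc_symm_apply]
  refine ite_eq2 Iff.rfl fun _ => ?_
  rw [tA_eq]
  unfold ind
  by_cases hp : Pos4 x y z w
  · rw [if_pos hp]
    unfold Pos4 at hp
    rw [if_pos (show 0 < x ∧ 0 < y from ⟨by tauto, by tauto⟩), if_pos (show 0 < z ∧ 0 < w from ⟨by tauto, by tauto⟩)]
    split_ifs
    · push_cast; ring
    · ring
  · rw [if_neg hp]
    unfold Pos4 at hp
    by_cases h1 : 0 < x ∧ 0 < y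
    · rw [if_neg (show ¬ (0 < z ∧ 0 < w) by tauto)]; simp
    · rw [if_neg h1]; ring

open PowerSeries in
theorem link (N : ℕ) (s : ℝ) (hs : HN ((3 * N + 1 : ℕ) : ℤ) (fun x y z w => ind (Pos4 x y z w) (tA x y z w)) s) :
    ((coeff N (PP N ^ 8) : ℤ) : ℝ) = (3 * N + 1) * ((rho (3 * N + 1) : ℤ) : ℝ) + 6 * s := by
  have e1 := hs.unique (s_val _)
  have h := (rep_nm (3 * N + 1)).conv (rep_nm3 (3 * N + 1)) (fun a b => (a:ℝ) - b) (3 * N + 1) le_rfl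
  have e2 := (T6 N).unique (h.congr (fun v => by
    push_cast
    refine ite_eq2 Iff.rfl fun _ => ?_
    push_cast; ring) rfl)
  have e3 : ∑ ab ∈ Finset.HasAntidiagonal.antidiagonal (3 * N + 1), (((ab.1 : ℤ) : ℝ) - ((ab.2 : ℤ) : ℝ)) *
      (((Rf ab.1).card : ℝ) * (if 3 ∣ ab.2 then ((Rf (ab.2 / 3)).card : ℝ) else 0)) =
      ∑ ab ∈ Finset.HasAntidiagonal.antidiagonal (3 * N + 1), (36 * (((ab.1:ℝ) - ab.2) * (((rho ab.1 : ℤ) : ℝ) * (if 3 ∣ ab.2 then ((rho ab.2 : ℤ) : ℝ) else 0)))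
        + if ab.2 = 0 then 6 * (3 * N + 1) * ((rho (3 * N + 1) : ℤ) : ℝ) else 0) := by
    refine Finset.sum_congr rfl ?_
    rintro ⟨a, b⟩ hab
    rw [Finset.HasAntidiagonal.mem_antidiagonal] at hab
    dsimp only at hab ⊢
    by_cases hd : 3 ∣ b
    · have ha : 0 < a := by omega
      have r1 : ((Rf a).card : ℝ) = 6 * ((rho a : ℤ) : ℝ) := by exact_mod_cast r_six a ha
      rw [if_pos hd, if_pos hd, r1]
      rcases Nat.eq_zero_or_pos b with hb | hb
      · subst hb
        rw [if_pos rfl, Nat.zero_div, r_zero]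
        have : a = 3 * N + 1 := by omega
        subst this
        simp [rho]; ring
      · rw [if_neg (by omega)]
        obtain ⟨c, rfl⟩ := hd
        have r2 : ((Rf c).card : ℝ) = 6 * ((rho c : ℤ) : ℝ) := by exact_mod_cast r_six c (by omega)
        rw [Nat.mul_div_cancel_left _ (by norm_num), r2, rho_three c (by omega)]
        push_cast; ring
    · rw [if_neg hd, if_neg hd, if_neg (by rintro rfl; simp at hd)]; ring
  rw [e3, Finset.sum_add_distrib, ← Finset.mul_sum, ← e1, Finset.sum_eq_single (3 * N + 1, 0)] at e2
  · rw [if_pos rfl] at e2; linarith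
  · rintro ⟨a, b⟩ hab hne
    rw [Finset.HasAntidiagonal.mem_antidiagonal] at hab
    dsimp only at hab ⊢
    rw [if_neg]
    rintro rfl
    exact hne (by rw [Prod.mk.injEq]; omega)
  · intro hh
    exact absurd (by rw [Finset.HasAntidiagonal.mem_antidiagonal]; rfl) hh


end


theorem PP_eq (n : ℕ) : ∏ k ∈ Finset.Icc 1 n, (1 - (PowerSeries.X : PowerSeries ℤ) ^ k) ^ 8 = PP n ^ 8 := by
  unfold PP
  rw [Finset.prod_pow, Finset.range_eq_Ico, Finset.prod_Ico_add' (fun k => (1 - (PowerSeries.X : PowerSeries ℤ) ^ k)) 0 n 1]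
  congr 1

theorem eta_PP (N : ℕ) : etaCoeff (3 * N + 1) = PowerSeries.coeff N (PP N ^ 8) := by
  unfold etaCoeff
  rw [Polynomial.coeff_X_mul]
  have h1 : (∏ k ∈ Finset.Icc 1 (3 * N + 1), (1 - Polynomial.X ^ (3 * k)) ^ 8 : Polynomial ℤ) =
      Polynomial.expand ℤ 3 (∏ k ∈ Finset.Icc 1 (3 * N + 1), (1 - Polynomial.X ^ k) ^ 8) := by
    rw [map_prod]
    refine Finset.prod_congr rfl fun k _ => ?_
    simp [pow_mul]
  rw [h1, Polynomial.coeff_expand_mul' (by norm_num), ← Polynomial.coeff_coe]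
  have h2 : ((∏ k ∈ Finset.Icc 1 (3 * N + 1), (1 - Polynomial.X ^ k) ^ 8 : Polynomial ℤ) : PowerSeries ℤ)
      = PP (3 * N + 1) ^ 8 := by
    rw [← PP_eq, ← Polynomial.coeToPowerSeries.ringHom_apply, map_prod]
    refine Finset.prod_congr rfl fun k _ => ?_
    simp
  rw [h2]
  have h3 := PP_cong N (2 * N + 1)
  rw [show N + (2 * N + 1) = 3 * N + 1 by ring] at h3
  have h4 := h3.trans (sub_dvd_pow_sub_pow (PP (3 * N + 1)) (PP N) 8)
  have h5 := (PowerSeries.X_pow_dvd_iff.mp h4) N (by omega)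
  rw [map_sub] at h5
  linarith

theorem sum_uv (n : ℕ) (f : ℕ → ℝ) : ∑ u ∈ n.divisorsAntidiagonal, (f u.1 + f u.2) = 2 * ∑ d ∈ n.divisors, f d := by
  rw [Finset.sum_add_distrib, Nat.sum_divisorsAntidiagonal (fun a _ => f a),
    Nat.sum_divisorsAntidiagonal' (fun _ b => f b)]
  ring

theorem HH0_eq (n : ℕ) {s : ℝ} (h : HF (fun t : ℤ => f3 t * hurwitzClassNumber (4 * n - t ^ 2)) s) : HH 2 0 3 n = s := by
  rw [← h.2]
  unfold HH
  refine finsum_congr fun t => ?_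
  unfold f3
  by_cases ht : t % 3 = 0 <;> simp [ht]

theorem HHm_eq (n : ℕ) {s T : ℝ} (h : HF (fun t : ℤ => f3 t * hurwitzClassNumber (4 * n - t ^ 2)) s)
    (hT : HF (fun t : ℤ => (t:ℝ) ^ 2 * hurwitzClassNumber (4 * n - t ^ 2)) T) (m : ℤ) (hm : m = 1 ∨ m = 2) :
    HH 2 m 3 n = (T - s) / 2 := by
  have key : ∀ m : ℤ, ∃ x, HF (fun t : ℤ => if t % 3 = m then (t:ℝ) ^ 2 * hurwitzClassNumber (4 * n - t ^ 2) else 0) x := by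
    intro m
    refine ⟨_, hT.1.subset ?_, rfl⟩
    intro t ht hh
    apply ht
    simp only at hh ⊢
    rw [hh, ite_self]
  obtain ⟨x, hx⟩ := key 1
  obtain ⟨y, hy⟩ := key 2
  have e1 : x = y := by
    have := hx.equiv (Equiv.neg ℤ)
    refine HF.unique (this.congr (fun t => ?_) rfl) hy
    simp only [Equiv.neg_apply]
    have : (-t) % 3 = 1 ↔ t % 3 = 2 := by omega
    simp only [this, neg_sq, Int.cast_neg]
  have e2 : x + y = T - s := by
    refine HF.unique ((hx.add hy).congr (fun t => ?_) rfl) (hT.sub h) |>.trans rfl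
    unfold f3
    have : t % 3 = 0 ∨ t % 3 = 1 ∨ t % 3 = 2 := by omega
    rcases this with h | h | h <;> simp [h]
  have e3 : HH 2 m 3 n = x := by
    rcases hm with rfl | rfl
    · rw [← hx.2]; rfl
    · rw [e1, ← hy.2]; rfl
  rw [e3]; linarith

theorem S0_one (n : ℕ) (hn : n % 3 = 1) : HF (fun t : ℤ => f3 t * hurwitzClassNumber (4 * n - t ^ 2))
    ((n:ℝ) / 2 * (∑ d ∈ n.divisors, (d:ℝ)) - (etaCoeff n : ℝ) / 2) := by
  obtain ⟨s, hs, h⟩ := S1 n hn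
  refine h.congr (fun _ => rfl) ?_
  obtain ⟨N, rfl⟩ : ∃ N, n = 3 * N + 1 := ⟨n / 3, by omega⟩
  have hl := link N s hs
  rw [← eta_PP] at hl
  have a1 := sum_uv (3 * N + 1) (fun d => (d:ℝ))
  have a2 := sum_uv (3 * N + 1) (fun d => (ch d:ℝ))
  have a3 : ((rho (3 * N + 1) : ℤ) : ℝ) = ∑ d ∈ (3 * N + 1).divisors, (ch d : ℝ) := by
    unfold rho; push_cast; rfl
  rw [hl, a3, Finset.sum_sub_distrib, ← Finset.sum_div, ← Finset.sum_div, ← Finset.mul_sum, ← Finset.mul_sum, a1, a2]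
  push_cast
  ring

noncomputable def mm (q : ℝ) (e r : ℕ) : ℝ := ∑ i ∈ Finset.range (r + 1), (min (q ^ i) (q ^ (r - i))) ^ e

theorem mm_step (q : ℝ) (hq : 1 ≤ q) (e r : ℕ) : mm q e (r + 2) = 2 + q ^ e * mm q e r := by
  unfold mm
  rw [Finset.sum_range_succ, Finset.sum_range_succ']
  have h1 : ∀ i ∈ Finset.range (r + 1), (min (q ^ (i + 1)) (q ^ (r + 2 - (i + 1)))) ^ e
      = q ^ e * (min (q ^ i) (q ^ (r - i))) ^ e := by
    intro i hi
    rw [Finset.mem_range] at hi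
    rw [show r + 2 - (i + 1) = (r - i) + 1 by omega, pow_succ', pow_succ', ← mul_min_of_nonneg _ _ (by linarith), mul_pow]
  rw [Finset.sum_congr rfl h1, ← Finset.mul_sum]
  have h2 : (1:ℝ) ≤ q ^ (r + 2) := one_le_pow₀ hq
  simp only [pow_zero, Nat.sub_zero, Nat.sub_self, min_eq_left h2, min_eq_right h2, one_pow]
  ring

theorem mm_odd (q : ℝ) (hq : 1 ≤ q) (e k : ℕ) : (q ^ e - 1) * mm q e (2 * k + 1) = 2 * ((q ^ e) ^ (k + 1) - 1) := by
  induction k with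
  | zero =>
    simp [mm, Finset.sum_range_succ, hq]; ring
  | succ k ih =>
    rw [show 2 * (k + 1) + 1 = 2 * k + 1 + 2 by ring, mm_step q hq]
    linear_combination (q ^ e) * ih

theorem mm_even (q : ℝ) (hq : 1 ≤ q) (e k : ℕ) : (q ^ e - 1) * mm q e (2 * k) = (q ^ e) ^ (k + 1) + (q ^ e) ^ k - 2 := by
  induction k with
  | zero => simp [mm]; ring
  | succ k ih =>
    rw [show 2 * (k + 1) = 2 * k + 2 by ring, mm_step q hq]
    linear_combination (q ^ e) * ih

theorem sum_min (p : ℕ) (hp : p.Prime) (r e : ℕ) :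
    ∑ u ∈ (p ^ r).divisorsAntidiagonal, min (u.1:ℝ) u.2 ^ e = mm p e r := by
  rw [Nat.sum_divisorsAntidiagonal (fun a b => min (a:ℝ) b ^ e), Nat.sum_divisors_prime_pow hp]
  unfold mm
  refine Finset.sum_congr rfl fun i hi => ?_
  rw [Finset.mem_range] at hi
  rw [Nat.pow_div (by omega) hp.pos]
  push_cast
  rfl

theorem sum_sig (p : ℕ) (hp : p.Prime) (r : ℕ) :
    ∑ d ∈ (p ^ r).divisors, (d:ℝ) = ((p:ℝ) ^ (r + 1) - 1) / ((p:ℝ) - 1) := by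
  rw [Nat.sum_divisors_prime_pow hp]
  push_cast
  have : (1:ℝ) < p := by exact_mod_cast hp.one_lt
  rw [geom_sum_eq (by linarith)]

theorem T_eq (n : ℕ) (hn : 0 < n) : HF (fun t : ℤ => (t:ℝ) ^ 2 * hurwitzClassNumber (4 * n - t ^ 2))
    (2 * n * (∑ d ∈ n.divisors, (d:ℝ)) - n * (∑ u ∈ n.divisorsAntidiagonal, min (u.1:ℝ) u.2 ^ 1)
      - ∑ u ∈ n.divisorsAntidiagonal, min (u.1:ℝ) u.2 ^ 3) := by
  refine (E2 n hn).congr (fun _ => rfl) ?_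
  have a1 := sum_uv n (fun d => (d:ℝ))
  simp only [pow_one]
  rw [Finset.sum_sub_distrib, Finset.sum_sub_distrib, ← Finset.mul_sum, ← Finset.mul_sum, a1]
  ring

theorem S0_two (n : ℕ) (hn : n % 3 = 2) : HF (fun t : ℤ => f3 t * hurwitzClassNumber (4 * n - t ^ 2))
    (n * (∑ d ∈ n.divisors, (d:ℝ)) - n * (∑ u ∈ n.divisorsAntidiagonal, min (u.1:ℝ) u.2 ^ 1)
      - ∑ u ∈ n.divisorsAntidiagonal, min (u.1:ℝ) u.2 ^ 3) := by
  refine (S2 n hn).congr (fun _ => rfl) ?_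
  have a1 := sum_uv n (fun d => (d:ℝ))
  simp only [pow_one]
  rw [Finset.sum_sub_distrib, Finset.sum_sub_distrib, ← Finset.sum_div, ← Finset.mul_sum, ← Finset.mul_sum, a1]
  ring

theorem pmod (p : ℕ) (hp2 : p % 3 = 2) (k : ℕ) : p ^ (2 * k) % 3 = 1 ∧ p ^ (2 * k + 1) % 3 = 2 := by
  have : p ^ (2 * k) % 3 = 1 := by
    rw [pow_mul, Nat.pow_mod, Nat.pow_mod p, hp2]; simp
  exact ⟨this, by rw [pow_succ, Nat.mul_mod, this, hp2]⟩

/-- Corollary 1.3 (1), case `p ≡ 2 (mod 3)`: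
for a prime `p ≡ 2 (mod 3)` and `r ≥ 1`:
if `r` is even, `H_{2,0,3}(p^r) = (p^r/2)(p^{r+1}-1)/(p-1) - a(p^r)/2`;
if `r` is odd, `H_{2,0,3}(p^r) = -2(p^{(3r+3)/2}-1)/(p³-1) + p^r(p^{r+1}-1)/(p-1)`
`- 2p^r(p^{⌊(r+1)/2⌋}-1)/(p-1)`;
for `m ∈ {1,2}`: if `r` is even,
`H_{2,m,3}(p^r) = -(p^{3⌊r/2⌋+3}-1)/(p³-1) + (3p^r/4)(p^{r+1}-1)/(p-1)`
`- p^r(p^{⌊(r+1)/2⌋}-1)/(p-1) + a(p^r)/4`, and if `r` is odd,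
`H_{2,m,3}(p^r) = (p^r/2)(p^{r+1}-1)/(p-1)`. -/
theorem second_moment_prime_power_two_mod_three (p : ℕ) (hp : p.Prime)
    (hp2 : p % 3 = 2) (r : ℕ) (hr : 0 < r) :
    (Even r →
      HH 2 0 3 (p ^ r) =
        (p : ℝ) ^ r / 2 * (((p : ℝ) ^ (r + 1) - 1) / ((p : ℝ) - 1))
          - (etaCoeff (p ^ r) : ℝ) / 2)
    ∧ (Odd r →
      HH 2 0 3 (p ^ r) =
        -(2 * (((p : ℝ) ^ ((3 * r + 3) / 2) - 1) / ((p : ℝ) ^ 3 - 1)))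
          + (p : ℝ) ^ r * (((p : ℝ) ^ (r + 1) - 1) / ((p : ℝ) - 1))
          - 2 * (p : ℝ) ^ r * (((p : ℝ) ^ ((r + 1) / 2) - 1) / ((p : ℝ) - 1)))
    ∧ ∀ m : ℤ, m = 1 ∨ m = 2 →
        (Even r →
          HH 2 m 3 (p ^ r) =
            -(((p : ℝ) ^ (3 * (r / 2) + 3) - 1) / ((p : ℝ) ^ 3 - 1))
            + 3 * (p : ℝ) ^ r / 4 * (((p : ℝ) ^ (r + 1) - 1) / ((p : ℝ) - 1))
            - (p : ℝ) ^ r * (((p : ℝ) ^ ((r + 1) / 2) - 1) / ((p : ℝ) - 1))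
            + (etaCoeff (p ^ r) : ℝ) / 4)
        ∧ (Odd r →
          HH 2 m 3 (p ^ r) =
            (p : ℝ) ^ r / 2 * (((p : ℝ) ^ (r + 1) - 1) / ((p : ℝ) - 1))) := by

  have hq : (1:ℝ) < p := by exact_mod_cast hp.one_lt
  have hq1 : (p:ℝ) - 1 ≠ 0 := by linarith
  have hq3 : (p:ℝ) ^ 3 - 1 ≠ 0 := by
    have : (1:ℝ) < (p:ℝ) ^ 3 := one_lt_pow₀ hq (by norm_num)
    linarith
  have hT := T_eq (p ^ r) (pow_pos hp.pos r)
  rw [sum_min p hp, sum_min p hp, sum_sig p hp] at hT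
  rcases Nat.even_or_odd' r with ⟨k, rfl | rfl⟩
  · have h0 := S0_one (p ^ (2 * k)) (pmod p hp2 k).1
    rw [sum_sig p hp] at h0
    have ne : ¬ Odd (2 * k) := by simp
    have m1 : mm p 1 (2 * k) = ((p:ℝ) ^ (k + 1) + (p:ℝ) ^ k - 2) / ((p:ℝ) - 1) := by
      rw [eq_div_iff hq1]
      have := mm_even p hq.le 1 k
      rw [pow_one] at this
      linarith
    have m3 : mm p 3 (2 * k) = (((p:ℝ) ^ 3) ^ (k + 1) + ((p:ℝ) ^ 3) ^ k - 2) / ((p:ℝ) ^ 3 - 1) := by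
      rw [eq_div_iff hq3]
      have := mm_even p hq.le 3 k
      linarith
    refine ⟨fun _ => ?_, fun h => absurd h ne, fun m hm => ⟨fun _ => ?_, fun h => absurd h ne⟩⟩
    · rw [HH0_eq _ h0]; push_cast; ring
    · rw [HHm_eq _ h0 hT m hm, m1, m3]
      rw [show 2 * k / 2 = k by omega, show (2 * k + 1) / 2 = k by omega]
      push_cast
      have e1 : ((p:ℝ) ^ (k + 1) + (p:ℝ) ^ k - 2) / ((p:ℝ) - 1) = 2 * (((p:ℝ) ^ k - 1) / ((p:ℝ) - 1)) + (p:ℝ) ^ k := by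
        field_simp; ring
      have e3 : (((p:ℝ) ^ 3) ^ (k + 1) + ((p:ℝ) ^ 3) ^ k - 2) / ((p:ℝ) ^ 3 - 1)
          = 2 * (((p:ℝ) ^ (3 * k + 3) - 1) / ((p:ℝ) ^ 3 - 1)) - (p:ℝ) ^ (2 * k) * (p:ℝ) ^ k := by
        field_simp; ring
      rw [e1, e3]
      ring
  · have h0 := S0_two (p ^ (2 * k + 1)) (pmod p hp2 k).2
    rw [sum_min p hp, sum_min p hp, sum_sig p hp] at h0
    have ne : ¬ Even (2 * k + 1) := by simp
    have m1 : mm p 1 (2 * k + 1) = 2 * (((p:ℝ) ^ (k + 1) - 1) / ((p:ℝ) - 1)) := by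
      rw [← mul_div_assoc, eq_div_iff hq1]
      have := mm_odd p hq.le 1 k
      rw [pow_one] at this
      linarith
    have m3 : mm p 3 (2 * k + 1) = 2 * (((p:ℝ) ^ (3 * k + 3) - 1) / ((p:ℝ) ^ 3 - 1)) := by
      rw [← mul_div_assoc, eq_div_iff hq3]
      have := mm_odd p hq.le 3 k
      rw [← pow_mul, show 3 * (k + 1) = 3 * k + 3 by ring] at this
      linarith
    refine ⟨fun h => absurd h ne, fun _ => ?_, fun m hm => ⟨fun h => absurd h ne, fun _ => ?_⟩⟩
    · rw [HH0_eq _ h0, m1, m3]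
      rw [show (3 * (2 * k + 1) + 3) / 2 = 3 * k + 3 by omega, show (2 * k + 1 + 1) / 2 = k + 1 by omega]
      push_cast; ring
    · rw [HHm_eq _ h0 hT m hm]
      push_cast; ring

end HurwitzPaper
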